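/- Let M ⊆ ℂ^N be a connected Stein manifold of complex dimension n+1 (n ≥ 1), let B ⊆ ℂ^n be a connected open set, and let p : M → B be a surjective holomorphic submersion all of whose fibres are connected with the same finite first Betti number. Let M̃ be a Hausdorff topological space and π : M̃ → M a local homeomorphism such that for every b ∈ B the set π^{-1}(p^{-1}(b)) is nonempty, connected and simply connected, and the restriction π : π^{-1}(p^{-1}(b)) → p^{-1}(b) is a covering map (that is, π restricts over each fibre of p to its universal covering). Then π : M̃ → M is a covering map. -/

import Mathlib

open Filter Set Topology

noncomputable section

/-- The singular chain complex of a topological space, with `ℚ` coefficients: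
the alternating face map complex of the free simplicial `ℚ`-module on the
singular simplicial set. -/
def singularChainComplex (X : Type) [TopologicalSpace X] : ChainComplex (ModuleCat ℚ) ℕ :=
  (AlgebraicTopology.alternatingFaceMapComplex (ModuleCat ℚ)).obj
    (((CategoryTheory.SimplicialObject.whiskering (Type) (ModuleCat ℚ)).obj
      (ModuleCat.free ℚ)).obj (TopCat.toSSet.obj (TopCat.of X)))

/-- Singular homology of a topological space with `ℚ` coefficients. -/
def singularHomology (X : Type) [TopologicalSpace X] (i : ℕ) : ModuleCat ℚ :=
  (singularChainComplex X).homology i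

/-- The `i`-th Betti number: the dimension over `ℚ` of the `i`-th singular
homology with `ℚ` coefficients. -/
def bettiNumber (X : Type) [TopologicalSpace X] (i : ℕ) : ℕ :=
  Module.finrank ℚ (singularHomology X i)

/-- The `i`-th Betti number is finite. -/
def FiniteBetti (X : Type) [TopologicalSpace X] (i : ℕ) : Prop :=
  FiniteDimensional ℚ (singularHomology X i)

/-- `Φ` and `Ψ` give mutually inverse smooth maps between `S ⊆ E` and `T ⊆ F`,
i.e. a diffeomorphism between `S` and `T` (smoothness of a map on a subset is
expressed via `ContDiffOn`). -/
def IsDiffeoOn {E F : Type} [NormedAddCommGroup E] [NormedSpace ℝ E]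
    [NormedAddCommGroup F] [NormedSpace ℝ F]
    (Φ : E → F) (Ψ : F → E) (S : Set E) (T : Set F) : Prop :=
  ContDiffOn ℝ (⊤ : ℕ∞) Φ S ∧ ContDiffOn ℝ (⊤ : ℕ∞) Ψ T ∧ Set.MapsTo Φ S T ∧ Set.MapsTo Ψ T S ∧
    Set.LeftInvOn Ψ Φ S ∧ Set.RightInvOn Ψ Φ T

/-- `S` and `T` are diffeomorphic. -/
def DiffeoEquiv {E F : Type} [NormedAddCommGroup E] [NormedSpace ℝ E]
    [NormedAddCommGroup F] [NormedSpace ℝ F] (S : Set E) (T : Set F) : Prop :=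
  ∃ Φ Ψ, IsDiffeoOn Φ Ψ S T

/-- The restriction of `p` to `M` is a trivial smooth fibration over `D` with fibre
`p⁻¹(lam) ∩ M`: there is a diffeomorphism `Φ : M ∩ p⁻¹(D) → D × (M ∩ p⁻¹(lam))`
with `pr₁ ∘ Φ = p`. -/
def IsSmoothTrivialFibrationOn {E F : Type} [NormedAddCommGroup E] [NormedSpace ℝ E]
    [NormedAddCommGroup F] [NormedSpace ℝ F]
    (p : E → F) (M : Set E) (D : Set F) (lam : F) : Prop :=
  ∃ Φ : E → F × E, ∃ Ψ : F × E → E,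
    IsDiffeoOn Φ Ψ (M ∩ p ⁻¹' D) (D ×ˢ (M ∩ p ⁻¹' {lam})) ∧
    ∀ x ∈ M ∩ p ⁻¹' D, (Φ x).1 = p x

/-- `lam` is not a bifurcation value of `p : M → B`. -/
def IsNotBifurcationValueOn {E F : Type} [NormedAddCommGroup E] [NormedSpace ℝ E]
    [NormedAddCommGroup F] [NormedSpace ℝ F]
    (p : E → F) (M : Set E) (B : Set F) (lam : F) : Prop :=
  ∃ D : Set F, IsOpen D ∧ lam ∈ D ∧ D ⊆ B ∧ IsSmoothTrivialFibrationOn p M D lam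

/-- `g : V → ℂᵏ` is a holomorphic local defining function for `M` at `x`, with
surjective derivative at every point of its zero set. -/
def IsLocalDefiningFunction {E : Type} [NormedAddCommGroup E] [NormedSpace ℂ E]
    (k : ℕ) (M : Set E) (x : E) (V : Set E) (g : E → (Fin k → ℂ)) : Prop :=
  IsOpen V ∧ x ∈ V ∧ DifferentiableOn ℂ g V ∧
    (∀ y ∈ V, g y = 0 → Function.Surjective (fderiv ℂ g y)) ∧
    M ∩ V = {y ∈ V | g y = 0}

/-- `M ⊆ ℂᴺ` is a (Stein) closed complex submanifold of complex dimension `m`: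
it is closed and near each of its points it is the zero set of a holomorphic
submersion to `ℂ^{N-m}`. -/
def IsSteinSubmanifold (N m : ℕ) (M : Set (Fin N → ℂ)) : Prop :=
  IsClosed M ∧ ∀ x ∈ M, ∃ V g, IsLocalDefiningFunction (N - m) M x V g

/-- A holomorphic map `p` (defined near `M`) is a submersion at `x ∈ M`: its
derivative maps the tangent space `T_x M = ker (d_x g)` onto the target, where
`g` is a local defining function of `M` near `x` (of codimension `k`). -/
def SubmersionAt {E F : Type} [NormedAddCommGroup E] [NormedSpace ℂ E]
    [NormedAddCommGroup F] [NormedSpace ℂ F]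
    (k : ℕ) (M : Set E) (p : E → F) (x : E) : Prop :=
  ∃ V g, IsLocalDefiningFunction k M x V g ∧
    Submodule.map (fderiv ℂ p x).toLinearMap
      (LinearMap.ker (fderiv ℂ g x).toLinearMap) = ⊤

/-- A connected component of the fibres of `p : M → B` vanishes at infinity as
`t → lam`: there are `t k → lam` in `B` and connected components
`C k = connectedComponentIn (M ∩ p⁻¹(t k)) (x k)` of the fibres over `t k`
which eventually miss every compact subset. -/
def HasVanishingComponentAtInfinity {E F : Type} [TopologicalSpace E] [TopologicalSpace F]
    (M : Set E) (p : E → F) (B : Set F) (lam : F) : Prop :=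
  ∃ t : ℕ → F, ∃ x : ℕ → E,
    (∀ k, t k ∈ B) ∧ Filter.Tendsto t Filter.atTop (nhds lam) ∧
    (∀ k, x k ∈ M ∩ p ⁻¹' {t k}) ∧
    ∀ K : Set E, IsCompact K →
      ∀ᶠ k in Filter.atTop, connectedComponentIn (M ∩ p ⁻¹' {t k}) (x k) ∩ K = ∅

/-- `Φ` and `Ψ` give mutually inverse continuous maps between `S` and `T`,
i.e. a homeomorphism between `S` and `T`. -/
def IsHomeoOn {E F : Type} [TopologicalSpace E] [TopologicalSpace F]
    (Φ : E → F) (Ψ : F → E) (S : Set E) (T : Set F) : Prop :=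
  ContinuousOn Φ S ∧ ContinuousOn Ψ T ∧ Set.MapsTo Φ S T ∧ Set.MapsTo Ψ T S ∧
    Set.LeftInvOn Ψ Φ S ∧ Set.RightInvOn Ψ Φ T

/-- The Euler characteristic `b₀ - b₁` of the fibre of `p : M → ·` over `t`
(the fibres under consideration are open curves, with no homology in degrees ≥ 2). -/
def eulerCharOn {E F : Type} [TopologicalSpace E] (p : E → F) (M : Set E) (t : F) : ℤ :=
  (bettiNumber ↥(M ∩ p ⁻¹' {t}) 0 : ℤ) - (bettiNumber ↥(M ∩ p ⁻¹' {t}) 1 : ℤ)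


section
noncomputable section

/-- locally constant on a set -/
def LC {X S : Type*} [TopologicalSpace X] (V : Set X) (c : X → S) : Prop :=
  ∀ x ∈ V, ∀ᶠ u in 𝓝 x, c u = c x

def ZC {X : Type*} [TopologicalSpace X] (V : Set X) (φ : X → X → ℚ) : Prop :=
  ∀ x ∈ V, ∀ᶠ y in 𝓝 x, ∀ᶠ u in 𝓝 y, φ y u - φ y y = φ x u - φ x y

def Prim {X : Type*} [TopologicalSpace X] (V : Set X) (φ : X → X → ℚ) (f : X → ℚ) : Prop :=
  ∀ x ∈ V, ∀ᶠ u in 𝓝 x, φ x u - φ x x = f u - f x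

def BC {X : Type*} [TopologicalSpace X] (V : Set X) (φ : X → X → ℚ) : Prop :=
  ∃ f : X → ℚ, Prim V φ f

section A
variable {X : Type*} [TopologicalSpace X]

theorem LC.mono {S : Type*} {V W : Set X} {c : X → S} (h : LC V c) (hW : W ⊆ V) : LC W c :=
  fun x hx => h x (hW hx)
theorem ZC.mono {V W : Set X} {φ : X → X → ℚ} (h : ZC V φ) (hW : W ⊆ V) : ZC W φ :=
  fun x hx => h x (hW hx)
theorem Prim.mono {V W : Set X} {φ : X → X → ℚ} {f} (h : Prim V φ f) (hW : W ⊆ V) : Prim W φ f :=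
  fun x hx => h x (hW hx)
theorem BC.mono {V W : Set X} {φ : X → X → ℚ} (h : BC V φ) (hW : W ⊆ V) : BC W φ :=
  h.imp fun _ hf => hf.mono hW

theorem LC.const_of_preconn {S : Type*} {V : Set X} {c : X → S} (h : LC V c)
    (hV : IsPreconnected V) {x y : X} (hx : x ∈ V) (hy : y ∈ V) : c y = c x := by
  by_contra hne
  have hcl : ∀ z ∈ V, (∀ᶠ u in 𝓝 z, c u = c z) := h
  have := hV {z | ∀ᶠ u in 𝓝 z, c u = c x} {z | ∀ᶠ u in 𝓝 z, c u ≠ c x} ?_ ?_ ?_ ⟨x, hx, hcl x hx⟩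
    ⟨y, hy, ?_⟩
  · obtain ⟨z, hz, h1, h2⟩ := this
    exact h2.self_of_nhds h1.self_of_nhds
  · rw [isOpen_iff_mem_nhds]; intro z hz; exact eventually_eventually_nhds.2 hz
  · rw [isOpen_iff_mem_nhds]; intro z hz; exact eventually_eventually_nhds.2 hz
  · intro z hz
    by_cases hzx : c z = c x
    · left; have := hcl z hz; rw [hzx] at this; exact this
    · right; exact (hcl z hz).mono fun u hu => by rw [hu]; exact hzx
  · exact (hcl y hy).mono fun u hu => by rw [hu]; exact hne

theorem Prim.sub_LC {V : Set X} {φ : X → X → ℚ} {f g : X → ℚ} (hf : Prim V φ f)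
    (hg : Prim V φ g) : LC V (fun x => f x - g x) := by
  intro x hx
  filter_upwards [hf x hx, hg x hx] with u h1 h2
  linarith

theorem Prim.unique {V : Set X} {φ : X → X → ℚ} {f g : X → ℚ} (hf : Prim V φ f)
    (hg : Prim V φ g) (hV : IsPreconnected V) {x y : X} (hx : x ∈ V) (hy : y ∈ V) :
    f y - f x = g y - g x := by
  have := (hf.sub_LC hg).const_of_preconn hV hx hy
  linarith

theorem ZC.add {V : Set X} {φ ψ : X → X → ℚ} (h : ZC V φ) (h' : ZC V ψ) :
    ZC V (fun x u => φ x u + ψ x u) := by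
  intro x hx
  filter_upwards [h x hx, h' x hx] with y h1 h2
  filter_upwards [h1, h2] with u h3 h4
  linarith
theorem ZC.smul {V : Set X} {φ : X → X → ℚ} (h : ZC V φ) (a : ℚ) :
    ZC V (fun x u => a * φ x u) := by
  intro x hx
  filter_upwards [h x hx] with y h1
  filter_upwards [h1] with u h3
  linear_combination a * h3
theorem ZC.sum {ι : Type*} (s : Finset ι) {V : Set X} {φ : ι → X → X → ℚ} (a : ι → ℚ)
    (h : ∀ i ∈ s, ZC V (φ i)) : ZC V (fun x u => ∑ i ∈ s, a i * φ i x u) := by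
  classical
  induction s using Finset.induction_on with
  | empty => intro x hx; simp
  | insert i s hi ih =>
    simp only [Finset.sum_insert hi]
    exact ((h i (by simp)).smul (a i)).add (ih fun j hj => h j (by simp [hj]))
theorem Prim.add {V : Set X} {φ ψ : X → X → ℚ} {f g} (h : Prim V φ f) (h' : Prim V ψ g) :
    Prim V (fun x u => φ x u + ψ x u) (fun x => f x + g x) := by
  intro x hx
  filter_upwards [h x hx, h' x hx] with y h1 h2
  linarith
theorem Prim.smul {V : Set X} {φ : X → X → ℚ} {f} (h : Prim V φ f) (a : ℚ) :
    Prim V (fun x u => a * φ x u) (fun x => a * f x) := by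
  intro x hx
  filter_upwards [h x hx] with u h3
  linear_combination a * h3
theorem BC.add {V : Set X} {φ ψ : X → X → ℚ} : BC V φ → BC V ψ →
    BC V (fun x u => φ x u + ψ x u) := fun ⟨_, hf⟩ ⟨_, hg⟩ => ⟨_, hf.add hg⟩
theorem BC.smul {V : Set X} {φ : X → X → ℚ} (h : BC V φ) (a : ℚ) :
    BC V (fun x u => a * φ x u) := by obtain ⟨f, hf⟩ := h; exact ⟨_, hf.smul a⟩
theorem BC.sum {ι : Type*} (s : Finset ι) {V : Set X} {φ : ι → X → X → ℚ} (a : ι → ℚ)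
    (h : ∀ i ∈ s, BC V (φ i)) : BC V (fun x u => ∑ i ∈ s, a i * φ i x u) := by
  classical
  induction s using Finset.induction_on with
  | empty => exact ⟨fun _ => 0, fun x hx => by simp⟩
  | insert i s hi ih =>
    simp only [Finset.sum_insert hi]
    exact ((h i (by simp)).smul (a i)).add (ih fun j hj => h j (by simp [hj]))

theorem BC.congr {V : Set X} {φ ψ : X → X → ℚ} (h : BC V φ)
    (h' : ∀ x ∈ V, ∀ᶠ u in 𝓝 x, φ x u - φ x x = ψ x u - ψ x x) : BC V ψ := by
  obtain ⟨f, hf⟩ := h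
  refine ⟨f, fun x hx => ?_⟩
  filter_upwards [hf x hx, h' x hx] with u h1 h2
  rw [← h2, h1]

/-- pullback along a map continuous on an open set -/
theorem ZC.comp {Y : Type*} [TopologicalSpace Y] {V : Set X} {φ : X → X → ℚ} (h : ZC V φ)
    {W : Set Y} (hW : IsOpen W) {g : Y → X} (hg : ContinuousOn g W) (hm : MapsTo g W V) :
    ZC W (fun s t => φ (g s) (g t)) := by
  intro s hs
  have hc := fun s hs => hg.continuousAt (hW.mem_nhds (x := s) hs)
  filter_upwards [(hc s hs).eventually (h _ (hm hs)), hW.mem_nhds hs] with y hy hyW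
  exact (hc y hyW).eventually hy
theorem Prim.comp {Y : Type*} [TopologicalSpace Y] {V : Set X} {φ : X → X → ℚ} {f}
    (h : Prim V φ f)
    {W : Set Y} (hW : IsOpen W) {g : Y → X} (hg : ContinuousOn g W) (hm : MapsTo g W V) :
    Prim W (fun s t => φ (g s) (g t)) (f ∘ g) := by
  intro s hs
  exact (hg.continuousAt (hW.mem_nhds hs)).eventually (h _ (hm hs))

/-- extension by gluing -/
theorem glue_ext {V W : Set X} (hV : IsOpen V) (hW : IsOpen W) {φ : X → X → ℚ}
    (hφ : ZC V φ) {f : X → ℚ} (hf : Prim (V ∩ W) φ f) :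
    ∃ φ' : X → X → ℚ, ZC (V ∪ W) φ' ∧ (∀ x ∈ V, φ' x = φ x) ∧ (∀ x, x ∉ V → φ' x = f) := by
  classical
  refine ⟨fun x => if x ∈ V then φ x else f, ?_, fun x hx => by simp [hx], fun x hx => by simp [hx]⟩
  intro x hx
  by_cases hxV : x ∈ V
  · filter_upwards [hφ x hxV, hV.mem_nhds hxV] with y hy hyV
    simpa [hxV, hyV] using hy
  · have hxW : x ∈ W := hx.resolve_left hxV
    filter_upwards [hW.mem_nhds hxW] with y hyW
    by_cases hyV : y ∈ V
    · simpa [hxV, hyV] using hf y ⟨hyV, hyW⟩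
    · simp [hxV, hyV]

theorem MV_surj {V W : Set X} (hV : IsOpen V) (hW : IsOpen W)
    (hext : ∀ φ : X → X → ℚ, ZC (V ∪ W) φ → (∀ x ∈ V, φ x = 0) → BC (V ∪ W) φ)
    {c : X → ℚ} (hc : LC (V ∩ W) c) :
    ∃ f g : X → ℚ, LC V f ∧ LC W g ∧ ∀ x ∈ V ∩ W, c x = f x + g x := by
  have h0 : ZC V (0 : X → X → ℚ) := fun x hx => by simp
  obtain ⟨φ', h1, h2, h3⟩ := glue_ext hV hW h0 (f := c) (fun x hx =>
    (hc x hx).mono fun u hu => by simp [hu])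
  obtain ⟨F, hF⟩ := hext φ' h1 (fun x hx => by rw [h2 x hx]; rfl)
  have hFV : LC V F := by
    intro x hx
    have := hF x (Or.inl hx)
    rw [h2 x hx] at this
    exact this.mono fun u hu => by simp at hu; linarith
  refine ⟨F, fun x => c x - F x, hFV, ?_, fun x _ => by ring⟩
  intro x hx
  by_cases hxV : x ∈ V
  · filter_upwards [hFV x hxV, hc x ⟨hxV, hx⟩] with u h4 h5
    rw [h4, h5]
  · have := hF x (Or.inr hx)
    rw [h3 x hxV] at this
    exact this.mono fun u hu => by linarith

theorem BC_iUnion_preconn {V : ℕ → Set X} (hm : Monotone V)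
    (hp : ∀ k, IsPreconnected (V k)) (ho : ∀ k, IsOpen (V k)) {x0 : X}
    (h0 : ∀ k x, x ∈ V k → x0 ∈ V k) {φ : X → X → ℚ}
    (h : ∀ k, BC (V k) φ) : BC (⋃ k, V k) φ := by
  classical
  choose g hg using h
  have key : ∀ x k l, x ∈ V k → x ∈ V l → g k x - g k x0 = g l x - g l x0 := by
    have : ∀ k l, k ≤ l → ∀ x ∈ V k, g k x - g k x0 = g l x - g l x0 := fun k l hkl x hx =>
      (hg k).unique ((hg l).mono (hm hkl)) (hp k) (h0 k x hx) hx
    intro x k l hk hl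
    rcases le_total k l with h | h
    · exact this k l h x hk
    · exact (this l k h x hl).symm
  refine ⟨fun x => if hx : ∃ k, x ∈ V k then g hx.choose x - g hx.choose x0 else 0, ?_⟩
  intro x hx
  obtain ⟨k, hk⟩ := mem_iUnion.1 hx
  filter_upwards [hg k x hk, (ho k).mem_nhds hk] with u h1 h2
  have ex : ∃ k, x ∈ V k := ⟨k, hk⟩
  have eu : ∃ k, u ∈ V k := ⟨k, h2⟩
  rw [dif_pos ex, dif_pos eu, key x _ k ex.choose_spec hk, key u _ k eu.choose_spec h2, h1]
  ring

theorem BC_of_components [LocallyConnectedSpace X] {U : Set X} (hU : IsOpen U) {φ : X → X → ℚ}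
    (h : ∀ x ∈ U, BC (connectedComponentIn U x) φ) : BC U φ := by
  classical
  choose! g hg using h
  -- representative
  let r : X → X := fun x =>
    if h : ∃ z, z ∈ connectedComponentIn U x then h.choose else x
  have hr : ∀ x ∈ U, r x ∈ connectedComponentIn U x := fun x hx => by
    have : ∃ z, z ∈ connectedComponentIn U x := ⟨x, mem_connectedComponentIn hx⟩
    simp only [r, dif_pos this]; exact this.choose_spec
  have hrU : ∀ x ∈ U, r x ∈ U := fun x hx => connectedComponentIn_subset _ _ (hr x hx)
  have hreq : ∀ x u, u ∈ connectedComponentIn U x → x ∈ U → r u = r x := fun x u hu hx => by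
    have e : connectedComponentIn U u = connectedComponentIn U x := (connectedComponentIn_eq hu).symm
    have h1 : ∃ z, z ∈ connectedComponentIn U x := ⟨x, mem_connectedComponentIn hx⟩
    have h2 : ∃ z, z ∈ connectedComponentIn U u := by rw [e]; exact h1
    simp only [r, dif_pos h1, dif_pos h2]
    simp only [e]
  refine ⟨fun x => g (r x) x, fun x hx => ?_⟩
  have hx' : x ∈ connectedComponentIn U (r x) := by
    rw [← connectedComponentIn_eq (hr x hx)]; exact mem_connectedComponentIn hx
  filter_upwards [hg (r x) (hrU x hx) x hx',
    (hU.connectedComponentIn (x := x)).mem_nhds (mem_connectedComponentIn hx)] with u h1 h2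
  rw [hreq x u h2 hx, h1]

theorem iUnion_comp [LocallyConnectedSpace X] {V : ℕ → Set X} (hm : Monotone V)
    (ho : ∀ k, IsOpen (V k)) {x0 : X} (hx0 : ∃ k, x0 ∈ V k) :
    connectedComponentIn (⋃ k, V k) x0 = ⋃ k, connectedComponentIn (V k) x0 := by
  obtain ⟨k0, hk0⟩ := hx0
  have hmono : Monotone fun k => connectedComponentIn (V k) x0 := fun k l hkl =>
    connectedComponentIn_mono _ (hm hkl)
  apply subset_antisymm
  · have hpre : IsPreconnected (connectedComponentIn (⋃ k, V k) x0) := isPreconnected_connectedComponentIn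
    have hmemU : x0 ∈ ⋃ k, V k := mem_iUnion.2 ⟨k0, hk0⟩
    have hLC : LC (⋃ k, V k) (fun y => y ∈ ⋃ k, connectedComponentIn (V k) x0) := by
      intro y hy
      obtain ⟨k, hk⟩ := mem_iUnion.1 hy
      have hop := ((ho k).connectedComponentIn (x := y)).mem_nhds (mem_connectedComponentIn hk)
      filter_upwards [hop] with u hu
      have : ∀ l, k ≤ l → connectedComponentIn (V l) u = connectedComponentIn (V l) y := fun l hl =>
        (connectedComponentIn_eq (connectedComponentIn_mono _ (hm hl) hu)).symm
      have hiff : ∀ z ∈ ⋃ k, V k, (z ∈ ⋃ k, connectedComponentIn (V k) x0) ↔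
          ∃ l, k ≤ l ∧ x0 ∈ connectedComponentIn (V l) z := by
        intro z hz
        constructor
        · rintro hz'
          obtain ⟨l, hl⟩ := mem_iUnion.1 hz'
          refine ⟨max k l, le_max_left _ _, ?_⟩
          have h3 := hmono (le_max_right k l) hl
          have h3' : z ∈ connectedComponentIn (V (max k l)) x0 := h3
          have hxx : x0 ∈ V (max k l) := by
            by_contra hcon
            rw [connectedComponentIn_eq_empty hcon] at h3'
            exact h3'
          rw [← connectedComponentIn_eq h3']
          exact mem_connectedComponentIn hxx
        · rintro ⟨l, _, hl⟩
          refine mem_iUnion.2 ⟨l, ?_⟩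
          have hzl : z ∈ V l := by
            by_contra hcon
            rw [connectedComponentIn_eq_empty hcon] at hl
            exact hl
          rw [← connectedComponentIn_eq hl]
          exact mem_connectedComponentIn hzl
      have huU : u ∈ ⋃ k, V k := mem_iUnion.2 ⟨k, connectedComponentIn_subset _ _ hu⟩
      apply propext
      rw [hiff u huU, hiff y hy]
      constructor
      · rintro ⟨l, hl, h⟩; exact ⟨l, hl, by rwa [← this l hl]⟩
      · rintro ⟨l, hl, h⟩; exact ⟨l, hl, by rwa [this l hl]⟩
    intro y hy
    have := (hLC.mono (connectedComponentIn_subset _ _)).const_of_preconn hpre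
      (mem_connectedComponentIn hmemU) hy
    rw [this]
    exact mem_iUnion.2 ⟨k0, mem_connectedComponentIn hk0⟩
  · exact iUnion_subset fun k => connectedComponentIn_mono _ (subset_iUnion V k)

theorem BC_iUnion [LocallyConnectedSpace X] {V : ℕ → Set X} (hm : Monotone V)
    (ho : ∀ k, IsOpen (V k)) {φ : X → X → ℚ}
    (h : ∀ k, BC (V k) φ) : BC (⋃ k, V k) φ := by
  apply BC_of_components (isOpen_iUnion ho)
  intro x hx
  rw [iUnion_comp hm ho (mem_iUnion.1 hx)]
  refine BC_iUnion_preconn (x0 := x) (fun k l hkl => connectedComponentIn_mono _ (hm hkl))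
    (fun k => isPreconnected_connectedComponentIn) (fun k => (ho k).connectedComponentIn) ?_
    (fun k => (h k).mono (connectedComponentIn_subset _ _))
  intro k y hy
  apply mem_connectedComponentIn
  by_contra hcon
  rw [connectedComponentIn_eq_empty hcon] at hy
  exact hy

/-- stepwise extension -/
theorem ZC_extend_iUnion {V : ℕ → Set X} (hm : Monotone V) (ho : ∀ k, IsOpen (V k))
    (hstep : ∀ k φ, ZC (V k) φ → ∃ φ', ZC (V (k+1)) φ' ∧ ∀ x ∈ V k, φ' x = φ x)
    {k0 : ℕ} {φ : X → X → ℚ} (hφ : ZC (V k0) φ) :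
    ∃ φ', ZC (⋃ k, V k) φ' ∧ ∀ x ∈ V k0, φ' x = φ x := by
  classical
  choose! E hE1 hE2 using hstep
  let ψ : ℕ → X → X → ℚ := fun j => Nat.rec φ (fun i f => E (k0 + i) f) j
  have hψ : ∀ j, ZC (V (k0 + j)) (ψ j) := by
    intro j; induction j with
    | zero => exact hφ
    | succ j ih => exact hE1 _ _ ih
  have hs : ∀ j, ∀ x ∈ V (k0 + j), ψ (j+1) x = ψ j x := fun j x hx => hE2 _ _ (hψ j) x hx
  have hs' : ∀ i j, i ≤ j → ∀ x ∈ V (k0 + i), ψ j x = ψ i x := by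
    intro i j hij
    induction j, hij using Nat.le_induction with
    | base => intros; rfl
    | succ j hij ih => intro x hx; rw [hs j x (hm (by omega) hx), ih x hx]
  have hkey : ∀ x i j, x ∈ V (k0 + i) → x ∈ V (k0 + j) → ψ i x = ψ j x := fun x i j hi hj => by
    rcases le_total i j with h | h
    · exact (hs' i j h x hi).symm
    · exact hs' j i h x hj
  let Φ : X → X → ℚ := fun x => if h : ∃ j, x ∈ V (k0 + j) then ψ h.choose x else 0
  have hΦ : ∀ j, ∀ x ∈ V (k0 + j), Φ x = ψ j x := fun j x hx => by
    have e : ∃ j, x ∈ V (k0 + j) := ⟨j, hx⟩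
    simp only [Φ, dif_pos e]
    exact hkey x _ _ e.choose_spec hx
  refine ⟨Φ, ?_, fun x hx => hΦ 0 x hx⟩
  intro x hx
  obtain ⟨k, hk⟩ := mem_iUnion.1 hx
  have hk' : x ∈ V (k0 + k) := hm (by omega) hk
  filter_upwards [hψ k x hk', (ho _).mem_nhds hk'] with y hy hyV
  rw [hΦ k x hk', hΦ k y hyV]
  exact hy
end A

/-- the rationals as a discrete space -/
def DQ : Type := ℚ
instance : TopologicalSpace DQ := ⊥
instance : DiscreteTopology DQ := ⟨rfl⟩

def addq (q : DQ) (r : ℚ) : DQ := @HAdd.hAdd ℚ ℚ ℚ _ q r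
theorem addq_zero (q : DQ) : addq q 0 = q := by
  unfold addq; exact add_zero (M := ℚ) q
theorem addq_addq (q : DQ) (r s : ℚ) : addq (addq q r) s = addq q (r + s) := by
  unfold addq; exact add_assoc (G := ℚ) q r s

/-- the bundle of germs of primitives -/
def germCore {X : Type*} [TopologicalSpace X] (φ : X → X → ℚ) (U : X → Set X)
    (hU : ∀ x, IsOpen (U x)) (hxU : ∀ x, x ∈ U x)
    (h : ∀ x, ∀ y ∈ U x, ∀ᶠ u in 𝓝 y, φ y u - φ y y = φ x u - φ x y) :
    FiberBundleCore X X DQ :=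
  { baseSet := U
    isOpen_baseSet := hU
    indexAt := id
    mem_baseSet_at := hxU
    coordChange := fun i j x q => addq q (φ j x - φ i x)
    coordChange_self := fun i x _ v => by rw [sub_self, addq_zero]
    continuousOn_coordChange := fun i j => by
      rintro ⟨x, q⟩ hx
      apply ContinuousAt.continuousWithinAt
      unfold ContinuousAt
      rw [nhds_discrete DQ, tendsto_pure]
      have h1 := h i x hx.1.1
      have h2 := h j x hx.1.2
      rw [nhds_prod_eq, nhds_discrete DQ]
      have : ∀ᶠ p : X × DQ in 𝓝 x ×ˢ pure q, (φ x p.1 - φ x x = φ i p.1 - φ i x) ∧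
        (φ x p.1 - φ x x = φ j p.1 - φ j x) ∧ p.2 = q := by
        apply Filter.Eventually.and
        · exact tendsto_fst.eventually h1
        apply Filter.Eventually.and
        · exact tendsto_fst.eventually h2
        · exact tendsto_snd.eventually (p := fun z => z = q) (by simp)
      filter_upwards [this] with p ⟨h3, h4, h5⟩
      rw [h5]
      congr 1; linarith
    coordChange_comp := fun i j k x _ v => by
      rw [addq_addq]; congr 1; ring }

theorem BC_of_simplyConnected {X : Type*} [TopologicalSpace X] [SimplyConnectedSpace X]
    [LocallyPathConnectedSpace X] {φ : X → X → ℚ} (h : ZC univ φ) : BC univ φ := by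
  have hU : ∀ x, ∃ U, IsOpen U ∧ x ∈ U ∧ ∀ y ∈ U, ∀ᶠ u in 𝓝 y, φ y u - φ y y = φ x u - φ x y := by
    intro x
    obtain ⟨U, h1, h2, h3⟩ := mem_nhds_iff.1 (h x trivial)
    exact ⟨U, h2, h3, h1⟩
  choose U hUo hxU hUφ using hU
  let Z := germCore φ U hUo hxU hUφ
  have hcov : IsCoveringMap Z.proj := IsFiberBundle.isCoveringMap fun x => ⟨Z.localTriv x, hxU x⟩
  obtain ⟨x0⟩ : Nonempty X := inferInstance
  obtain ⟨s, ⟨-, hs⟩, -⟩ := hcov.existsUnique_continuousMap_lifts (ContinuousMap.id X) x0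
    (⟨x0, (0 : ℚ)⟩ : Z.TotalSpace) rfl
  have hs1 : ∀ x, (s x).1 = x := fun x => congrFun hs x
  let f : X → ℚ := fun x => (s x).2
  refine ⟨fun x => φ x x - f x, fun x _ => ?_⟩
  have hc : ContinuousAt (fun u => ((Z.localTriv x) (s u)).2) x := by
    have h1 : ContinuousAt (Z.localTriv x) (s x) := (Z.localTriv x).continuousAt (by
      rw [FiberBundleCore.mem_localTriv_source, hs1]; exact hxU x)
    exact continuousAt_snd.comp (ContinuousAt.comp h1 s.continuous.continuousAt)
  rw [ContinuousAt, nhds_discrete DQ, tendsto_pure] at hc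
  filter_upwards [hc] with u hu
  rw [FiberBundleCore.localTriv_apply, FiberBundleCore.localTriv_apply] at hu
  have hu' : addq (f u) (φ x (s u).1 - φ (s u).1 (s u).1)
    = addq (f x) (φ x (s x).1 - φ (s x).1 (s x).1) := hu
  rw [hs1, hs1] at hu'
  have hu2 : f u + (φ x u - φ u u) = f x + (φ x x - φ x x) := hu'
  linarith

theorem BC_univ_of_vector {E : Type*} [NormedAddCommGroup E] [NormedSpace ℝ E] {φ : E → E → ℚ}
    (h : ZC univ φ) : BC univ φ := BC_of_simplyConnected h
end
end

section
noncomputable section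

theorem int_antidiff (g : ℤ → ℚ) : ∃ A : ℤ → ℚ, A 0 = 0 ∧ ∀ i, A (i+1) - A i = g i := by
  refine ⟨fun i => ∑ k ∈ Finset.range i.toNat, g k -
    ∑ k ∈ Finset.range (-i).toNat, g (-(k:ℤ) - 1), by simp, fun i => ?_⟩
  rcases le_or_gt 0 i with h | h
  · lift i to ℕ using h
    have h1 : ((i:ℤ) + 1).toNat = i + 1 := by omega
    have h2 : (-((i:ℤ) + 1)).toNat = 0 := by omega
    have h3 : (-(i:ℤ)).toNat = 0 := by omega
    simp only [h1, h2, h3, Int.toNat_natCast, Finset.sum_range_succ]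
    simp
  · obtain ⟨k, rfl⟩ : ∃ k : ℕ, i = -(k:ℤ) - 1 := ⟨(-i-1).toNat, by omega⟩
    have h1 : (-(k:ℤ) - 1 + 1).toNat = 0 := by omega
    have h2 : (-(-(k:ℤ) - 1 + 1)).toNat = k := by omega
    have h3 : (-(k:ℤ) - 1).toNat = 0 := by omega
    have h4 : (-(-(k:ℤ) - 1)).toNat = k + 1 := by omega
    simp only [h1, h2, h3, h4, Finset.sum_range_succ]
    simp

theorem grid_potential (H V : ℤ → ℤ → ℚ)
    (h : ∀ i j, H i j + V (i+1) j - H i (j+1) - V i j = 0) :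
    ∃ F : ℤ → ℤ → ℚ, (∀ i j, F (i+1) j - F i j = H i j) ∧ ∀ i j, F i (j+1) - F i j = V i j := by
  obtain ⟨A, -, hA⟩ := int_antidiff (fun i => H i 0)
  choose B hB0 hB using fun i => int_antidiff (V i)
  refine ⟨fun i j => A i + B i j, fun i j => ?_, fun i j => by linarith [hB i j]⟩
  induction j using Int.induction_on with
  | zero => simp only [hB0]; linarith [hA i]
  | succ j ih => linarith [hB i j, hB (i+1) j, h i j]
  | pred j ih =>
    have h1 := hB i (-(j:ℤ)-1)
    have h2 := hB (i+1) (-(j:ℤ)-1)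
    have h3 := h i (-(j:ℤ)-1)
    simp only [sub_add_cancel] at h1 h2 h3
    linarith

theorem grid_lemma (G : Set (ℤ × ℤ)) (IH IV : ℤ × ℤ → ℚ)
    (hI : ∀ i j, (i, j) ∈ G → IH (i, j) + IV (i+1, j) - IH (i, j+1) - IV (i, j) = 0)
    (hbad : ∀ n : ℤ × ℤ →₀ ℚ, (∀ q ∈ G, n q = 0) →
      (∀ i j, (i, j) ∉ G → (i+1, j) ∉ G → n (i, j) = n (i+1, j)) →
      (∀ i j, (i, j) ∉ G → (i, j+1) ∉ G → n (i, j) = n (i, j+1)) → n = 0) :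
    ∃ F : ℤ → ℤ → ℚ, ∀ i j, (i, j) ∈ G →
      F (i+1) j - F i j = IH (i, j) ∧ F (i+1) (j+1) - F i (j+1) = IH (i, j+1) ∧
      F i (j+1) - F i j = IV (i, j) := by
  classical
  let up : ℤ × ℤ ≃ ℤ × ℤ := (Equiv.refl ℤ).prodCongr (Equiv.addRight 1)
  let rt : ℤ × ℤ ≃ ℤ × ℤ := (Equiv.addRight 1).prodCongr (Equiv.refl ℤ)
  let d : (ℤ × ℤ →₀ ℚ) →ₗ[ℚ] (ℤ × ℤ →₀ ℚ) × (ℤ × ℤ →₀ ℚ) :=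
    (LinearMap.id - Finsupp.lmapDomain ℚ ℚ up).prod (Finsupp.lmapDomain ℚ ℚ rt - LinearMap.id)
  let I : Module.Dual ℚ ((ℤ × ℤ →₀ ℚ) × (ℤ × ℤ →₀ ℚ)) :=
    (Finsupp.linearCombination ℚ IH).coprod (Finsupp.linearCombination ℚ IV)
  let KH : Set (ℤ × ℤ) := {q | q ∈ G ∨ up.symm q ∈ G}
  let KV : Set (ℤ × ℤ) := {q | q ∈ G ∨ rt.symm q ∈ G}
  let K : Submodule ℚ ((ℤ × ℤ →₀ ℚ) × (ℤ × ℤ →₀ ℚ)) :=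
    (Finsupp.supported ℚ ℚ KH).prod (Finsupp.supported ℚ ℚ KV)
  have hd1 : ∀ n i j, (d n).1 (i, j) = n (i, j) - n (i, j-1) := by
    intro n i j
    simp only [d, LinearMap.prod_apply, Function.prod, LinearMap.sub_apply, LinearMap.id_apply,
      Finsupp.lmapDomain_apply, Finsupp.sub_apply, Finsupp.mapDomain_equiv_apply]
    rfl
  have hd2 : ∀ n i j, (d n).2 (i, j) = n (i-1, j) - n (i, j) := by
    intro n i j
    simp only [d, LinearMap.prod_apply, Function.prod, LinearMap.sub_apply, LinearMap.id_apply,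
      Finsupp.lmapDomain_apply, Finsupp.sub_apply, Finsupp.mapDomain_equiv_apply]
    rfl
  have hsymm1 : ∀ i j, up.symm (i, j) = (i, j-1) := fun i j => rfl
  have hsymm2 : ∀ i j, rt.symm (i, j) = (i-1, j) := fun i j => rfl
  have hds : ∀ i j, d (Finsupp.single (i, j) 1) =
      (Finsupp.single (i, j) 1 - Finsupp.single (i, j+1) 1,
       Finsupp.single (i+1, j) 1 - Finsupp.single (i, j) 1) := by
    intro i j
    simp only [d, LinearMap.prod_apply, Function.prod, LinearMap.sub_apply, LinearMap.id_apply,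
      Finsupp.lmapDomain_apply, Finsupp.mapDomain_single]
    rfl
  have hIs : ∀ i j, (i, j) ∈ G → I (d (Finsupp.single (i, j) 1)) = 0 := by
    intro i j hij
    rw [hds]
    simp only [I, LinearMap.coprod_apply, map_sub, Finsupp.linearCombination_single, one_smul]
    linarith [hI i j hij]
  have hvan : I ∈ (K ⊓ LinearMap.range d).dualAnnihilator := by
    rw [Submodule.mem_dualAnnihilator]
    rintro w ⟨hwK, n, rfl⟩
    -- split n
    let ng := n.filter (· ∈ G)
    let nb := n.filter (fun q => ¬ q ∈ G)
    have hn : ng + nb = n := Finsupp.filter_add_filter_not n (· ∈ G)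
    have hK1 : ∀ i j, (i, j) ∉ G → (i, j-1) ∉ G → n (i, j) = n (i, j-1) := by
      intro i j h1 h2
      have := (Finsupp.mem_supported' ℚ _).1 hwK.1 (i, j) (by
        simp only [KH, mem_ofPred_eq, hsymm1]; tauto)
      rw [hd1] at this; linarith
    have hK2 : ∀ i j, (i, j) ∉ G → (i-1, j) ∉ G → n (i-1, j) = n (i, j) := by
      intro i j h1 h2
      have := (Finsupp.mem_supported' ℚ _).1 hwK.2 (i, j) (by
        simp only [KV, mem_ofPred_eq, hsymm2]; tauto)
      rw [hd2] at this; linarith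
    have hnb : nb = 0 := by
      apply hbad
      · intro q hq; simp [nb, hq]
      · intro i j h1 h2
        simp only [nb, Finsupp.filter_apply, h1, h2, not_false_eq_true, if_true]
        have := hK2 (i+1) j h2 (by simpa using h1)
        simpa using this
      · intro i j h1 h2
        simp only [nb, Finsupp.filter_apply, h1, h2, not_false_eq_true, if_true]
        have := hK1 i (j+1) h2 (by simpa using h1)
        simpa using this.symm
    rw [← hn, hnb, add_zero]
    have : ng ∈ Finsupp.supported ℚ ℚ G := by
      rw [Finsupp.mem_supported]; intro q hq
      simp only [ng, Finsupp.support_filter, Finset.coe_filter, mem_ofPred_eq] at hq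
      exact hq.2
    rw [Finsupp.supported_eq_span_single] at this
    have hle : Submodule.span ℚ ((fun i => Finsupp.single i (1:ℚ)) '' G) ≤ LinearMap.ker (I ∘ₗ d) := by
      rw [Submodule.span_le]
      rintro _ ⟨⟨i, j⟩, hq, rfl⟩
      simpa using hIs i j hq
    exact hle this
  rw [Subspace.dualAnnihilator_inf_eq, Submodule.mem_sup] at hvan
  obtain ⟨a, ha, b, hb, hab⟩ := hvan
  rw [Submodule.mem_dualAnnihilator] at ha hb
  have hbK : ∀ w ∈ K, b w = I w := fun w hw => by rw [← hab, LinearMap.add_apply, ha w hw, zero_add]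
  obtain ⟨F, hF1, hF2⟩ := grid_potential (fun i j => b (Finsupp.single (i, j) 1, 0))
    (fun i j => b (0, Finsupp.single (i, j) 1)) (by
      intro i j
      have := hb _ ⟨Finsupp.single (i, j) 1, rfl⟩
      rw [hds] at this
      rw [← map_add, ← map_sub, ← map_sub, ← this]
      congr 1
      ext <;> simp)
  have hH : ∀ q ∈ KH, b (Finsupp.single q 1, 0) = IH q := fun q hq => by
    rw [hbK _ ⟨Finsupp.single_mem_supported ℚ 1 hq, Submodule.zero_mem _⟩]
    simp [I]
  have hV : ∀ q ∈ KV, b (0, Finsupp.single q 1) = IV q := fun q hq => by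
    rw [hbK _ ⟨Submodule.zero_mem _, Finsupp.single_mem_supported ℚ 1 hq⟩]
    simp [I]
  refine ⟨F, fun i j hij => ⟨?_, ?_, ?_⟩⟩
  · rw [hF1]; exact hH _ (Or.inl hij)
  · rw [hF1]; refine hH _ (Or.inr ?_); rw [hsymm1]; simpa using hij
  · rw [hF2]; exact hV _ (Or.inl hij)
end
end

section
noncomputable section

theorem BC_of_subtype {X : Type*} [TopologicalSpace X] {U : Set X} (hU : IsOpen U)
    {φ : X → X → ℚ} (h : BC (univ : Set U) (fun s t => φ s t)) : BC U φ := by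
  classical
  obtain ⟨f, hf⟩ := h
  refine ⟨fun x => if hx : x ∈ U then f ⟨x, hx⟩ else 0, fun x hx => ?_⟩
  have := hf ⟨x, hx⟩ trivial
  rw [nhds_subtype_eq_comap, eventually_comap] at this
  filter_upwards [this, hU.mem_nhds hx] with u h1 h2
  rw [dif_pos hx, dif_pos h2]
  exact h1 ⟨u, h2⟩ rfl

theorem BC_open_convex {E : Type*} [NormedAddCommGroup E] [NormedSpace ℝ E] {U : Set E}
    (hU : IsOpen U) (hc : Convex ℝ U) {φ : E → E → ℚ} (h : ZC U φ) : BC U φ := by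
  rcases U.eq_empty_or_nonempty with rfl | hne
  · exact ⟨0, fun x hx => hx.elim⟩
  apply BC_of_subtype hU
  have := hc.contractibleSpace hne
  have := hU.locallyPathConnectedSpace
  apply BC_of_simplyConnected
  exact h.comp isOpen_univ continuous_subtype_val.continuousOn (fun x _ => x.2)

theorem BC_compact_convex {E : Type*} [NormedAddCommGroup E] [NormedSpace ℝ E] {K U : Set E}
    (hU : IsOpen U) (hK : IsCompact K) (hc : Convex ℝ K) (hKU : K ⊆ U)
    {φ : E → E → ℚ} (h : ZC U φ) : BC K φ := by
  obtain ⟨δ, hδ, h1⟩ := hK.exists_thickening_subset_open hU hKU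
  exact (BC_open_convex Metric.isOpen_thickening (hc.thickening δ) (h.mono h1)).mono
    (Metric.self_subset_thickening hδ K)

/-- closed grid squares -/
def Sq (m : ℝ) (q : ℤ × ℤ) : Set ℂ :=
  {z | ((q.1 : ℝ) ≤ m * z.re ∧ m * z.re ≤ q.1 + 1) ∧ ((q.2 : ℝ) ≤ m * z.im ∧ m * z.im ≤ q.2 + 1)}

theorem Sq_eq {m : ℝ} (hm : 0 < m) (q : ℤ × ℤ) :
    Sq m q = Icc (q.1 / m : ℝ) ((q.1 + 1) / m) ×ℂ Icc (q.2 / m : ℝ) ((q.2 + 1) / m) := by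
  ext z
  rw [Complex.mem_reProdIm]
  simp only [Sq, mem_ofPred_eq, mem_Icc, div_le_iff₀ hm, le_div_iff₀ hm, mul_comm m]

theorem Sq_compact {m : ℝ} (hm : 0 < m) (q : ℤ × ℤ) : IsCompact (Sq m q) := by
  rw [Sq_eq hm]; exact isCompact_Icc.reProdIm isCompact_Icc

theorem Sq_convex {m : ℝ} (q : ℤ × ℤ) : Convex ℝ (Sq m q) := by
  intro x hx y hy a b ha hb hab
  obtain ⟨⟨h1, h2⟩, h3, h4⟩ := hx
  obtain ⟨⟨k1, k2⟩, k3, k4⟩ := hy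
  obtain rfl : b = 1 - a := by linarith
  refine ⟨⟨?_, ?_⟩, ?_, ?_⟩ <;> simp <;> nlinarith

/-- vertices -/
def vtx (m : ℝ) (i j : ℤ) : ℂ := ⟨i / m, j / m⟩

theorem vtx_mem {m : ℝ} (hm : 0 < m) {q : ℤ × ℤ} {i j : ℤ} (h1 : q.1 ≤ i) (h2 : i ≤ q.1 + 1)
    (h3 : q.2 ≤ j) (h4 : j ≤ q.2 + 1) : vtx m i j ∈ Sq m q := by
  simp only [Sq, vtx, mem_ofPred_eq, mul_div_cancel₀ _ hm.ne']
  exact ⟨⟨by exact_mod_cast h1, by exact_mod_cast h2⟩, by exact_mod_cast h3, by exact_mod_cast h4⟩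

theorem int_near (τ : ℝ) : ∀ᶠ σ in 𝓝 τ, ∀ i : ℤ, (i:ℝ) ≤ σ → σ ≤ i + 1 → (i:ℝ) ≤ τ ∧ τ ≤ i + 1 := by
  filter_upwards [isOpen_Ioo.mem_nhds (⟨by linarith [Int.ceil_lt_add_one τ], Int.lt_floor_add_one τ⟩ :
    τ ∈ Ioo ((⌈τ⌉:ℝ) - 1) (⌊τ⌋ + 1))] with σ hσ i h1 h2
  have a1 : (i:ℝ) < ⌊τ⌋ + 1 := by linarith [hσ.2]
  have a2 : (⌈τ⌉ : ℝ) - 1 < i + 1 := by linarith [hσ.1]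
  have b1 : i < ⌊τ⌋ + 1 := by exact_mod_cast a1
  have b2 : ⌈τ⌉ - 1 < i + 1 := by exact_mod_cast a2
  have c1 : i ≤ ⌊τ⌋ := by omega
  have c2 : ⌈τ⌉ ≤ i + 1 := by omega
  refine ⟨le_trans (by exact_mod_cast c1) (Int.floor_le τ), le_trans (Int.le_ceil τ) ?_⟩
  exact_mod_cast c2

theorem Sq_near (m : ℝ) (x : ℂ) : ∀ᶠ u in 𝓝 x, ∀ q, u ∈ Sq m q → x ∈ Sq m q := by
  have h1 : Tendsto (fun u : ℂ => m * u.re) (𝓝 x) (𝓝 (m * x.re)) :=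
    (continuous_const.mul Complex.continuous_re).tendsto x
  have h2 : Tendsto (fun u : ℂ => m * u.im) (𝓝 x) (𝓝 (m * x.im)) :=
    (continuous_const.mul Complex.continuous_im).tendsto x
  filter_upwards [h1.eventually (int_near _), h2.eventually (int_near _)] with u a b q hq
  exact ⟨a _ hq.1.1 hq.1.2, b _ hq.2.1 hq.2.2⟩

theorem Sq_fin (m : ℝ) (x : ℂ) : {q | x ∈ Sq m q}.Finite := by
  refine ((finite_Icc (⌈m * x.re⌉ - 1) ⌊m * x.re⌋).prod (finite_Icc (⌈m * x.im⌉ - 1) ⌊m * x.im⌋)).subset ?_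
  rintro ⟨i, j⟩ ⟨⟨h1, h2⟩, h3, h4⟩
  simp only at h1 h2 h3 h4
  have k2 : ⌈m * x.re⌉ ≤ i + 1 := Int.ceil_le.2 (by exact_mod_cast h2)
  have k4 : ⌈m * x.im⌉ ≤ j + 1 := Int.ceil_le.2 (by exact_mod_cast h4)
  exact ⟨⟨by simp only; omega, Int.le_floor.2 h1⟩, by simp only; omega, Int.le_floor.2 h3⟩

theorem Sq_exists (m : ℝ) (x : ℂ) : ∃ q, x ∈ Sq m q :=
  ⟨(⌊m * x.re⌋, ⌊m * x.im⌋), ⟨Int.floor_le _, (Int.lt_floor_add_one _).le⟩,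
    Int.floor_le _, (Int.lt_floor_add_one _).le⟩

theorem int_adj {t : ℝ} {i k : ℤ} (h1 : (i:ℝ) ≤ t) (h2 : t ≤ i + 1) (h3 : (k:ℝ) ≤ t)
    (h4 : t ≤ k + 1) : i ≤ k + 1 ∧ k ≤ i + 1 := by
  constructor
  · have : (i:ℝ) ≤ k + 1 := by linarith
    exact_mod_cast this
  · have : (k:ℝ) ≤ i + 1 := by linarith
    exact_mod_cast this

def goodSq (Ω : Set ℂ) (m : ℝ) : Set (ℤ × ℤ) := {q | Sq m q ⊆ Ω}
def goodU (Ω : Set ℂ) (m : ℝ) : Set ℂ := interior (⋃ q ∈ goodSq Ω m, Sq m q)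

theorem planar_level {Ω : Set ℂ} (hΩ : IsOpen Ω)
    (hMP : ∀ S : Set ℂ, IsCompact S → frontier S ⊆ Ω → S ⊆ Ω)
    {φ : ℂ → ℂ → ℚ} (hφ : ZC Ω φ) {m : ℝ} (hm : 0 < m) : BC (goodU Ω m) φ := by
  classical
  set G := goodSq Ω m with hG
  have hprim : ∀ q : ℤ × ℤ, ∃ f : ℂ → ℚ, q ∈ G → Prim (Sq m q) φ f := by
    intro q
    by_cases hq : q ∈ G
    · obtain ⟨f, hf⟩ := BC_compact_convex hΩ (Sq_compact hm q) (Sq_convex q) hq hφ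
      exact ⟨f, fun _ => hf⟩
    · exact ⟨0, fun h => (hq h).elim⟩
  choose f hf using hprim
  -- difference independence
  have hdiff : ∀ q q' x y, q ∈ G → q' ∈ G → x ∈ Sq m q → x ∈ Sq m q' → y ∈ Sq m q → y ∈ Sq m q' →
      f q y - f q x = f q' y - f q' x := fun q q' x y hq hq' h1 h2 h3 h4 =>
    ((hf q hq).mono inter_subset_left).unique ((hf q' hq').mono inter_subset_right)
      ((Sq_convex q).inter (Sq_convex q')).isPreconnected ⟨h1, h2⟩ ⟨h3, h4⟩
  let IH : ℤ × ℤ → ℚ := fun q =>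
    if q ∈ G then f q (vtx m (q.1+1) q.2) - f q (vtx m q.1 q.2)
    else f (q.1, q.2-1) (vtx m (q.1+1) q.2) - f (q.1, q.2-1) (vtx m q.1 q.2)
  let IV : ℤ × ℤ → ℚ := fun q =>
    if q ∈ G then f q (vtx m q.1 (q.2+1)) - f q (vtx m q.1 q.2)
    else f (q.1-1, q.2) (vtx m q.1 (q.2+1)) - f (q.1-1, q.2) (vtx m q.1 q.2)
  have hIH1 : ∀ i j, (i,j) ∈ G → IH (i,j) = f (i,j) (vtx m (i+1) j) - f (i,j) (vtx m i j) := by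
    intro i j h; simp only [IH, h, if_true]
  have hIV1 : ∀ i j, (i,j) ∈ G → IV (i,j) = f (i,j) (vtx m i (j+1)) - f (i,j) (vtx m i j) := by
    intro i j h; simp only [IV, h, if_true]
  have hIH2 : ∀ i j, (i,j) ∈ G → IH (i,j+1) =
      f (i,j) (vtx m (i+1) (j+1)) - f (i,j) (vtx m i (j+1)) := by
    intro i j h
    by_cases h' : (i,j+1) ∈ G
    · rw [hIH1 _ _ h']
      apply hdiff _ _ _ _ h' h <;> apply vtx_mem hm <;> simp
    · simp only [IH, h', if_false, add_sub_cancel_right]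
  have hIV2 : ∀ i j, (i,j) ∈ G → IV (i+1,j) =
      f (i,j) (vtx m (i+1) (j+1)) - f (i,j) (vtx m (i+1) j) := by
    intro i j h
    by_cases h' : (i+1,j) ∈ G
    · rw [hIV1 _ _ h']
      apply hdiff _ _ _ _ h' h <;> apply vtx_mem hm <;> simp
    · simp only [IV, h', if_false, add_sub_cancel_right]
  obtain ⟨F, hF⟩ := grid_lemma G IH IV (by
      intro i j h
      rw [hIH1 i j h, hIV1 i j h, hIH2 i j h, hIV2 i j h]; ring) (by
    intro n hn0 hn1 hn2
    let S : Set ℂ := ⋃ q ∈ n.support, Sq m q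
    have hSc : IsCompact S := n.support.isCompact_biUnion fun q _ => Sq_compact hm q
    have hSΩ : S ⊆ Ω := by
      apply hMP S hSc
      intro z hz
      by_contra hzΩ
      have hzS : z ∈ S := hSc.isClosed.frontier_subset hz
      obtain ⟨⟨i, j⟩, hq, hzq⟩ : ∃ q, q ∈ n.support ∧ z ∈ Sq m q := by
        simpa [S] using hzS
      have hbadz : ∀ q, z ∈ Sq m q → q ∉ G := fun q hq h => hzΩ (h hq)
      have hconst : ∀ q, z ∈ Sq m q → n q = n (i, j) := by
        rintro ⟨k, l⟩ hk
        have hkj : z ∈ Sq m (k, j) := ⟨hk.1, hzq.2⟩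
        have e1 : n (k, j) = n (i, j) := by
          have hadj := int_adj hk.1.1 hk.1.2 hzq.1.1 hzq.1.2
          simp only at hadj
          rcases lt_trichotomy k i with h | h | h
          · obtain rfl : i = k + 1 := by omega
            exact hn1 k j (hbadz _ hkj) (hbadz _ hzq)
          · rw [h]
          · obtain rfl : k = i + 1 := by omega
            exact (hn1 i j (hbadz _ hzq) (hbadz _ hkj)).symm
        have e2 : n (k, l) = n (k, j) := by
          have hadj := int_adj hk.2.1 hk.2.2 hzq.2.1 hzq.2.2
          simp only at hadj
          rcases lt_trichotomy l j with h | h | h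
          · obtain rfl : j = l + 1 := by omega
            exact hn2 k l (hbadz _ hk) (hbadz _ hkj)
          · rw [h]
          · obtain rfl : l = j + 1 := by omega
            exact (hn2 k j (hbadz _ hkj) (hbadz _ hk)).symm
        rw [e2, e1]
      have : z ∈ interior S := by
        rw [mem_interior_iff_mem_nhds]
        filter_upwards [Sq_near m z] with u hu
        obtain ⟨q, hq'⟩ := Sq_exists m u
        refine mem_biUnion (x := q) ?_ hq'
        simp only [Finset.mem_coe, Finsupp.mem_support_iff] at hq ⊢
        rw [hconst q (hu q hq')]; exact hq
      exact hz.2 this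
    ext q
    by_contra hne
    exact hne (hn0 q (show Sq m q ⊆ Ω from
      (subset_biUnion_of_mem (u := fun q => Sq m q) (show q ∈ n.support by simpa using hne)).trans hSΩ)))
  let g : ℤ × ℤ → ℂ → ℚ := fun q x => f q x - f q (vtx m q.1 q.2) + F q.1 q.2
  have hgF : ∀ q ∈ G, ∀ i j, q.1 ≤ i → i ≤ q.1 + 1 → q.2 ≤ j → j ≤ q.2 + 1 →
      g q (vtx m i j) = F i j := by
    rintro ⟨k, l⟩ hq i j h1 h2 h3 h4
    simp only at h1 h2 h3 h4
    have hh := hF k l hq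
    rw [hIH1 _ _ hq, hIH2 _ _ hq, hIV1 _ _ hq] at hh
    obtain ⟨e1, e2, e3⟩ := hh
    simp only [g]
    rcases (show i = k ∨ i = k + 1 by omega) with rfl | rfl <;>
      rcases (show j = l ∨ j = l + 1 by omega) with rfl | rfl <;> linarith
  have hgg : ∀ q q' x, q ∈ G → q' ∈ G → x ∈ Sq m q → x ∈ Sq m q' → g q x = g q' x := by
    intro q q' x hq hq' h1 h2
    have a1 := int_adj h1.1.1 h1.1.2 h2.1.1 h2.1.2
    have a2 := int_adj h1.2.1 h1.2.2 h2.2.1 h2.2.2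
    set i := max q.1 q'.1
    set j := max q.2 q'.2
    have b1 : q.1 ≤ i := le_max_left _ _
    have b2 : q'.1 ≤ i := le_max_right _ _
    have b3 : i ≤ q.1 + 1 := max_le (by omega) (by omega)
    have b4 : i ≤ q'.1 + 1 := max_le (by omega) (by omega)
    have c1 : q.2 ≤ j := le_max_left _ _
    have c2 : q'.2 ≤ j := le_max_right _ _
    have c3 : j ≤ q.2 + 1 := max_le (by omega) (by omega)
    have c4 : j ≤ q'.2 + 1 := max_le (by omega) (by omega)
    have d1 := hgF q hq i j b1 b3 c1 c3
    have d2 := hgF q' hq' i j b2 b4 c2 c4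
    have d3 := hdiff q q' (vtx m i j) x hq hq' (vtx_mem hm b1 b3 c1 c3) (vtx_mem hm b2 b4 c2 c4) h1 h2
    simp only [g] at d1 d2 ⊢
    linarith
  refine ⟨fun x => if hx : ∃ q, q ∈ G ∧ x ∈ Sq m q then g hx.choose x else 0, fun x hx => ?_⟩
  have hev : ∀ᶠ u in 𝓝 x, ∀ q ∈ {q | x ∈ Sq m q}, q ∈ G → φ x u - φ x x = f q u - f q x := by
    rw [eventually_all_finite (Sq_fin m x)]
    intro q hq
    by_cases hqG : q ∈ G
    · exact (hf q hqG x hq).mono fun u hu _ => hu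
    · exact Eventually.of_forall fun u h => (hqG h).elim
  filter_upwards [hev, Sq_near m x, isOpen_interior.mem_nhds hx] with u h1 h2 h3
  obtain ⟨q, hqG, hqu⟩ : ∃ q, q ∈ G ∧ u ∈ Sq m q := by
    have := interior_subset h3
    simpa using this
  have hqx := h2 q hqu
  have eu : ∃ q, q ∈ G ∧ u ∈ Sq m q := ⟨q, hqG, hqu⟩
  have ex : ∃ q, q ∈ G ∧ x ∈ Sq m q := ⟨q, hqG, hqx⟩
  rw [dif_pos eu, dif_pos ex, hgg _ q u eu.choose_spec.1 hqG eu.choose_spec.2 hqu,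
    hgg _ q x ex.choose_spec.1 hqG ex.choose_spec.2 hqx, h1 q hqx hqG]
  simp only [g]; ring

theorem planar_lemma {Ω : Set ℂ} (hΩ : IsOpen Ω)
    (hMP : ∀ S : Set ℂ, IsCompact S → frontier S ⊆ Ω → S ⊆ Ω)
    {φ : ℂ → ℂ → ℚ} (hφ : ZC Ω φ) : BC Ω φ := by
  have hmono : Monotone fun k : ℕ => goodU Ω (2^k) := by
    apply monotone_nat_of_le_succ
    intro k
    apply interior_mono
    intro z hz
    simp only [mem_iUnion, exists_prop] at hz ⊢
    obtain ⟨⟨i, j⟩, hq, hz⟩ := hz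
    obtain ⟨⟨h1, h2⟩, h3, h4⟩ := hz
    simp only at h1 h2 h3 h4
    have half : ∀ (t : ℝ) (i : ℤ), (i:ℝ) ≤ 2^k * t → 2^k * t ≤ i + 1 →
        ∃ a : ℤ, (a : ℝ) ≤ 2^(k+1) * t ∧ 2^(k+1) * t ≤ a + 1 ∧ 2 * i ≤ a ∧ a + 1 ≤ 2 * i + 2 := by
      intro t i h1 h2
      rcases le_total (2^(k+1) * t) (2 * i + 1 : ℝ) with h | h
      · exact ⟨2 * i, by push_cast; rw [pow_succ]; linarith, by push_cast; exact h, le_rfl, by omega⟩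
      · exact ⟨2 * i + 1, by push_cast; exact h, by push_cast; rw [pow_succ]; linarith,
          by omega, by omega⟩
    obtain ⟨a, a1, a2, a3, a4⟩ := half _ _ h1 h2
    obtain ⟨c, c1, c2, c3, c4⟩ := half _ _ h3 h4
    refine ⟨(a, c), fun w hw => hq ?_, ⟨a1, a2⟩, c1, c2⟩
    obtain ⟨⟨w1, w2⟩, w3, w4⟩ := hw
    simp only at w1 w2 w3 w4
    have a3' : (2 * i : ℝ) ≤ a := by exact_mod_cast a3
    have a4' : (a + 1 : ℝ) ≤ 2 * i + 2 := by exact_mod_cast a4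
    have c3' : (2 * j : ℝ) ≤ c := by exact_mod_cast c3
    have c4' : (c + 1 : ℝ) ≤ 2 * j + 2 := by exact_mod_cast c4
    rw [pow_succ] at w1 w2 w3 w4
    exact ⟨⟨by simp only; linarith, by simp only; linarith⟩, by simp only; linarith, by simp only; linarith⟩
  have hcov : Ω = ⋃ k : ℕ, goodU Ω (2^k) := by
    apply subset_antisymm
    · intro x hx
      obtain ⟨ε, hε, hball⟩ := Metric.isOpen_iff.1 hΩ x hx
      obtain ⟨k, hk⟩ := pow_unbounded_of_one_lt (4 / ε) (one_lt_two : (1:ℝ) < 2)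
      refine mem_iUnion.2 ⟨k, ?_⟩
      have hm : (0:ℝ) < 2^k := by positivity
      have hkε : 4 < 2^k * ε := by rwa [div_lt_iff₀ hε] at hk
      refine mem_interior_iff_mem_nhds.2 ?_
      filter_upwards [Metric.ball_mem_nhds x (half_pos hε)] with u hu
      obtain ⟨q, hq⟩ := Sq_exists (2^k) u
      refine mem_biUnion (x := q) ?_ hq
      intro w hw
      apply hball
      have hre : 2^k * |w.re - u.re| ≤ 1 := by
        rw [← abs_of_pos hm, ← abs_mul, abs_le, mul_sub]
        exact ⟨by linarith [hw.1.1, hw.1.2, hq.1.1, hq.1.2], by linarith [hw.1.1, hw.1.2, hq.1.1, hq.1.2]⟩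
      have him : 2^k * |w.im - u.im| ≤ 1 := by
        rw [← abs_of_pos hm, ← abs_mul, abs_le, mul_sub]
        exact ⟨by linarith [hw.2.1, hw.2.2, hq.2.1, hq.2.2], by linarith [hw.2.1, hw.2.2, hq.2.1, hq.2.2]⟩
      have hd : dist w u ≤ |w.re - u.re| + |w.im - u.im| := by
        rw [Complex.dist_eq]; simpa using Complex.norm_le_abs_re_add_abs_im (w - u)
      have : dist w u < ε / 2 := by
        by_contra hcon
        push Not at hcon
        nlinarith
      calc dist w x ≤ dist w u + dist u x := dist_triangle _ _ _
        _ < ε / 2 + ε / 2 := add_lt_add this hu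
        _ = ε := by ring
    · exact iUnion_subset fun k x hx => by
        have := interior_subset hx
        simp only [mem_iUnion, exists_prop] at this
        obtain ⟨q, hq, hx⟩ := this
        exact hq hx
  rw [hcov]
  exact BC_iUnion hmono (fun k => isOpen_interior) fun k => planar_level hΩ hMP hφ (by positivity)

/-- maximum principle for sublevel sets given by convex sets -/
theorem disc_MP {E : Type*} [NormedAddCommGroup E] [NormedSpace ℂ E] {ψ : ℂ → E}
    (hψ : DifferentiableOn ℂ ψ (Metric.ball 0 1)) {C : Set E}
    (hC : IsOpen C) (hc : Convex ℝ C) (S : Set ℂ) (hS : IsCompact S)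
    (hfr : frontier S ⊆ {ζ | ζ ∈ Metric.ball 0 1 ∧ ψ ζ ∈ C}) :
    S ⊆ {ζ | ζ ∈ Metric.ball 0 1 ∧ ψ ζ ∈ C} := by
  have hball : S ⊆ Metric.ball 0 1 := by
    intro z hz
    by_cases hzi : z ∈ interior S
    · obtain ⟨w, hw, hmax⟩ := Complex.exists_mem_frontier_isMaxOn_norm (f := fun z : ℂ => z)
        (hS.isBounded.subset interior_subset) ⟨z, hzi⟩ (differentiable_id.diffContOnCl)
      have h1 := hmax (subset_closure hzi)
      have h2 := (hfr (frontier_interior_subset hw)).1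
      simp only [Function.comp, mem_ofPred_eq] at h1
      rw [mem_ball_zero_iff] at h2 ⊢
      linarith
    · exact (hfr ⟨subset_closure hz, hzi⟩).1
  intro z hz
  by_cases hzi : z ∈ interior S
  · refine ⟨hball hz, ?_⟩
    by_contra hcon
    obtain ⟨ℓ, hℓ⟩ := RCLike.geometric_hahn_banach_open_point (𝕜 := ℂ) hc hC hcon
    have hcl : closure (interior S) ⊆ Metric.ball 0 1 :=
      (closure_minimal interior_subset hS.isClosed).trans hball
    have hd : DifferentiableOn ℂ (fun ζ => Complex.exp (ℓ (ψ ζ))) (closure (interior S)) := by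
      have := (ℓ.differentiable.comp_differentiableOn (hψ.mono hcl))
      exact this.cexp
    obtain ⟨w, hw, hmax⟩ := Complex.exists_mem_frontier_isMaxOn_norm
        (hS.isBounded.subset interior_subset) ⟨z, hzi⟩ hd.diffContOnCl
    have h1 := hmax (subset_closure hzi)
    have h2 := hℓ _ (hfr (frontier_interior_subset hw)).2
    simp only [Function.comp, mem_ofPred_eq, Complex.norm_exp, Real.exp_le_exp] at h1
    simp only [RCLike.re_to_complex] at h2
    linarith
  · exact hfr ⟨subset_closure hz, hzi⟩

theorem disc_convex_BC {E : Type*} [NormedAddCommGroup E] [NormedSpace ℂ E] {ψ : ℂ → E}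
    (hψ : DifferentiableOn ℂ ψ (Metric.ball 0 1)) {C : Set E}
    (hC : IsOpen C) (hc : Convex ℝ C) {φ : ℂ → ℂ → ℚ}
    (hφ : ZC {ζ | ζ ∈ Metric.ball 0 1 ∧ ψ ζ ∈ C} φ) : 
    BC {ζ | ζ ∈ Metric.ball 0 1 ∧ ψ ζ ∈ C} φ :=
  planar_lemma (hψ.continuousOn.isOpen_inter_preimage Metric.isOpen_ball hC) (disc_MP hψ hC hc) hφ
end
end

section
set_option linter.unusedSectionVars false
set_option linter.deprecated false
noncomputable section

section tree
variable {X Xt : Type} [TopologicalSpace X] [TopologicalSpace Xt]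

def FBij {S : Type} (w : Xt → X) (l : Xt → S) (x : X) : Prop := ∀ s, ∃! y, w y = x ∧ l y = s

def Triv (w : Xt → X) (P : Set X) : Prop :=
  ∃ (S : Type) (l : Xt → S), LC (w ⁻¹' P) l ∧ ∀ x ∈ P, FBij w l x

theorem Triv.mono {w : Xt → X} {P Q : Set X} (h : Triv w P) (hQ : Q ⊆ P) : Triv w Q := by
  obtain ⟨S, l, h1, h2⟩ := h
  exact ⟨S, l, h1.mono (preimage_mono hQ), fun x hx => h2 x (hQ hx)⟩

theorem LC_mem_comp {U A : Set X} (hA : LC U (· ∈ A)) {x u : X}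
    (hu : u ∈ connectedComponentIn U x) : u ∈ A ↔ x ∈ A := by
  have hx : x ∈ U := by
    by_contra h; rw [connectedComponentIn_eq_empty h] at hu; exact hu
  have := (hA.mono (connectedComponentIn_subset U x)).const_of_preconn
    isPreconnected_connectedComponentIn (mem_connectedComponentIn hx) hu
  exact iff_of_eq this

theorem LC_of_comp [LocallyConnectedSpace X] {U A : Set X} (hU : IsOpen U)
    (h : ∀ x ∈ U, ∀ u ∈ connectedComponentIn U x, (u ∈ A ↔ x ∈ A)) : LC U (· ∈ A) := by
  intro x hx
  filter_upwards [hU.connectedComponentIn.mem_nhds (mem_connectedComponentIn hx)] with u hu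
  exact propext (h x hx u hu)

theorem comp_nhds [LocallyConnectedSpace X] {U : Set X} (hU : IsOpen U) {x : X} (hx : x ∈ U) :
    connectedComponentIn U x ∈ 𝓝 x :=
  hU.connectedComponentIn.mem_nhds (mem_connectedComponentIn hx)

theorem mem_of_mem_comp {U : Set X} {x u : X} (h : u ∈ connectedComponentIn U x) : x ∈ U := by
  by_contra hc; rw [connectedComponentIn_eq_empty hc] at h; exact h

def MVS (V W : Set X) : Prop := ∀ c : X → ℚ, LC (V ∩ W) c →
  ∃ f g : X → ℚ, LC V f ∧ LC W g ∧ ∀ x ∈ V ∩ W, c x = f x + g x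

theorem MVS.swap {V W : Set X} (h : MVS V W) : MVS W V := fun c hc => by
  obtain ⟨f, g, h1, h2, h3⟩ := h c (by rwa [inter_comm])
  exact ⟨g, f, h2, h1, fun x hx => by rw [h3 x hx.symm, add_comm]⟩

def YY (V W A B : Set X) : Set X := (V ∩ A) ∪ (W ∩ B)
theorem YY_swap (V W A B : Set X) : YY V W A B = YY W V B A := union_comm _ _

theorem LC_and_open {V A : Set X} (hV : IsOpen V) (hA : LC V (· ∈ A)) : IsOpen (V ∩ A) := by
  rw [isOpen_iff_mem_nhds]
  rintro x ⟨h1, h2⟩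
  filter_upwards [hV.mem_nhds h1, hA x h1] with u a b
  exact ⟨a, b.symm ▸ h2⟩

theorem YY_open {V W A B : Set X} (hV : IsOpen V) (hW : IsOpen W) (hA : LC V (· ∈ A))
    (hB : LC W (· ∈ B)) : IsOpen (YY V W A B) := (LC_and_open hV hA).union (LC_and_open hW hB)

theorem tree_const [LocallyConnectedSpace X] {V W A B : Set X} (hV : IsOpen V) (hW : IsOpen W)
    (hMV : MVS V W) (hA : LC V (· ∈ A)) (hB : LC W (· ∈ B))
    (hY : IsPreconnected (YY V W A B)) {x : X}
    (hPA : ∀ u ∈ connectedComponentIn V x, u ∉ A) {S : Type} {κ : X → S}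
    (hκ : LC (connectedComponentIn V x ∩ YY V W A B) κ) {x1 x2 : X}
    (h1 : x1 ∈ connectedComponentIn V x ∩ YY V W A B)
    (h2 : x2 ∈ connectedComponentIn V x ∩ YY V W A B) : κ x2 = κ x1 := by
  classical
  set P := connectedComponentIn V x with hP
  have hPo : IsOpen P := hV.connectedComponentIn
  have hPV : P ⊆ V := connectedComponentIn_subset _ _
  have hYo := YY_open hV hW hA hB
  have hPW : ∀ u ∈ P ∩ YY V W A B, u ∈ W ∩ B := by
    rintro u ⟨hu, h | h⟩
    · exact (hPA u hu h.2).elim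
    · exact h
  let c : X → ℚ := fun u => if u ∈ P ∩ YY V W A B ∧ κ u = κ x1 then 1 else 0
  have hc : LC (V ∩ W) c := by
    rintro z ⟨hzV, hzW⟩
    by_cases hzP : z ∈ P
    · by_cases hzY : z ∈ YY V W A B
      · filter_upwards [hPo.mem_nhds hzP, hYo.mem_nhds hzY, hκ z ⟨hzP, hzY⟩] with u a b d
        simp only [c, mem_inter_iff, a, b, hzP, hzY, d]
      · have hzB : z ∉ B := fun h => hzY (Or.inr ⟨hzW, h⟩)
        filter_upwards [hPo.mem_nhds hzP, hB z hzW] with u a b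
        have huY : ¬ (u ∈ P ∩ YY V W A B) := fun hu => hzB (b ▸ (hPW u hu).2)
        have hzY' : ¬ (z ∈ P ∩ YY V W A B) := fun hu => hzY hu.2
        simp only [c, huY, hzY', false_and, if_false]
    · filter_upwards [comp_nhds hV hzV] with u hu
      have huP : u ∉ P := fun h => hzP (by
        have e1 := connectedComponentIn_eq h
        have e2 := connectedComponentIn_eq hu
        rw [hP, e1, ← e2]; exact mem_connectedComponentIn hzV)
      simp only [c, mem_inter_iff, huP, hzP, false_and, if_false]
  obtain ⟨f, g, hf, hg, hfg⟩ := hMV c hc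
  let h : X → ℚ := fun u => if u ∈ V ∩ A then - f u else g u
  have hh : LC (YY V W A B) h := by
    intro z hz
    by_cases hzA : z ∈ V ∩ A
    · filter_upwards [(LC_and_open hV hA).mem_nhds hzA, hf z hzA.1] with u a b
      simp only [h, a, hzA, if_true, b]
    · have hzW : z ∈ W ∩ B := hz.resolve_left hzA
      filter_upwards [(LC_and_open hW hB).mem_nhds hzW, hg z hzW.1] with u a b
      by_cases huA : u ∈ V ∩ A
      · have : c u = 0 := by
          have : u ∉ P := fun h => hPA u h huA.2
          simp only [c, mem_inter_iff, this, false_and, if_false]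
        have h3 := hfg u ⟨huA.1, a.1⟩
        simp only [h, huA, hzA, if_true, if_false]
        linarith
      · simp only [h, huA, hzA, if_false, b]
  have e1 := hh.const_of_preconn hY h1.2 h2.2
  have n1 : x1 ∉ V ∩ A := fun h => hPA x1 h1.1 h.2
  have n2 : x2 ∉ V ∩ A := fun h => hPA x2 h2.1 h.2
  simp only [h, n1, n2, if_false] at e1
  have e2 := (hf.mono hPV).const_of_preconn isPreconnected_connectedComponentIn h1.1 h2.1
  have e3 := hfg x1 ⟨hPV h1.1, (hPW x1 h1).1⟩
  have e4 := hfg x2 ⟨hPV h2.1, (hPW x2 h2).1⟩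
  have e5 : c x2 = c x1 := by linarith
  by_contra hne
  have c1 : c x1 = 1 := if_pos ⟨h1, rfl⟩
  have c2 : c x2 = 0 := if_neg fun h => hne h.2
  rw [c1, c2] at e5; norm_num at e5

structure Adm (V W : Set X) (w : Xt → X) (P0 : Set X) {S : Type} (l0 : Xt → S)
    (A B : Set X) (l : Xt → S) : Prop where
  hA : LC V (· ∈ A)
  hB : LC W (· ∈ B)
  pre : IsPreconnected (YY V W A B)
  sub : P0 ⊆ YY V W A B
  lc : LC (w ⁻¹' YY V W A B) l
  ext : ∀ y, w y ∈ P0 → l y = l0 y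
  bij : (∀ x ∈ P0, FBij w l0 x) → ∀ x ∈ YY V W A B, FBij w l x

theorem Adm.swap {V W : Set X} {w : Xt → X} {P0 : Set X} {S : Type} {l0 : Xt → S}
    {A B : Set X} {l : Xt → S} (h : Adm V W w P0 l0 A B l) : Adm W V w P0 l0 B A l := by
  have e := YY_swap V W A B
  exact ⟨h.hB, h.hA, e ▸ h.pre, e ▸ h.sub, e ▸ h.lc, h.ext, e ▸ h.bij⟩

theorem tree_step [LocallyConnectedSpace X] {V W : Set X} (hV : IsOpen V) (hW : IsOpen W)
    (hMV : MVS V W) {w : Xt → X} (hw : IsLocalHomeomorph w) {P0 : Set X} {S : Type} {l0 : Xt → S}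
    {A B : Set X} {l : Xt → S} (h : Adm V W w P0 l0 A B l) {x : X}
    (hPA : ∀ u ∈ connectedComponentIn V x, u ∉ A)
    {x1 : X} (hx1 : x1 ∈ connectedComponentIn V x ∩ YY V W A B)
    (hT : Triv w (connectedComponentIn V x)) :
    ∃ l', Adm V W w P0 l0 (A ∪ connectedComponentIn V x) B l' ∧
      ∀ y, w y ∈ YY V W A B → l' y = l y := by
  classical
  obtain ⟨T, m, hm, hmb⟩ := hT
  have hYo := YY_open hV hW h.hA h.hB
  set P := connectedComponentIn V x with hP
  set Y := YY V W A B with hYdef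
  have hPo : IsOpen P := hV.connectedComponentIn
  have hPV : P ⊆ V := connectedComponentIn_subset _ _
  have hYeq : YY V W (A ∪ P) B = Y ∪ P := by
    ext u; simp only [hYdef, YY, mem_union, mem_inter_iff]
    constructor
    · rintro (⟨h1, h2 | h2⟩ | h1)
      · exact Or.inl (Or.inl ⟨h1, h2⟩)
      · exact Or.inr h2
      · exact Or.inl (Or.inr h1)
    · rintro ((h1 | h1) | h1)
      · exact Or.inl ⟨h1.1, Or.inl h1.2⟩
      · exact Or.inr h1
      · exact Or.inl ⟨hPV h1, Or.inr h1⟩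
  -- sections
  have hσ : ∀ s : T, ∀ u : X, ∃ y : Xt, u ∈ P → (w y = u ∧ m y = s) := by
    intro s u
    by_cases hu : u ∈ P
    · obtain ⟨y, hy, -⟩ := hmb u hu s; exact ⟨y, fun _ => hy⟩
    · obtain ⟨y, -⟩ := (hmb x1 hx1.1 s).exists
      exact ⟨y, fun h => (hu h).elim⟩
  choose σ hσ using hσ
  have hσu : ∀ s u y, u ∈ P → w y = u → m y = s → y = σ s u := fun s u y hu h1 h2 =>
    (hmb u hu s).unique ⟨h1, h2⟩ (hσ s u hu)
  have hσc : ∀ s, ∀ u ∈ P, ∀ O ∈ 𝓝 (σ s u), ∀ᶠ v in 𝓝 u, σ s v ∈ O := by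
    intro s u hu O hO
    have h1 : ∀ᶠ y in 𝓝 (σ s u), y ∈ O ∧ m y = s := by
      have := hm (σ s u) (by rw [mem_preimage, (hσ s u hu).1]; exact hu)
      rw [(hσ s u hu).2] at this
      exact Filter.Eventually.and hO this
    have h2 : w '' {y | y ∈ O ∧ m y = s} ∈ 𝓝 u := by
      have := hw.isOpenMap.image_mem_nhds h1
      rwa [(hσ s u hu).1] at this
    filter_upwards [h2, hPo.mem_nhds hu] with v ⟨y, ⟨hyO, hym⟩, hyv⟩ hvP
    rw [← hσu s v y hvP hyv hym]; exact hyO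
  have hlσ : ∀ s, LC (P ∩ Y) (fun u => l (σ s u)) := by
    intro s u hu
    have := h.lc (σ s u) (by rw [mem_preimage, (hσ s u hu.1).1]; exact hu.2)
    exact hσc s u hu.1 _ this
  let τ : T → S := fun s => l (σ s x1)
  have hτ : ∀ y, w y ∈ P → w y ∈ Y → l y = τ (m y) := by
    intro y hyP hyY
    have e := tree_const hV hW hMV h.hA h.hB h.pre hPA (hlσ (m y)) hx1 ⟨hyP, hyY⟩
    rw [← hσu (m y) (w y) y hyP rfl rfl] at e
    exact e
  let l' : Xt → S := fun y => if w y ∈ Y then l y else τ (m y)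
  have hl'P : ∀ y, w y ∈ P → l' y = τ (m y) := fun y hy => by
    by_cases hyY : w y ∈ Y
    · simp only [l', hyY, if_true]; exact hτ y hy hyY
    · simp only [l', hyY, if_false]
  have hl'Y : ∀ y, w y ∈ Y → l' y = l y := fun y hy => by simp only [l', hy, if_true]
  refine ⟨l', ⟨?_, h.hB, ?_, ?_, ?_, ?_, ?_⟩, hl'Y⟩
  · intro z hz
    by_cases hzP : z ∈ P
    · filter_upwards [hPo.mem_nhds hzP] with u hu
      simp [hu, hzP]
    · filter_upwards [comp_nhds hV hz, h.hA z hz] with u hu hA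
      have huP : u ∉ P := fun h => hzP (by
        have e1 := connectedComponentIn_eq h
        have e2 := connectedComponentIn_eq hu
        rw [hP, e1, ← e2]; exact mem_connectedComponentIn hz)
      simp only [mem_union, huP, hzP, or_false, hA]
  · rw [hYeq]
    exact h.pre.union x1 hx1.2 hx1.1 isPreconnected_connectedComponentIn
  · rw [hYeq]; exact h.sub.trans subset_union_left
  · rw [hYeq]
    intro y hy
    by_cases hyY : w y ∈ Y
    · have hn : w ⁻¹' Y ∈ 𝓝 y := (hYo.preimage hw.continuous).mem_nhds hyY
      filter_upwards [hn, h.lc y hyY] with u a b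
      rw [hl'Y u a, hl'Y y hyY, b]
    · have hyP : w y ∈ P := hy.resolve_left hyY
      have hn : w ⁻¹' P ∈ 𝓝 y := (hPo.preimage hw.continuous).mem_nhds hyP
      filter_upwards [hn, hm y hyP] with u a b
      rw [hl'P u a, hl'P y hyP, b]
  · intro y hy
    rw [hl'Y y (h.sub hy), h.ext y hy]
  · intro hb z hz
    rw [hYeq] at hz
    by_cases hzY : z ∈ Y
    · intro s
      have := h.bij hb z hzY s
      refine (existsUnique_congr fun y => ?_).1 this
      constructor
      · rintro ⟨h1, h2⟩; exact ⟨h1, by rw [hl'Y y (h1 ▸ hzY)]; exact h2⟩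
      · rintro ⟨h1, h2⟩; exact ⟨h1, by rw [hl'Y y (h1 ▸ hzY)] at h2; exact h2⟩
    · have hzP : z ∈ P := hz.resolve_left hzY
      have hb1 := h.bij hb x1 hx1.2
      have hτb : ∀ s, ∃! t, τ t = s := by
        intro s
        obtain ⟨y, ⟨hy1, hy2⟩, hyu⟩ := hb1 s
        refine ⟨m y, ?_, ?_⟩
        · simp only; rw [← hτ y (hy1 ▸ hx1.1) (hy1 ▸ hx1.2), hy2]
        · intro t ht
          have := hyu (σ t x1) ⟨(hσ t x1 hx1.1).1, ht⟩
          rw [← this, (hσ t x1 hx1.1).2]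
      intro s
      obtain ⟨t, ht, htu⟩ := hτb s
      refine ⟨σ t z, ⟨(hσ t z hzP).1, ?_⟩, ?_⟩
      · rw [hl'P _ (by rw [(hσ t z hzP).1]; exact hzP), (hσ t z hzP).2]; exact ht
      · rintro y ⟨hy1, hy2⟩
        rw [hl'P y (hy1 ▸ hzP)] at hy2
        exact hσu t z y hzP hy1 (htu _ hy2)

theorem tree [LocallyConnectedSpace X] {V W : Set X} (hV : IsOpen V) (hW : IsOpen W)
    (hconn : IsPreconnected (V ∪ W)) (hMV : MVS V W) {w : Xt → X} (hw : IsLocalHomeomorph w)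
    {x0 : X} (hx0 : x0 ∈ V)
    (hTV : ∀ x ∈ V, x ∉ connectedComponentIn V x0 → Triv w (connectedComponentIn V x))
    (hTW : ∀ x ∈ W, Triv w (connectedComponentIn W x)) {S : Type} (l0 : Xt → S)
    (h0 : LC (w ⁻¹' connectedComponentIn V x0) l0) :
    ∃ l : Xt → S, LC (w ⁻¹' (V ∪ W)) l ∧ (∀ y, w y ∈ connectedComponentIn V x0 → l y = l0 y) ∧
      ((∀ x ∈ connectedComponentIn V x0, FBij w l0 x) → ∀ x ∈ V ∪ W, FBij w l x) := by
  classical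
  set P0 := connectedComponentIn V x0 with hP0
  let Tp := {t : Set X × Set X × (Xt → S) // Adm V W w P0 l0 t.1 t.2.1 t.2.2}
  let YT : Tp → Set X := fun t => YY V W t.1.1 t.1.2.1
  let r : Tp → Tp → Prop := fun s t => s.1.1 ⊆ t.1.1 ∧ s.1.2.1 ⊆ t.1.2.1 ∧
    ∀ y, w y ∈ YT s → t.1.2.2 y = s.1.2.2 y
  have hYT : ∀ s t, r s t → YT s ⊆ YT t := fun s t h =>
    union_subset_union (inter_subset_inter_right _ h.1) (inter_subset_inter_right _ h.2.1)
  have hP0V : P0 ⊆ V := connectedComponentIn_subset _ _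
  have hY0 : YY V W P0 ∅ = P0 := by
    ext u; simp only [YY, inter_empty, union_empty]
    exact ⟨fun h => h.2, fun h => ⟨hP0V h, h⟩⟩
  have hinit : Adm V W w P0 l0 P0 ∅ l0 := by
    refine ⟨?_, ?_, ?_, ?_, ?_, fun y _ => rfl, ?_⟩
    · apply LC_of_comp hV
      intro x hx u hu
      rw [hP0]
      constructor
      · intro h
        rw [connectedComponentIn_eq h, ← connectedComponentIn_eq hu]; exact mem_connectedComponentIn hx
      · intro h
        rw [connectedComponentIn_eq h]; exact hu
    · intro x _; simp
    · rw [hY0]; exact isPreconnected_connectedComponentIn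
    · rw [hY0]
    · rw [hY0]; exact h0
    · rw [hY0]; exact fun h => h
  have htrans : ∀ {a b c : Tp}, r a b → r b c → r a c := by
    intro a b c h1 h2
    refine ⟨h1.1.trans h2.1, h1.2.1.trans h2.2.1, fun y hy => ?_⟩
    rw [h2.2.2 y (hYT a b h1 hy), h1.2.2 y hy]
  have hrefl : ∀ a, r a a := fun a => ⟨subset_rfl, subset_rfl, fun _ _ => rfl⟩
  obtain ⟨t, ht⟩ := exists_maximal_of_chains_bounded (r := r) (by
    intro c hc
    rcases c.eq_empty_or_nonempty with rfl | ⟨t0, ht0⟩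
    · exact ⟨⟨(P0, ∅, l0), hinit⟩, fun a ha => ha.elim⟩
    have hc' : ∀ s ∈ c, ∀ t ∈ c, r s t ∨ r t s := by
      intro s hs t ht
      by_cases hst : s = t
      · left; rw [hst]; exact hrefl t
      · exact hc hs ht hst
    let A : Set X := ⋃ s ∈ c, s.1.1
    let B : Set X := ⋃ s ∈ c, s.1.2.1
    let l : Xt → S := fun y => if h : ∃ s, s ∈ c ∧ w y ∈ YT s then h.choose.1.2.2 y else l0 y
    have hY : YY V W A B = ⋃ s ∈ c, YT s := by
      ext u
      simp only [YY, A, B, YT, mem_union, mem_inter_iff, mem_iUnion, exists_prop]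
      constructor
      · rintro (⟨h1, s, h2, h3⟩ | ⟨h1, s, h2, h3⟩)
        · exact ⟨s, h2, Or.inl ⟨h1, h3⟩⟩
        · exact ⟨s, h2, Or.inr ⟨h1, h3⟩⟩
      · rintro ⟨s, h2, ⟨h1, h3⟩ | ⟨h1, h3⟩⟩
        · exact Or.inl ⟨h1, s, h2, h3⟩
        · exact Or.inr ⟨h1, s, h2, h3⟩
    have hl : ∀ s ∈ c, ∀ y, w y ∈ YT s → l y = s.1.2.2 y := by
      intro s hs y hy
      have hex : ∃ s, s ∈ c ∧ w y ∈ YT s := ⟨s, hs, hy⟩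
      simp only [l, dif_pos hex]
      rcases hc' _ hex.choose_spec.1 _ hs with h | h
      · exact (h.2.2 y hex.choose_spec.2).symm
      · exact h.2.2 y hy
    have hadm : Adm V W w P0 l0 A B l := by
      refine ⟨?_, ?_, ?_, ?_, ?_, ?_, ?_⟩
      · apply LC_of_comp hV
        intro x hx u hu
        simp only [A, mem_iUnion, exists_prop]
        exact exists_congr fun s => and_congr_right fun _ => LC_mem_comp s.2.hA hu
      · apply LC_of_comp hW
        intro x hx u hu
        simp only [B, mem_iUnion, exists_prop]
        exact exists_congr fun s => and_congr_right fun _ => LC_mem_comp s.2.hB hu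
      · rw [hY, biUnion_eq_iUnion]
        exact isPreconnected_iUnion (s := fun i : c => YT i)
          ⟨x0, mem_iInter.2 fun s => s.1.2.sub (mem_connectedComponentIn hx0)⟩ fun s => s.1.2.pre
      · rw [hY]; exact t0.2.sub.trans (subset_biUnion_of_mem (u := YT) ht0)
      · rw [hY]
        intro y hy
        obtain ⟨s, hs, hys⟩ : ∃ s, s ∈ c ∧ w y ∈ YT s := by simpa using hy
        have hYo : IsOpen (YT s) := YY_open hV hW s.2.hA s.2.hB
        have hn : w ⁻¹' YT s ∈ 𝓝 y := (hYo.preimage hw.continuous).mem_nhds hys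
        filter_upwards [hn, s.2.lc y hys] with u a b
        rw [hl s hs u a, hl s hs y hys, b]
      · intro y hy
        rw [hl t0 ht0 y (t0.2.sub hy), t0.2.ext y hy]
      · intro hb x hx
        rw [hY] at hx
        obtain ⟨s, hs, hys⟩ : ∃ s, s ∈ c ∧ x ∈ YT s := by simpa using hx
        intro q
        refine (existsUnique_congr fun y => ?_).1 (s.2.bij hb x hys q)
        constructor
        · rintro ⟨h1, h2⟩; exact ⟨h1, by rw [hl s hs y (h1 ▸ hys)]; exact h2⟩
        · rintro ⟨h1, h2⟩; exact ⟨h1, by rw [hl s hs y (h1 ▸ hys)] at h2; exact h2⟩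
    refine ⟨⟨(A, B, l), hadm⟩, fun s hs => ⟨?_, ?_, ?_⟩⟩
    · exact subset_biUnion_of_mem (u := fun s : Tp => s.1.1) hs
    · exact subset_biUnion_of_mem (u := fun s : Tp => s.1.2.1) hs
    · intro y hy; exact hl s hs y hy) htrans
  obtain ⟨⟨A, B, l⟩, hadm⟩ := t
  simp only at hadm
  have hYo := YY_open hV hW hadm.hA hadm.hB
  -- closure under V-components
  have clV : ∀ x ∈ V, (∃ u ∈ connectedComponentIn V x, u ∈ YY V W A B) → x ∈ YY V W A B := by
    rintro x hx ⟨u, hu, huY⟩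
    by_contra hxY
    have hxA : x ∉ A := fun h => hxY (Or.inl ⟨hx, h⟩)
    have hPA : ∀ v ∈ connectedComponentIn V x, v ∉ A := fun v hv h =>
      hxA ((LC_mem_comp hadm.hA hv).1 h)
    have hx0' : x ∉ P0 := fun h => hxY (hadm.sub h)
    obtain ⟨l', h1, h2⟩ := tree_step hV hW hMV hw hadm hPA ⟨hu, huY⟩ (hTV x hx hx0')
    have := ht ⟨(A ∪ connectedComponentIn V x, B, l'), h1⟩ ⟨subset_union_left, subset_rfl, h2⟩
    exact hxA (this.1 (Or.inr (mem_connectedComponentIn hx)))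
  have clW : ∀ x ∈ W, (∃ u ∈ connectedComponentIn W x, u ∈ YY V W A B) → x ∈ YY V W A B := by
    rintro x hx ⟨u, hu, huY⟩
    by_contra hxY
    have hxB : x ∉ B := fun h => hxY (Or.inr ⟨hx, h⟩)
    have hPB : ∀ v ∈ connectedComponentIn W x, v ∉ B := fun v hv h =>
      hxB ((LC_mem_comp hadm.hB hv).1 h)
    obtain ⟨l', h1, h2⟩ := tree_step hW hV hMV.swap hw hadm.swap hPB
      ⟨hu, by rw [← YY_swap]; exact huY⟩ (hTW x hx)
    have := ht ⟨(A, B ∪ connectedComponentIn W x, l'), h1.swap⟩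
      ⟨subset_rfl, subset_union_left, fun y hy => h2 y (by rw [← YY_swap]; exact hy)⟩
    exact hxB (this.2.1 (Or.inr (mem_connectedComponentIn hx)))
  have hYLC : LC (V ∪ W) (· ∈ YY V W A B) := by
    intro z hz
    by_cases hzY : z ∈ YY V W A B
    · filter_upwards [hYo.mem_nhds hzY] with u hu
      simp [hu, hzY]
    · rcases hz with hz | hz
      · filter_upwards [comp_nhds hV hz] with u hu
        have : u ∉ YY V W A B := fun h => hzY (clV z hz ⟨u, hu, h⟩)
        simp [this, hzY]
      · filter_upwards [comp_nhds hW hz] with u hu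
        have : u ∉ YY V W A B := fun h => hzY (clW z hz ⟨u, hu, h⟩)
        simp [this, hzY]
  have hYall : V ∪ W ⊆ YY V W A B := by
    intro z hz
    have := hYLC.const_of_preconn hconn (Or.inl hx0) hz
    rw [this]; exact hadm.sub (mem_connectedComponentIn hx0)
  exact ⟨l, hadm.lc.mono (preimage_mono hYall), hadm.ext, fun hb x hx => hadm.bij hb x (hYall hx)⟩
end tree
end
end

section
set_option linter.unusedSectionVars false
set_option linter.deprecated false
noncomputable section

section geom
variable {E : Type*} [NormedAddCommGroup E] [InnerProductSpace ℂ E] [ProperSpace E]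

structure StepE (Q : Set E → Prop) (A B : Set E) : Prop where
  oA : IsOpen A
  cA : Convex ℝ A
  oB : IsOpen B
  cB : Convex ℝ B
  sub : A ⊆ B
  q : Q (B \ A)

def DT (R R'' ρ : ℝ) (T : Set E) : Set E :=
  Metric.ball 0 R'' ∩ {z | ∀ p ∈ Metric.sphere (0:E) R \ ⋃ a ∈ T, Metric.ball a ρ,
    (inner ℂ p z).re < R ^ 2}

theorem DT_open (R R'' ρ : ℝ) (T : Set E) : IsOpen (DT R R'' ρ T) := by
  refine Metric.isOpen_ball.inter ?_
  have hK : IsCompact (Metric.sphere (0:E) R \ ⋃ a ∈ T, Metric.ball a ρ) :=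
    (isCompact_sphere 0 R).diff (isOpen_biUnion fun _ _ => Metric.isOpen_ball)
  rw [isOpen_iff_mem_nhds]
  intro z hz
  refine hK.eventually_forall_of_forall_eventually (P := fun z p => (inner ℂ p z).re < R ^ 2) ?_
  intro p hp
  have : Continuous fun q : E × E => (inner ℂ q.2 q.1).re := by fun_prop
  exact this.continuousAt.eventually_lt continuousAt_const (hz p hp)

theorem DT_convex (R R'' ρ : ℝ) (T : Set E) : Convex ℝ (DT R R'' ρ T) := by
  refine (convex_ball _ _).inter ?_
  intro x hx y hy a b ha hb hab p hp
  have h1 := hx p hp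
  have h2 := hy p hp
  have : (inner ℂ p (a • x + b • y)).re = a * (inner ℂ p x).re + b * (inner ℂ p y).re := by
    rw [inner_add_right, ← Complex.coe_smul a x, ← Complex.coe_smul b y, inner_smul_right,
      inner_smul_right]; simp
  rw [this]
  rcases ha.eq_or_lt with rfl | ha'
  · have : b = 1 := by linarith
    subst this; linarith
  · nlinarith

theorem small_step {Q : Set E → Prop} (hQ : ∀ S T, S ⊆ T → Q T → Q S) {R R'' ρ : ℝ} (hR : 0 < R)
    (h1 : R ≤ R'') (h2 : R'' ^ 2 ≤ R ^ 2 + ρ ^ 2) (hρ : 0 < ρ)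
    (hb : ∀ a ∈ Metric.closedBall (0:E) R'', Q (Metric.ball a (2 * ρ))) :
    Relation.ReflTransGen (StepE Q) (Metric.ball 0 R) (Metric.ball 0 R'') := by
  classical
  obtain ⟨t, hts, htf, htc⟩ := (isCompact_sphere (0:E) R).finite_cover_balls hρ
  have h0 : DT R R'' ρ (∅ : Set E) = Metric.ball 0 R := by
    ext z
    simp only [DT, mem_inter_iff, mem_ball_zero_iff, mem_ofPred_eq, Set.mem_sdiff, mem_sphere_zero_iff_norm]
    constructor
    · rintro ⟨-, h⟩
      by_cases hz : z = 0
      · simpa [hz] using hR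
      · have hz' : 0 < ‖z‖ := norm_pos_iff.2 hz
        have := h (((R / ‖z‖ : ℝ) : ℂ) • z) ⟨by
          rw [norm_smul, Complex.norm_real, Real.norm_of_nonneg (by positivity)]; field_simp, by simp⟩
        rw [inner_smul_left, inner_self_eq_norm_sq_to_K] at this
        have e : ((starRingEnd ℂ) ((R / ‖z‖ : ℝ) : ℂ) * ((‖z‖:ℂ)) ^ 2).re = R * ‖z‖ := by
          rw [Complex.conj_ofReal]
          have : ((R / ‖z‖ : ℝ) : ℂ) * ((‖z‖:ℂ)) ^ 2 = ((R * ‖z‖ : ℝ) : ℂ) := by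
            rw [← Complex.ofReal_pow, ← Complex.ofReal_mul]; congr 1; field_simp
          rw [this, Complex.ofReal_re]
        have this' : R * ‖z‖ < R ^ 2 := by rw [← e]; exact this
        nlinarith
    · intro h
      refine ⟨by linarith, fun p hp => ?_⟩
      have := (Complex.re_le_norm (inner ℂ p z)).trans (norm_inner_le_norm p z)
      rw [hp.1] at this
      nlinarith
  have hind : ∀ s : Set E, s.Finite → s ⊆ t →
      Relation.ReflTransGen (StepE Q) (Metric.ball 0 R) (DT R R'' ρ s) := by
    intro s hs
    induction s, hs using Set.Finite.induction_on with
    | empty => intro _; rw [h0]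
    | @insert a s ha hs ih =>
      intro hst
      refine (ih ((subset_insert _ _).trans hst)).tail ⟨DT_open _ _ _ _, DT_convex _ _ _ _,
        DT_open _ _ _ _, DT_convex _ _ _ _, ?_, ?_⟩
      · rintro z ⟨hz1, hz2⟩
        refine ⟨hz1, fun p hp => hz2 p ⟨hp.1, fun h => hp.2 ?_⟩⟩
        rw [biUnion_insert]; exact Or.inr h
      · have haS : a ∈ Metric.sphere (0:E) R := hts (hst (mem_insert _ _))
        refine hQ _ _ ?_ (hb a (by
          rw [mem_closedBall_zero_iff]; rw [mem_sphere_zero_iff_norm] at haS; linarith))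
        rintro z ⟨⟨hz1, hz2⟩, hz3⟩
        have : ∃ p ∈ Metric.sphere (0:E) R \ ⋃ a ∈ s, Metric.ball a ρ,
            R ^ 2 ≤ (inner ℂ p z).re := by
          by_contra hcon
          push Not at hcon
          exact hz3 ⟨hz1, hcon⟩
        obtain ⟨p, hp, hpz⟩ := this
        have hpa : p ∈ Metric.ball a ρ := by
          by_contra hcon
          have := hz2 p ⟨hp.1, by
            rw [biUnion_insert]; rintro (h | h)
            · exact hcon h
            · exact hp.2 h⟩
          linarith
        have hzp : ‖z - p‖ < ρ := by
          have e := norm_sub_sq (𝕜 := ℂ) z p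
          have e2 : RCLike.re (inner ℂ z p) = (inner ℂ p z).re := by
            exact inner_re_symm (𝕜 := ℂ) z p
          rw [e2] at e
          have hp1 : ‖p‖ = R := by simpa using hp.1
          have hz1' : ‖z‖ < R'' := by simpa using hz1
          rw [hp1] at e
          have : ‖z‖ ^ 2 < R'' ^ 2 := by nlinarith [norm_nonneg z]
          nlinarith [norm_nonneg (z - p)]
        rw [mem_ball_iff_norm] at hpa ⊢
        have := norm_add_le (z - p) (p - a)
        rw [sub_add_sub_cancel] at this
        linarith
  have := hind t htf subset_rfl
  have hfin : DT R R'' ρ t = Metric.ball 0 R'' := by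
    unfold DT
    rw [sdiff_eq_empty.2 htc]; simp
  rwa [hfin] at this

theorem reach_ball {Q : Set E → Prop} (hQ : ∀ S T, S ⊆ T → Q T → Q S)
    (hQl : ∀ a : E, ∃ r > 0, Q (Metric.ball a r)) {R R' : ℝ} (hR : 0 < R)
    (h1 : R ≤ R') : Relation.ReflTransGen (StepE Q) (Metric.ball 0 R) (Metric.ball 0 R') := by
  choose r hr hrQ using hQl
  obtain ⟨δ, hδ, hL⟩ := lebesgue_number_lemma_of_metric (isCompact_closedBall (0:E) R')
    (c := fun a => Metric.ball a (r a)) (fun _ => Metric.isOpen_ball)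
    (fun x _ => mem_iUnion.2 ⟨x, Metric.mem_ball_self (hr x)⟩)
  have hb : ∀ a ∈ Metric.closedBall (0:E) R', Q (Metric.ball a (2 * (δ / 2))) := by
    intro a ha
    obtain ⟨i, hi⟩ := hL a ha
    rw [mul_div_cancel₀ _ two_ne_zero]
    exact hQ _ _ hi (hrQ i)
  set ρ := δ / 2
  have hρ : 0 < ρ := half_pos hδ
  let q : ℕ → ℝ := fun k => min R' (√(R ^ 2 + k * ρ ^ 2))
  have hq0 : q 0 = R := by simp [q, Real.sqrt_sq hR.le, h1]
  have hqpos : ∀ k, 0 < q k := fun k => lt_min (by linarith) (by positivity)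
  have hqs : ∀ k, Relation.ReflTransGen (StepE Q) (Metric.ball 0 R) (Metric.ball 0 (q k)) := by
    intro k
    induction k with
    | zero => rw [hq0]
    | succ k ih =>
      refine ih.trans (small_step hQ (ρ := ρ) (hqpos k) ?_ ?_ hρ fun a ha => hb a
        (Metric.closedBall_subset_closedBall (min_le_left _ _) ha))
      · apply min_le_min le_rfl
        apply Real.sqrt_le_sqrt
        push_cast; nlinarith [sq_nonneg ρ]
      · have hp := (hqpos (k+1)).le
        rcases min_choice R' (√(R ^ 2 + k * ρ ^ 2)) with h | h
        · have h2 : q (k+1) ≤ R' := min_le_left _ _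
          have : q k = R' := h
          rw [this]; nlinarith [sq_nonneg ρ]
        · have h2 : q (k+1) ≤ √(R ^ 2 + (k+1 : ℕ) * ρ ^ 2) := min_le_right _ _
          have : q k = √(R ^ 2 + k * ρ ^ 2) := h
          rw [this, Real.sq_sqrt (by positivity)]
          have h3 := Real.sq_sqrt (x := R ^ 2 + (k+1 : ℕ) * ρ ^ 2) (by positivity)
          push_cast at h2 h3
          have h4 := pow_le_pow_left₀ hp h2 2
          linarith
  obtain ⟨k, hk⟩ := exists_nat_gt (R' ^ 2 / ρ ^ 2)
  have : q k = R' := by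
    apply min_eq_left
    apply Real.le_sqrt_of_sq_le
    rw [div_lt_iff₀ (by positivity)] at hk
    nlinarith [sq_nonneg R]
  rw [← this]; exact hqs k

theorem reach_empty {Q : Set E → Prop} (hQ : ∀ S T, S ⊆ T → Q T → Q S)
    (hQl : ∀ a : E, ∃ r > 0, Q (Metric.ball a r)) {R : ℝ} (hR : 0 < R) :
    Relation.ReflTransGen (StepE Q) (∅ : Set E) (Metric.ball 0 R) := by
  obtain ⟨r, hr, hq⟩ := hQl 0
  refine Relation.ReflTransGen.head (b := Metric.ball 0 (min r R)) ⟨isOpen_empty, convex_empty,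
    Metric.isOpen_ball, convex_ball _ _, empty_subset _, hQ _ _ ?_ hq⟩
    (reach_ball hQ hQl (lt_min hr hR) (min_le_right _ _))
  exact sdiff_subset.trans (Metric.ball_subset_ball (min_le_left _ _))
end geom
end
end

section
set_option linter.unusedSectionVars false
set_option linter.deprecated false
noncomputable section

section phases
variable {E : Type*} [NormedAddCommGroup E] [InnerProductSpace ℂ E] [ProperSpace E]
variable {X Xt : Type} [TopologicalSpace X] [TopologicalSpace Xt]

/-- a family of good open sets -/
structure Fam (ι : X → E) (w : Xt → X) (𝒰 : Set (Set X)) : Prop where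
  cont : Continuous ι
  op : ∀ O ∈ 𝒰, IsOpen O
  al : ∀ O ∈ 𝒰, ∀ C : Set E, IsOpen C → Convex ℝ C → ∀ φ : X → X → ℚ,
    ZC (ι ⁻¹' C ∩ O) φ → BC (ι ⁻¹' C ∩ O) φ
  cov : ∀ a : E, ∃ r > 0, ∃ O ∈ 𝒰, ι ⁻¹' (Metric.ball a r) ⊆ O
  tr : ∀ O ∈ 𝒰, Triv w O

def QQ (ι : X → E) (𝒰 : Set (Set X)) (S : Set E) : Prop := ∃ O ∈ 𝒰, ι ⁻¹' S ⊆ O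

theorem QQ_mono (ι : X → E) (𝒰 : Set (Set X)) : ∀ S T, S ⊆ T → QQ ι 𝒰 T → QQ ι 𝒰 S :=
  fun _ _ h ⟨O, h1, h2⟩ => ⟨O, h1, (preimage_mono h).trans h2⟩

theorem Fam.ql {ι : X → E} {w : Xt → X} {𝒰 : Set (Set X)} (hF : Fam ι w 𝒰) :
    ∀ a : E, ∃ r > 0, QQ ι 𝒰 (Metric.ball a r) := hF.cov

def ExtP (A B : Set X) : Prop := ∀ φ : X → X → ℚ, ZC A φ →
  ∃ φ', ZC B φ' ∧ ∀ x ∈ A, φ' x = φ x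

theorem ExtP.trans {A B C : Set X} (hAB : A ⊆ B) (h1 : ExtP A B) (h2 : ExtP B C) : ExtP A C := by
  intro φ hφ
  obtain ⟨φ1, a, b⟩ := h1 φ hφ
  obtain ⟨φ2, c, d⟩ := h2 φ1 a
  exact ⟨φ2, c, fun x hx => by rw [d x (hAB hx), b x hx]⟩

theorem step_union {ι : X → E} {A B : Set E} {O : Set X} (h : A ⊆ B)
    (hO : ι ⁻¹' (B \ A) ⊆ O) : ι ⁻¹' A ∪ (ι ⁻¹' B ∩ O) = ι ⁻¹' B := by
  ext x
  constructor
  · rintro (h1 | h1)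
    · exact h h1
    · exact h1.1
  · intro hx
    by_cases hA : ι x ∈ A
    · exact Or.inl hA
    · exact Or.inr ⟨hx, hO ⟨hx, hA⟩⟩

theorem step_inter {ι : X → E} {A B : Set E} {O : Set X} (h : A ⊆ B) :
    ι ⁻¹' A ∩ (ι ⁻¹' B ∩ O) = ι ⁻¹' A ∩ O := by
  ext x
  exact ⟨fun h1 => ⟨h1.1, h1.2.2⟩, fun h1 => ⟨h1.1, h h1.1, h1.2⟩⟩

theorem Fam.ext_step {ι : X → E} {w : Xt → X} {𝒰 : Set (Set X)} (hF : Fam ι w 𝒰) {A B : Set E}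
    (hs : StepE (QQ ι 𝒰) A B) : ExtP (ι ⁻¹' A) (ι ⁻¹' B) := by
  obtain ⟨O, hO, hO2⟩ := hs.q
  intro φ hφ
  have hV : IsOpen (ι ⁻¹' A) := hs.oA.preimage hF.cont
  have hW : IsOpen (ι ⁻¹' B ∩ O) := (hs.oB.preimage hF.cont).inter (hF.op O hO)
  obtain ⟨f, hf⟩ := hF.al O hO A hs.oA hs.cA φ (hφ.mono inter_subset_left)
  obtain ⟨φ', h1, h2, -⟩ := glue_ext hV hW hφ (f := f) (by rw [step_inter hs.sub]; exact hf)
  rw [step_union hs.sub hO2] at h1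
  exact ⟨φ', h1, h2⟩

theorem reach_sub {Q : Set E → Prop} {A B : Set E} (h : Relation.ReflTransGen (StepE Q) A B) :
    A ⊆ B := by
  induction h with
  | refl => exact subset_rfl
  | tail _ h ih => exact ih.trans h.sub

theorem Fam.ext_reach {ι : X → E} {w : Xt → X} {𝒰 : Set (Set X)} (hF : Fam ι w 𝒰) {A B : Set E}
    (hs : Relation.ReflTransGen (StepE (QQ ι 𝒰)) A B) : ExtP (ι ⁻¹' A) (ι ⁻¹' B) := by
  induction hs with
  | refl => exact fun φ h => ⟨φ, h, fun _ _ => rfl⟩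
  | tail h1 h2 ih => exact ExtP.trans (preimage_mono (reach_sub h1)) ih (hF.ext_step h2)

theorem iUnion_balls (ι : X → E) (R : ℝ) : ⋃ k : ℕ, ι ⁻¹' (Metric.ball 0 (R + k)) = univ := by
  rw [eq_univ_iff_forall]
  intro x
  obtain ⟨k, hk⟩ := exists_nat_gt (‖ι x‖ - R)
  refine mem_iUnion.2 ⟨k, ?_⟩
  rw [mem_preimage, mem_ball_zero_iff]; linarith

theorem mono_balls (ι : X → E) (R : ℝ) : Monotone fun k : ℕ => ι ⁻¹' (Metric.ball 0 (R + k)) := by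
  intro k l h
  apply preimage_mono
  apply Metric.ball_subset_ball
  have : (k:ℝ) ≤ l := by exact_mod_cast h
  linarith

theorem Fam.ext_ball {ι : X → E} {w : Xt → X} {𝒰 : Set (Set X)} (hF : Fam ι w 𝒰) {R : ℝ}
    (hR : 0 < R) : ExtP (ι ⁻¹' (Metric.ball 0 R)) univ := by
  intro φ hφ
  have := ZC_extend_iUnion (V := fun k : ℕ => ι ⁻¹' (Metric.ball 0 (R + k))) (mono_balls ι R)
    (fun k => Metric.isOpen_ball.preimage hF.cont) (fun k => hF.ext_reach
      (reach_ball (QQ_mono ι 𝒰) hF.ql (by positivity) (by push_cast; linarith))) (k0 := 0) (φ := φ)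
    (by simpa using hφ)
  obtain ⟨φ', h1, h2⟩ := this
  rw [iUnion_balls] at h1
  exact ⟨φ', h1, fun x hx => h2 x (by simpa using hx)⟩

theorem ZC_zero_ext [LocallyConnectedSpace X] {U : Set X} (hU : IsOpen U) {x : X} {χ : X → X → ℚ}
    (hχ : ZC (connectedComponentIn U x) χ) :
    ∃ χ' : X → X → ℚ, ZC U χ' ∧ (∀ z ∈ connectedComponentIn U x, χ' z = χ z) ∧
      ∀ z, z ∉ connectedComponentIn U x → χ' z = 0 := by
  classical
  refine ⟨fun z => if z ∈ connectedComponentIn U x then χ z else 0, ?_,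
    fun z hz => by simp [hz], fun z hz => by simp [hz]⟩
  intro z hz
  by_cases hzP : z ∈ connectedComponentIn U x
  · filter_upwards [hχ z hzP, hU.connectedComponentIn.mem_nhds hzP] with y h1 h2
    simpa only [hzP, h2, if_true] using h1
  · filter_upwards [comp_nhds hU hz] with u hu
    have huP : u ∉ connectedComponentIn U x := fun h => hzP (by
      rw [connectedComponentIn_eq h, ← connectedComponentIn_eq hu]; exact mem_connectedComponentIn hz)
    simp [huP, hzP]

theorem BC.of_eq {V : Set X} {φ ψ : X → X → ℚ} (h : BC V φ) (e : ∀ x ∈ V, φ x = ψ x) : BC V ψ :=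
  h.congr fun x hx => by simp [e x hx]
theorem ZC.of_eq {V : Set X} (hV : IsOpen V) {φ ψ : X → X → ℚ} (h : ZC V φ)
    (e : ∀ x ∈ V, φ x = ψ x) : ZC V ψ := by
  intro x hx
  filter_upwards [h x hx, hV.mem_nhds hx] with y h1 h2
  rwa [← e x hx, ← e y h2]

/-- component of the trace -/
theorem comp_trace {U U' : Set X} (h : U ⊆ U') {x z : X} (hz : z ∈ U)
    (hz' : z ∈ connectedComponentIn U' x) :
    connectedComponentIn (U ∩ connectedComponentIn U' x) z = connectedComponentIn U z := by
  apply subset_antisymm (connectedComponentIn_mono _ inter_subset_left)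
  apply isPreconnected_connectedComponentIn.subset_connectedComponentIn (mem_connectedComponentIn hz)
  apply subset_inter (connectedComponentIn_subset _ _)
  rw [connectedComponentIn_eq hz']
  exact connectedComponentIn_mono _ h

theorem phase1 [LocallyConnectedSpace X] {ι : X → E} {w : Xt → X} (hw : IsLocalHomeomorph w)
    {𝒰 : Set (Set X)} (hF : Fam ι w 𝒰) {B : Set E}
    (hs : Relation.ReflTransGen (StepE (QQ ι 𝒰)) ∅ B) :
    ∀ x ∈ ι ⁻¹' B, (∀ χ, ZC (connectedComponentIn (ι ⁻¹' B) x) χ →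
      BC (connectedComponentIn (ι ⁻¹' B) x) χ) → Triv w (connectedComponentIn (ι ⁻¹' B) x) := by
  induction hs with
  | refl => intro x hx; exact hx.elim
  | @tail B B' h1 hs ih =>
    intro x hx hH
    obtain ⟨O, hO, hO2⟩ := hs.q
    set V1 := connectedComponentIn (ι ⁻¹' B') x with hV1
    have hB'o : IsOpen (ι ⁻¹' B') := hs.oB.preimage hF.cont
    have hBo : IsOpen (ι ⁻¹' B) := hs.oA.preimage hF.cont
    have hV1o : IsOpen V1 := hB'o.connectedComponentIn
    have hsub : ι ⁻¹' B ⊆ ι ⁻¹' B' := preimage_mono hs.sub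
    set V := ι ⁻¹' B ∩ V1 with hV
    set W := (ι ⁻¹' B' ∩ O) ∩ V1 with hW
    have hVo : IsOpen V := hBo.inter hV1o
    have hWo : IsOpen W := (hB'o.inter (hF.op O hO)).inter hV1o
    have hun : V ∪ W = V1 := by
      rw [hV, hW, ← union_inter_distrib_right, step_union hs.sub hO2]
      exact inter_eq_right.2 (connectedComponentIn_subset _ _)
    have hMV : MVS V W := fun c hc => MV_surj hVo hWo (fun φ hφ _ => by
      rw [hun] at hφ ⊢; exact hH φ hφ) hc
    have hconn : IsPreconnected (V ∪ W) := by
      rw [hun]; exact isPreconnected_connectedComponentIn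
    have hTV : ∀ z ∈ V, Triv w (connectedComponentIn V z) := by
      rintro z ⟨hz1, hz2⟩
      have e : connectedComponentIn V z = connectedComponentIn (ι ⁻¹' B) z := comp_trace hsub hz1 hz2
      rw [e]
      apply ih z hz1
      intro χ hχ
      obtain ⟨χ1, a1, a2, -⟩ := ZC_zero_ext hBo hχ
      obtain ⟨χ2, c1, c2⟩ := hF.ext_step hs χ1 a1
      have := hH χ2 (c1.mono (connectedComponentIn_subset _ _))
      have hsubc : connectedComponentIn (ι ⁻¹' B) z ⊆ V1 := by
        rw [← e]; exact (connectedComponentIn_subset _ _).trans inter_subset_right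
      refine (this.mono hsubc).of_eq fun u hu => ?_
      rw [c2 u (connectedComponentIn_subset _ _ hu), a2 u hu]
    have hTW : ∀ z ∈ W, Triv w (connectedComponentIn W z) := fun z hz =>
      (hF.tr O hO).mono ((connectedComponentIn_subset _ _).trans fun u hu => hu.1.2)
    have hxV1 : x ∈ V1 := mem_connectedComponentIn hx
    rw [← hun] at hxV1
    rcases hxV1 with hxV | hxW
    · obtain ⟨S, l0, a, b⟩ := hTV x hxV
      obtain ⟨l, c, -, d⟩ := tree hVo hWo hconn hMV hw hxV (fun z hz _ => hTV z hz) hTW l0 a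
      rw [← hun]; exact ⟨S, l, c, d b⟩
    · obtain ⟨S, l0, a, b⟩ := hTW x hxW
      rw [union_comm] at hconn hun
      obtain ⟨l, c, -, d⟩ := tree hWo hVo hconn hMV.swap hw hxW (fun z hz _ => hTW z hz) hTV l0 a
      rw [← hun]; exact ⟨S, l, c, d b⟩

theorem phase2 [LocallyConnectedSpace X] {ι : X → E} {w : Xt → X} (hw : IsLocalHomeomorph w)
    {𝒰 : Set (Set X)} (hF : Fam ι w 𝒰) {R0 R1 : ℝ} (hR0 : 0 < R0) (hR1 : R0 ≤ R1) {y0 : X}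
    (hy0 : y0 ∈ ι ⁻¹' Metric.ball 0 R0)
    (ht : ∀ χ, ZC univ χ → BC (connectedComponentIn (ι ⁻¹' Metric.ball 0 R0) y0) χ → BC univ χ)
    {l0 : Xt → Prop} (hl0 : LC (w ⁻¹' connectedComponentIn (ι ⁻¹' Metric.ball 0 R0) y0) l0) :
    ∃ l : Xt → Prop, LC (w ⁻¹' connectedComponentIn (ι ⁻¹' Metric.ball 0 R1) y0) l ∧
      ∀ y, w y ∈ connectedComponentIn (ι ⁻¹' Metric.ball 0 R0) y0 → l y = l0 y := by
  set Y0 := connectedComponentIn (ι ⁻¹' Metric.ball 0 R0) y0 with hY0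
  have key : ∀ A, Relation.ReflTransGen (StepE (QQ ι 𝒰)) A (Metric.ball 0 R1) →
      Relation.ReflTransGen (StepE (QQ ι 𝒰)) (Metric.ball 0 R0) A →
      (∃ l : Xt → Prop, LC (w ⁻¹' connectedComponentIn (ι ⁻¹' A) y0) l ∧
        ∀ y, w y ∈ Y0 → l y = l0 y) →
      (∃ l : Xt → Prop, LC (w ⁻¹' connectedComponentIn (ι ⁻¹' Metric.ball 0 R1) y0) l ∧
        ∀ y, w y ∈ Y0 → l y = l0 y) := by
    intro A hA
    induction hA using Relation.ReflTransGen.head_induction_on with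
    | refl => exact fun _ h => h
    | @head B B' hs h1 ih =>
      intro hR hl
      refine ih (hR.tail hs) ?_
      obtain ⟨l1, hl1, hl1e⟩ := hl
      have hEB' : ExtP (ι ⁻¹' B') univ := ExtP.trans (preimage_mono (reach_sub h1)) (hF.ext_reach h1)
        (hF.ext_ball (by linarith))
      have hEB : ExtP (ι ⁻¹' B) univ := ExtP.trans (preimage_mono hs.sub) (hF.ext_step hs) hEB'
      obtain ⟨O, hO, hO2⟩ := hs.q
      set V1 := connectedComponentIn (ι ⁻¹' B') y0 with hV1
      have hB'o : IsOpen (ι ⁻¹' B') := hs.oB.preimage hF.cont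
      have hBo : IsOpen (ι ⁻¹' B) := hs.oA.preimage hF.cont
      have hV1o : IsOpen V1 := hB'o.connectedComponentIn
      have hsub : ι ⁻¹' B ⊆ ι ⁻¹' B' := preimage_mono hs.sub
      have hy0B : y0 ∈ ι ⁻¹' B := reach_sub hR hy0
      have hY0B : Y0 ⊆ connectedComponentIn (ι ⁻¹' B) y0 :=
        connectedComponentIn_mono _ (preimage_mono (reach_sub hR))
      have hBV1 : connectedComponentIn (ι ⁻¹' B) y0 ⊆ V1 := connectedComponentIn_mono _ hsub
      set V := ι ⁻¹' B ∩ V1 with hV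
      set W := (ι ⁻¹' B' ∩ O) ∩ V1 with hW
      have hVo : IsOpen V := hBo.inter hV1o
      have hWo : IsOpen W := (hB'o.inter (hF.op O hO)).inter hV1o
      have hun : V ∪ W = V1 := by
        rw [hV, hW, ← union_inter_distrib_right, step_union hs.sub hO2]
        exact inter_eq_right.2 (connectedComponentIn_subset _ _)
      have hY0V : Y0 ⊆ V := fun u hu => ⟨connectedComponentIn_subset _ _ (hY0B hu), hBV1 (hY0B hu)⟩
      have hz : ∀ χ : X → X → ℚ, (∀ z ∈ Y0, χ z = 0) → BC Y0 χ := fun χ h =>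
        ⟨0, fun z hz => by simp [h z hz]⟩
      have hMV : MVS V W := fun c hc => MV_surj hVo hWo (fun φ hφ h0 => by
        rw [hun] at hφ ⊢
        obtain ⟨χ1, a1, a2, -⟩ := ZC_zero_ext hB'o hφ
        obtain ⟨χ2, c1, c2⟩ := hEB' χ1 a1
        have := ht χ2 c1 (hz χ2 fun z hz => by
          rw [c2 z (hsub (hY0V hz).1), a2 z (hY0V hz).2, h0 z (hY0V hz)])
        refine (this.mono (subset_univ V1)).of_eq fun u hu => ?_
        rw [c2 u (connectedComponentIn_subset _ _ hu), a2 u hu]) hc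
      have hconn : IsPreconnected (V ∪ W) := by
        rw [hun]; exact isPreconnected_connectedComponentIn
      have hyV : y0 ∈ V := hY0V (mem_connectedComponentIn hy0)
      have e0 : connectedComponentIn V y0 = connectedComponentIn (ι ⁻¹' B) y0 :=
        comp_trace hsub hyV.1 hyV.2
      have hTV : ∀ z ∈ V, z ∉ connectedComponentIn V y0 → Triv w (connectedComponentIn V z) := by
        rintro z ⟨hz1, hz2⟩ hz3
        have e : connectedComponentIn V z = connectedComponentIn (ι ⁻¹' B) z :=
          comp_trace hsub hz1 hz2
        rw [e]
        apply phase1 hw hF ((reach_empty (QQ_mono ι 𝒰) hF.ql hR0).trans hR) z hz1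
        intro χ hχ
        obtain ⟨χ1, a1, a2, a3⟩ := ZC_zero_ext hBo hχ
        obtain ⟨χ2, c1, c2⟩ := hEB χ1 a1
        have := ht χ2 c1 (hz χ2 fun u hu => by
          rw [c2 u (hY0V hu).1, a3]
          intro hcon
          rw [e0] at hz3
          apply hz3
          rw [connectedComponentIn_eq (hY0B hu), ← connectedComponentIn_eq hcon]
          exact mem_connectedComponentIn hz1)
        refine (this.mono (subset_univ _)).of_eq fun u hu => ?_
        rw [c2 u (connectedComponentIn_subset _ _ hu), a2 u hu]
      have hTW : ∀ z ∈ W, Triv w (connectedComponentIn W z) := fun z hz =>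
        (hF.tr O hO).mono ((connectedComponentIn_subset _ _).trans fun u hu => hu.1.2)
      obtain ⟨l, c, d, -⟩ := tree hVo hWo hconn hMV hw hyV hTV hTW l1 (by rw [e0]; exact hl1)
      rw [hun] at c
      refine ⟨l, c, fun y hy => ?_⟩
      rw [d y (by rw [e0]; exact hY0B hy), hl1e y hy]
  exact key _ (reach_ball (QQ_mono ι 𝒰) hF.ql hR0 hR1) .refl ⟨l0, hl0, fun _ _ => rfl⟩

theorem partC [LocallyConnectedSpace X] [PreconnectedSpace X] [PathConnectedSpace Xt] {ι : X → E}
    {w : Xt → X} (hw : IsLocalHomeomorph w)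
    {𝒰 : Set (Set X)} (hF : Fam ι w 𝒰) {R0 : ℝ} (hR0 : 0 < R0) {y0 : X}
    (hy0 : y0 ∈ ι ⁻¹' Metric.ball 0 R0)
    (ht : ∀ χ, ZC univ χ → BC (connectedComponentIn (ι ⁻¹' Metric.ball 0 R0) y0) χ → BC univ χ)
    {l0 : Xt → Prop} (hl0 : LC (w ⁻¹' connectedComponentIn (ι ⁻¹' Metric.ball 0 R0) y0) l0)
    {y1 y2 : Xt} (h1 : w y1 ∈ connectedComponentIn (ι ⁻¹' Metric.ball 0 R0) y0)
    (h2 : w y2 ∈ connectedComponentIn (ι ⁻¹' Metric.ball 0 R0) y0) : l0 y1 → l0 y2 := by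
  obtain ⟨γ⟩ := PathConnectedSpace.joined y1 y2
  let V := fun k : ℕ => ι ⁻¹' (Metric.ball 0 (R0 + k))
  have hVm := mono_balls ι R0
  have hVo : ∀ k, IsOpen (V k) := fun k => Metric.isOpen_ball.preimage hF.cont
  have hU := iUnion_comp hVm hVo (x0 := y0) ⟨0, by simpa [V] using hy0⟩
  rw [iUnion_balls, connectedComponentIn_univ, PreconnectedSpace.connectedComponent_eq_univ] at hU
  have hcpt : IsCompact (range (w ∘ γ)) := isCompact_range (hw.continuous.comp γ.continuous)
  obtain ⟨k, hk⟩ := hcpt.elim_directed_cover (fun k => connectedComponentIn (V k) y0)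
    (fun k => (hVo k).connectedComponentIn) (by rw [← hU]; exact subset_univ _)
    (directed_of_isDirected_le fun i j hij => connectedComponentIn_mono _ (hVm hij))
  obtain ⟨l, hl, he⟩ := phase2 hw hF hR0 (R1 := R0 + k) (by linarith [Nat.cast_nonneg (α := ℝ) k])
    hy0 ht hl0
  have := (hl.mono (W := range γ) (by
    rintro _ ⟨t, rfl⟩; exact hk ⟨t, rfl⟩)).const_of_preconn
      (isPreconnected_range γ.continuous) ⟨0, γ.source⟩ ⟨1, γ.target⟩
  rw [he y1 h1, he y2 h2] at this
  rw [this]; exact id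
end phases
end
end

section
set_option linter.unusedSectionVars false
noncomputable section

section charts
variable {E : Type*} [NormedAddCommGroup E] [InnerProductSpace ℂ E] [ProperSpace E]
variable {X Xt : Type} [TopologicalSpace X] [TopologicalSpace Xt]

structure DCh (T : Set X) (e : ℂ → X) (c : X → ℂ) : Prop where
  op : IsOpen T
  ec : ContinuousOn e (Metric.ball 0 1)
  em : MapsTo e (Metric.ball 0 1) T
  cc : ContinuousOn c T
  cm : MapsTo c T (Metric.ball 0 1)
  inv : ∀ x ∈ T, e (c x) = x

def DCov (ι : X → E) : Prop := ∀ x : X, ∀ U ∈ 𝓝 x, ∃ T e c, DCh T e c ∧ x ∈ T ∧ T ⊆ U ∧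
  DifferentiableOn ℂ (ι ∘ e) (Metric.ball 0 1)

theorem DCh.conn {T : Set X} {e : ℂ → X} {c : X → ℂ} (h : DCh T e c) : IsPathConnected T := by
  have : T = e '' Metric.ball 0 1 := by
    apply subset_antisymm
    · intro x hx; exact ⟨c x, h.cm hx, h.inv x hx⟩
    · exact h.em.image_subset
  rw [this]
  refine IsPathConnected.image' ?_ h.ec
  exact (convex_ball (0:ℂ) 1).isPathConnected ⟨0, by simp⟩

theorem DCov.lpc {ι : X → E} (h : DCov ι) : LocallyPathConnectedSpace X := by
  refine ⟨fun x => ⟨fun U => ⟨fun hU => ?_, ?_⟩⟩⟩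
  · obtain ⟨T, e, c, h1, h2, h3, -⟩ := h x U hU
    exact ⟨T, ⟨h1.op.mem_nhds h2, h1.conn⟩, h3⟩
  · rintro ⟨T, ⟨h1, -⟩, h2⟩; exact mem_of_superset h1 h2

theorem alpha {ι : X → E} (hι : Continuous ι) {T : Set X} {e : ℂ → X} {c : X → ℂ} (h : DCh T e c)
    (hd : DifferentiableOn ℂ (ι ∘ e) (Metric.ball 0 1)) {C : Set E} (hC : IsOpen C)
    (hc : Convex ℝ C) {φ : X → X → ℚ} (hφ : ZC (ι ⁻¹' C ∩ T) φ) : BC (ι ⁻¹' C ∩ T) φ := by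
  have hW : IsOpen {ζ | ζ ∈ Metric.ball (0:ℂ) 1 ∧ (ι ∘ e) ζ ∈ C} :=
    hd.continuousOn.isOpen_inter_preimage Metric.isOpen_ball hC
  have h1 := hφ.comp hW (h.ec.mono fun z hz => hz.1) (fun z hz => ⟨hz.2, h.em hz.1⟩)
  obtain ⟨f, hf⟩ := disc_convex_BC hd hC hc h1
  have hV : IsOpen (ι ⁻¹' C ∩ T) := (hC.preimage hι).inter h.op
  have h2 := hf.comp hV (g := c) (h.cc.mono inter_subset_right) (fun x hx => ⟨h.cm hx.2, by
    simp only [Function.comp_apply, h.inv x hx.2]; exact hx.1⟩)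
  refine ⟨f ∘ c, fun x hx => ?_⟩
  filter_upwards [h2 x hx, h.op.mem_nhds hx.2] with u hu huT
  rw [← hu]
  simp only [h.inv x hx.2, h.inv u huT]

theorem triv_of_cov {w : Xt → X} (hw : IsCoveringMap w) (hs : Function.Surjective w) (x : X) : ∃ U ∈ 𝓝 x, Triv w U := by
  obtain ⟨hd, U, hxU, hU, hU', H, hH⟩ := hw x
  refine ⟨U, hU.mem_nhds hxU, ?_⟩
  classical
  obtain ⟨s0⟩ : Nonempty (w ⁻¹' {x}) := ⟨_, (hs x).choose_spec⟩
  refine ⟨_, fun y => if h : y ∈ w ⁻¹' U then (H ⟨y, h⟩).2 else s0, ?_, ?_⟩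
  · intro y hy
    have hc : Continuous fun z : w ⁻¹' U => (H z).2 := by fun_prop
    have h1 : ∀ᶠ z in 𝓝 (⟨y, hy⟩ : w ⁻¹' U), (H z).2 = (H ⟨y, hy⟩).2 :=
      (hc.continuousAt (x := ⟨y, hy⟩)).eventually (p := fun q => q = (H ⟨y, hy⟩).2)
        (by rw [nhds_discrete]; exact rfl)
    rw [nhds_subtype_eq_comap, eventually_comap] at h1
    filter_upwards [h1, hU'.mem_nhds hy] with z h1 hz
    simp only [dif_pos hz, dif_pos hy]; exact h1 ⟨z, hz⟩ rfl
  · intro z hz s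
    refine ⟨(H.symm (⟨z, hz⟩, s)).1, ?_, ?_⟩
    · have h1 := hH (H.symm (⟨z, hz⟩, s))
      rw [H.apply_symm_apply] at h1
      have h2 : (H.symm (⟨z, hz⟩, s)).1 ∈ w ⁻¹' U := (H.symm (⟨z, hz⟩, s)).2
      refine ⟨h1.symm, ?_⟩
      simp only [dif_pos h2, Subtype.coe_eta, H.apply_symm_apply]
    · rintro y ⟨h1, h2⟩
      have h3 : y ∈ w ⁻¹' U := by rw [mem_preimage, h1]; exact hz
      simp only [dif_pos h3] at h2
      have : H ⟨y, h3⟩ = (⟨z, hz⟩, s) := Prod.ext (Subtype.ext (by rw [hH]; exact h1)) h2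
      rw [← this, H.symm_apply_apply]

theorem cov_surj [PreconnectedSpace X] [Nonempty Xt] {w : Xt → X} (hw : IsCoveringMap w) :
    Function.Surjective w := by
  have : LC (univ : Set X) (fun x => x ∈ range w) := by
    intro x _
    obtain ⟨hd, U, hxU, hU, hU', H, hH⟩ := hw x
    have : ∀ u ∈ U, (u ∈ range w ↔ Nonempty (w ⁻¹' {x})) := by
      intro u hu
      constructor
      · rintro ⟨y, rfl⟩; exact ⟨(H ⟨y, hu⟩).2⟩
      · rintro ⟨s⟩
        have h1 := hH (H.symm (⟨u, hu⟩, s))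
        rw [H.apply_symm_apply] at h1
        exact ⟨_, h1.symm⟩
    filter_upwards [hU.mem_nhds hxU] with u hu
    exact propext ((this u hu).trans (this x hxU).symm)
  intro x
  obtain ⟨y⟩ := ‹Nonempty Xt›
  have := this.const_of_preconn isPreconnected_univ (x := w y) (y := x) trivial trivial
  have h : x ∈ range w := by rw [this]; exact ⟨y, rfl⟩
  exact h

theorem mkFam {ι : X → E} (hι : IsClosedEmbedding ι) (hD : DCov ι) {w : Xt → X}
    (hw : IsCoveringMap w) (hs : Function.Surjective w) [Nonempty X] : ∃ 𝒰, Fam ι w 𝒰 := by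
  have ex : ∀ x : X, ∃ T e c, DCh T e c ∧ x ∈ T ∧ Triv w T ∧
      DifferentiableOn ℂ (ι ∘ e) (Metric.ball 0 1) := by
    intro x
    obtain ⟨U, hU, hT⟩ := triv_of_cov hw hs x
    obtain ⟨T, e, c, h1, h2, h3, h4⟩ := hD x U hU
    exact ⟨T, e, c, h1, h2, hT.mono h3, h4⟩
  refine ⟨{T | ∃ e c, DCh T e c ∧ Triv w T ∧ DifferentiableOn ℂ (ι ∘ e) (Metric.ball 0 1)},
    hι.continuous, ?_, ?_, ?_, ?_⟩
  · rintro T ⟨e, c, h, -⟩; exact h.op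
  · rintro T ⟨e, c, h, -, hd⟩ C hC hc φ hφ
    exact alpha hι.continuous h hd hC hc hφ
  · intro a
    by_cases ha : a ∈ range ι
    · obtain ⟨x, rfl⟩ := ha
      obtain ⟨T, e, c, h1, h2, h3, h4⟩ := ex x
      have := h1.op.mem_nhds h2
      rw [hι.isInducing.nhds_eq_comap, mem_comap] at this
      obtain ⟨S, hS, hST⟩ := this
      obtain ⟨r, hr, hrS⟩ := Metric.mem_nhds_iff.1 hS
      exact ⟨r, hr, T, ⟨e, c, h1, h3, h4⟩, (preimage_mono hrS).trans hST⟩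
    · obtain ⟨x⟩ := ‹Nonempty X›
      obtain ⟨T, e, c, h1, h2, h3, h4⟩ := ex x
      obtain ⟨r, hr, hrS⟩ := Metric.mem_nhds_iff.1 (hι.isClosed_range.isOpen_compl.mem_nhds ha)
      refine ⟨r, hr, T, ⟨e, c, h1, h3, h4⟩, fun y hy => (hrS hy ⟨y, rfl⟩).elim⟩
  · rintro T ⟨e, c, h, h1, -⟩; exact h1
end charts
end
end

section
noncomputable section
open CategoryTheory Simplicial Opposite
section
variable {X : Type} [TopologicalSpace X]

abbrev Sg (X : Type) [TopologicalSpace X] (n : ℕ) := C(stdSimplex ℝ (Fin (n+1)), X)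

def face {n : ℕ} (i : Fin (n+2)) (σ : Sg X (n+1)) : Sg X n :=
  σ.comp ⟨stdSimplex.map i.succAbove, stdSimplex.continuous_map _⟩

def sgE (X : Type) [TopologicalSpace X] (n : ℕ) :
   (TopCat.toSSet.obj (TopCat.of X)) _⦋n⦌ ≃ Sg X n := TopCat.toSSetObjEquiv (TopCat.of X) (op ⦋n⦌)

theorem sgE_face (n : ℕ) (i : Fin (n+2)) (s : (TopCat.toSSet.obj (TopCat.of X)) _⦋n+1⦌) :
    sgE X n ((TopCat.toSSet.obj (TopCat.of X)).δ i s) = face i (sgE X (n+1) s) := by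
  rfl

def ch (n : ℕ) (s : Sg X n) : (singularChainComplex X).X n :=
   (ModuleCat.freeMk ((sgE X n).symm s) : (ModuleCat.free ℚ).obj ((TopCat.toSSet.obj (TopCat.of X)) _⦋n⦌))

theorem objD_apply (Y : SimplicialObject (ModuleCat.{0} ℚ)) (n : ℕ) (v : Y _⦋n+1⦌) :
    (AlgebraicTopology.AlternatingFaceMapComplex.objD Y n).hom v =
    ∑ i : Fin (n+2), (-1 : ℚ)^(i:ℕ) • (Y.δ i).hom v := by
  unfold AlgebraicTopology.AlternatingFaceMapComplex.objD
  rw [ModuleCat.hom_sum, LinearMap.sum_apply]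
  refine Finset.sum_congr rfl fun i _ => ?_
  rw [ModuleCat.hom_zsmul, LinearMap.smul_apply]
  rcases Nat.even_or_odd (i:ℕ) with h | h
  · rw [h.neg_one_pow, h.neg_one_pow, one_smul, one_smul]
  · rw [h.neg_one_pow, h.neg_one_pow, neg_smul, neg_smul, one_smul, one_smul]

theorem objD_free (S : SSet.{0}) (n : ℕ) (s : S _⦋n+1⦌) :
    (AlgebraicTopology.AlternatingFaceMapComplex.objD (((CategoryTheory.SimplicialObject.whiskering (Type) (ModuleCat ℚ)).obj
      (ModuleCat.free ℚ)).obj S) n).hom (ModuleCat.freeMk s : (ModuleCat.free ℚ).obj (S _⦋n+1⦌)) =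
    (∑ i : Fin (n+2), (-1 : ℚ)^(i:ℕ) • (ModuleCat.freeMk (S.δ i s)) : (ModuleCat.free ℚ).obj (S _⦋n⦌)) := by
  refine (objD_apply _ n _).trans (Finset.sum_congr rfl fun i _ => ?_)
  exact congrArg (fun w : (ModuleCat.free ℚ).obj (S _⦋n⦌) => (-1 : ℚ)^(i:ℕ) • w) (ModuleCat.free_map_apply _ _)

theorem d_ch (n : ℕ) (s : Sg X (n+1)) : ((singularChainComplex X).d (n+1) n).hom (ch (n+1) s) =
    ∑ i : Fin (n+2), (-1 : ℚ)^(i:ℕ) • ch n (face i s) := by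
  have := AlgebraicTopology.alternatingFaceMapComplex_obj_d (((CategoryTheory.SimplicialObject.whiskering (Type) (ModuleCat ℚ)).obj
      (ModuleCat.free ℚ)).obj (TopCat.toSSet.obj (TopCat.of X))) n
  have e : (singularChainComplex X).d (n+1) n = AlgebraicTopology.AlternatingFaceMapComplex.objD (((CategoryTheory.SimplicialObject.whiskering (Type) (ModuleCat ℚ)).obj
      (ModuleCat.free ℚ)).obj (TopCat.toSSet.obj (TopCat.of X))) n := this
  rw [e]
  exact objD_free _ n _

def fn (n : ℕ) (c : Sg X n → ℚ) : (singularChainComplex X).X n →ₗ[ℚ] ℚ :=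
   (Finsupp.lift ℚ ℚ ((TopCat.toSSet.obj (TopCat.of X)) _⦋n⦌) (fun s => c (sgE X n s)) : 
    (((TopCat.toSSet.obj (TopCat.of X)) _⦋n⦌) →₀ ℚ) →ₗ[ℚ] ℚ)

theorem fn_ch (n : ℕ) (c : Sg X n → ℚ) (s : Sg X n) : fn n c (ch n s) = c s := by
  have : (Finsupp.lift ℚ ℚ ((TopCat.toSSet.obj (TopCat.of X)) _⦋n⦌) (fun s => c (sgE X n s)) : 
    (((TopCat.toSSet.obj (TopCat.of X)) _⦋n⦌) →₀ ℚ) →ₗ[ℚ] ℚ) (Finsupp.single ((sgE X n).symm s) 1) = c s := by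
      simp
  exact this

theorem ch_ext (n : ℕ) {V : Type*} [AddCommGroup V] [Module ℚ V] (f g : (singularChainComplex X).X n →ₗ[ℚ] V) (h : ∀ s, f (ch n s) = g (ch n s)) :
   f = g := by
  refine Finsupp.lhom_ext' (R := ℚ) (σ₁₂ := RingHom.id ℚ) (α := (TopCat.toSSet.obj (TopCat.of X)) _⦋n⦌) (φ := f) (ψ := g) ?_
  intro s
  refine LinearMap.ext_ring ?_
  have := h (sgE X n s)
  unfold ch at this
  rw [Equiv.symm_apply_apply] at this
  exact this

theorem hom_equiv (X : Type) [TopologicalSpace X] : Nonempty (singularHomology X 1 ≃ₗ[ℚ] 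
   (LinearMap.ker ((singularChainComplex X).d 1 0).hom ⧸ LinearMap.range (((singularChainComplex X).d 2 1).hom.codRestrict
    (LinearMap.ker ((singularChainComplex X).d 1 0).hom) (fun x => by 
     have h := (singularChainComplex X).d_comp_d 2 1 0
     exact congrArg (fun f => f.hom x) h)))) := by
  have i1 := HomologicalComplex.homologyIsoSc' (singularChainComplex X) 2 1 0 (by simp) (by simp)
  have i2 := ((singularChainComplex X).sc' 2 1 0).moduleCatHomologyIso
  exact ⟨(i1 ≪≫ i2).toLinearEquiv⟩

/-- path functionals -/
structure PF (D : C(ℝ, X) → ℚ) : Prop where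
  tri : ∀ (G : C(ℝ × ℝ, X)) (g0 g1 g2 : C(ℝ, X)), ∀ (h0 : ∀ t, g0 t = G (1 - t, t)) (h1 : ∀ t, g1 t = G (0, t))
    (h2 : ∀ t, g2 t = G (t, 0)), D g0 - D g1 + D g2 = 0
  ext : ∀ g h : C(ℝ, X), (∀ t ∈ Icc (0:ℝ) 1, g t = h t) → D g = D h

def pth (g : C(ℝ, X)) : Sg X 1 := ⟨fun x => g (x.1 1), g.continuous.comp ((continuous_apply 1).comp continuous_subtype_val)⟩
def trg (G : C(ℝ × ℝ, X)) : Sg X 2 := ⟨fun x => G (x.1 1, x.1 2), G.continuous.comp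
  (((continuous_apply 1).comp continuous_subtype_val).prodMk ((continuous_apply 2).comp continuous_subtype_val))⟩

def cl1 (t : ℝ) : stdSimplex ℝ (Fin 2) := ⟨![1 - max 0 (min t 1), max 0 (min t 1)], by
  constructor
  · intro i; fin_cases i
    · simp
    · simp
  · simp⟩
def cl2 (z : ℝ × ℝ) : stdSimplex ℝ (Fin 3) := ⟨![1 - max 0 (min z.1 1) - max 0 (min z.2 (1 - max 0 (min z.1 1))),
    max 0 (min z.1 1), max 0 (min z.2 (1 - max 0 (min z.1 1)))], by
  constructor
  · intro i; fin_cases i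
    · simp
    · simp
    · simp
  · simp [Fin.sum_univ_three]; ring⟩
theorem cl1_cont : Continuous cl1 := by
  unfold cl1
  refine Continuous.subtype_mk (continuous_pi fun i => ?_) _
  fin_cases i <;> simp <;> fun_prop
theorem cl2_cont : Continuous cl2 := by
  unfold cl2
  refine Continuous.subtype_mk (continuous_pi fun i => ?_) _
  fin_cases i <;> simp <;> fun_prop

def bk (s : Sg X 1) : C(ℝ, X) := ⟨fun t => s (cl1 t), by have := cl1_cont; fun_prop⟩
def bk2 (s : Sg X 2) : C(ℝ × ℝ, X) := ⟨fun t => s (cl2 t), by have := cl2_cont; fun_prop⟩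

theorem pth_bk (s : Sg X 1) : pth (bk s) = s := by
  ext x
  show s (cl1 (x.1 1)) = s x
  congr 1
  have h := x.2.2
  have h0 := x.2.1 0
  have h1 := x.2.1 1
  rw [Fin.sum_univ_two] at h
  apply Subtype.ext
  funext i
  have e : max 0 (min (x.1 1) 1) = x.1 1 := by
    rw [min_eq_left (by linarith), max_eq_right h1]
  fin_cases i
  · show 1 - max 0 (min (x.1 1) 1) = x.1 0
    rw [e]; linarith
  · exact e

theorem map_face (i : Fin 3) (x : stdSimplex ℝ (Fin 2)) :
    (stdSimplex.map i.succAbove x).1 = (![![0, x.1 0, x.1 1], ![x.1 0, 0, x.1 1], ![x.1 0, x.1 1, 0]] : Fin 3 → Fin 3 → ℝ) i := by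
  have : (stdSimplex.map i.succAbove x).1 = _ := stdSimplex.map_coe i.succAbove x
  rw [this]
  funext j
  rw [FunOnFinite.linearMap_apply_apply, Finset.sum_filter, Fin.sum_univ_two]
  fin_cases i <;> fin_cases j <;> simp [Fin.succAbove, Fin.lt_def, Fin.ext_iff] <;> rfl

theorem face_trg (G : C(ℝ × ℝ, X)) (i : Fin 3) (g : C(ℝ, X))
    (h : ∀ t, g t = G ((![(1 - t, t), (0, t), (t, 0)] : Fin 3 → ℝ × ℝ) i)) : face i (trg G) = pth g := by
  ext x
  show G ((stdSimplex.map i.succAbove x).1 1, (stdSimplex.map i.succAbove x).1 2) = g (x.1 1)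
  have hh := x.2.2
  rw [Fin.sum_univ_two] at hh
  have h0 : x.1 0 = 1 - x.1 1 := by linarith
  rw [h, map_face]
  fin_cases i
  · simp [h0]
  · simp
  · simp

theorem bk_face (s : Sg X 2) (i : Fin 3) (t : ℝ) (ht : t ∈ Icc (0:ℝ) 1) :
    bk (face i s) t = bk2 s ((![(1 - t, t), (0, t), (t, 0)] : Fin 3 → ℝ × ℝ) i) := by
  show s (stdSimplex.map i.succAbove (cl1 t)) = s (cl2 _)
  congr 1
  apply Subtype.ext
  rw [map_face]
  have e : max 0 (min t 1) = t := by rw [min_eq_left ht.2, max_eq_right ht.1]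
  have e' : max 0 (min (1 - t) 1) = 1 - t := by
    rw [min_eq_left (by linarith [ht.1]), max_eq_right (by linarith [ht.2])]
  fin_cases i
  · simp [cl1, cl2]
    rw [e', e]
    simp [ht.1]
  · simp [cl1, cl2, e]
  · simp [cl1, cl2, e, ht.2]

theorem face_one (g : Sg X 1) (i : Fin 2) (x) : face i g x = bk g ((![1, 0] : Fin 2 → ℝ) i) := by
  show g (stdSimplex.map i.succAbove x) = g (cl1 _)
  have hx : x = stdSimplex.vertex 0 := Subsingleton.elim _ _
  rw [hx, stdSimplex.map_vertex]
  congr 1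
  apply Subtype.ext
  funext j
  fin_cases i <;> fin_cases j <;> simp [cl1] <;> rfl

theorem H1_I (r : ℕ) (h1 : FiniteBetti X 1) (h2 : bettiNumber X 1 = r) :
    ∃ c : Fin r → C(ℝ, X) → ℚ, (∀ j, PF (c j)) ∧
      ∀ (a : Fin r → ℚ) (f : X → ℚ), (∀ g, ∑ j, a j * c j g = f (g 1) - f (g 0)) → a = 0 := by
  obtain ⟨e⟩ := hom_equiv X
  have : FiniteDimensional ℚ (singularHomology X 1) := h1
  let b := (Module.finBasisOfFinrankEq ℚ (singularHomology X 1) h2)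
  let q : Fin r → (LinearMap.ker ((singularChainComplex X).d 1 0).hom →ₗ[ℚ] ℚ) := fun j =>
    (b.coord j) ∘ₗ e.symm.toLinearMap ∘ₗ Submodule.mkQ _
  have hq : ∀ j, ∃ Q : (singularChainComplex X).X 1 →ₗ[ℚ] ℚ, Q ∘ₗ Submodule.subtype _ = q j :=
    fun j => LinearMap.exists_extend (q j)
  choose Q hQ using hq
  refine ⟨fun j g => Q j (ch 1 (pth g)), fun j => ⟨?_, ?_⟩, ?_⟩
  · intro G g0 g1 g2 e0 e1 e2
    have hd := d_ch 1 (trg G)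
    have hm : ((singularChainComplex X).d 2 1).hom (ch 2 (trg G)) ∈ LinearMap.ker ((singularChainComplex X).d 1 0).hom := by
      have h := (singularChainComplex X).d_comp_d 2 1 0
      exact congrArg (fun f => f.hom (ch 2 (trg G))) h
    have hz : Q j (((singularChainComplex X).d 2 1).hom (ch 2 (trg G))) = 0 := by
      have h3 := LinearMap.congr_fun (hQ j) ⟨_, hm⟩
      have h4 : q j ⟨_, hm⟩ = 0 := by
        show b.coord j (e.symm (Submodule.mkQ _ ⟨_, hm⟩)) = 0
        have : Submodule.mkQ (LinearMap.range (((singularChainComplex X).d 2 1).hom.codRestrict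
          (LinearMap.ker ((singularChainComplex X).d 1 0).hom) (fun x => by
          have h := (singularChainComplex X).d_comp_d 2 1 0
          exact congrArg (fun f => f.hom x) h))) ⟨_, hm⟩ = 0 := by
          rw [Submodule.mkQ_apply, Submodule.Quotient.mk_eq_zero]
          exact ⟨ch 2 (trg G), rfl⟩
        rw [this]; simp
      rw [h4] at h3; exact h3
    rw [hd, Fin.sum_univ_three, face_trg G 0 g0 e0, face_trg G 1 g1 e1, face_trg G 2 g2 e2] at hz
    simp at hz
    linarith
  · intro g h hgh
    have : pth g = pth h := by
      ext x; exact hgh _ ⟨x.2.1 1, stdSimplex.le_one x 1⟩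
    simp only [this]
  · intro a f hf
    have key : (∑ j, a j • Q j) = fn 0 (fun s : Sg X 0 => f (s default)) ∘ₗ ((singularChainComplex X).d 1 0).hom := by
      apply ch_ext
      intro s
      rw [LinearMap.comp_apply, d_ch, Fin.sum_univ_two]
      simp only [map_add, map_smul, fn_ch, face_one]
      have := hf (bk s)
      simp only [pth_bk] at this
      simp only [LinearMap.sum_apply, LinearMap.smul_apply, smul_eq_mul]
      rw [this]; simp; ring
    have k2 : ∀ z, ∑ j, a j * q j z = 0 := by
      intro z
      have h3 := LinearMap.congr_fun key z.1
      rw [LinearMap.comp_apply, z.2] at h3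
      simp only [LinearMap.sum_apply, LinearMap.smul_apply, smul_eq_mul, map_zero] at h3
      rw [← h3]
      refine Finset.sum_congr rfl fun j _ => ?_
      rw [← hQ j]; rfl
    funext i
    obtain ⟨z, hz⟩ := Submodule.mkQ_surjective _ (e (b i))
    have h3 := k2 z
    have h4 : ∀ j, q j z = b.coord j (b i) := fun j => by
      show b.coord j (e.symm _) = _
      rw [hz]; simp
    simp only [h4] at h3
    simpa [Finsupp.single_apply] using h3

theorem H1_II (r : ℕ) (h1 : FiniteBetti X 1) (h2 : bettiNumber X 1 = r)
    (c : Fin (r+1) → C(ℝ, X) → ℚ) (hc : ∀ j, PF (c j)) :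
    ∃ a : Fin (r+1) → ℚ, a ≠ 0 ∧ ∀ g, g 0 = g 1 → ∑ j, a j * c j g = 0 := by
  obtain ⟨e⟩ := hom_equiv X
  have : FiniteDimensional ℚ (singularHomology X 1) := h1
  have hk : ∀ j x, fn 1 (fun s => c j (bk s)) (((singularChainComplex X).d 2 1).hom x) = 0 := by
    intro j x
    have : fn 1 (fun s => c j (bk s)) ∘ₗ ((singularChainComplex X).d 2 1).hom = 0 := by
      apply ch_ext
      intro s
      rw [LinearMap.comp_apply, d_ch, Fin.sum_univ_three]
      simp only [map_add, map_smul, fn_ch]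
      have h0 := (hc j).ext (bk (face 0 s)) ⟨fun t => bk2 s (1 - t, t), by fun_prop⟩ (bk_face s 0)
      have h1 := (hc j).ext (bk (face 1 s)) ⟨fun t => bk2 s (0, t), by fun_prop⟩ (bk_face s 1)
      have h2 := (hc j).ext (bk (face 2 s)) ⟨fun t => bk2 s (t, 0), by fun_prop⟩ (bk_face s 2)
      have := (hc j).tri (bk2 s) (h0 := fun t => rfl) (h1 := fun t => rfl) (h2 := fun t => rfl)
        (g0 := ⟨fun t => bk2 s (1 - t, t), by fun_prop⟩) (g1 := ⟨fun t => bk2 s (0, t), by fun_prop⟩)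
        (g2 := ⟨fun t => bk2 s (t, 0), by fun_prop⟩)
      rw [h0, h1, h2]
      simp
      linarith
    exact LinearMap.congr_fun this x
  let F : Fin (r+1) → Module.Dual ℚ (singularHomology X 1) := fun j =>
    (Submodule.liftQ _ (fn 1 (fun s => c j (bk s)) ∘ₗ Submodule.subtype _) (by
      rintro _ ⟨x, rfl⟩
      exact hk j x)) ∘ₗ e.toLinearMap
  have hdep : ¬ LinearIndependent ℚ F := by
    intro hl
    have := hl.fintype_card_le_finrank
    rw [Subspace.dual_finrank_eq] at this
    have h3 : Module.finrank ℚ (singularHomology X 1) = r := h2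
    rw [h3] at this
    simp at this
  rw [Fintype.not_linearIndependent_iff] at hdep
  obtain ⟨a, ha, i, hi⟩ := hdep
  refine ⟨a, fun h => hi (by rw [h]; rfl), fun g hg => ?_⟩
  have hm : ch 1 (pth g) ∈ LinearMap.ker ((singularChainComplex X).d 1 0).hom := by
    rw [LinearMap.mem_ker, d_ch, Fin.sum_univ_two]
    have : face 0 (pth g) = face 1 (pth g) := by
      ext x
      rw [face_one, face_one]
      show g ((cl1 1).1 1) = g ((cl1 0).1 1)
      simp [cl1, hg]
    rw [this]; simp
  have h3 := LinearMap.congr_fun ha (e.symm (Submodule.Quotient.mk ⟨_, hm⟩))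
  rw [LinearMap.sum_apply] at h3
  rw [show (0 : Module.Dual ℚ (singularHomology X 1)) (e.symm (Submodule.Quotient.mk ⟨_, hm⟩)) = 0 from rfl] at h3
  rw [← h3]
  refine Finset.sum_congr rfl fun j _ => ?_
  rw [LinearMap.smul_apply, smul_eq_mul]
  congr 1
  have h5 : F j (e.symm (Submodule.Quotient.mk ⟨_, hm⟩)) = fn 1 (fun s => c j (bk s)) (ch 1 (pth g)) := by
    simp only [F, LinearMap.comp_apply, LinearEquiv.coe_coe, LinearEquiv.apply_symm_apply]
    exact Submodule.liftQ_apply _ _ _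
  rw [h5]
  rw [fn_ch]
  refine (hc j).ext _ _ fun t ht => ?_
  show g t = g ((cl1 t).1 1)
  simp [cl1, ht.1, ht.2]
end
end
end

section
set_option linter.unusedSectionVars false
noncomputable section
section
variable {X : Type} [TopologicalSpace X]

/-- global planar charts -/
def GCh (X : Type*) [TopologicalSpace X] : Prop := ∀ x : X, ∃ (T : Set X) (e : ℂ → X) (c : X → ℂ),
  IsOpen T ∧ x ∈ T ∧ Continuous e ∧ ContinuousOn c T ∧ ∀ u ∈ T, e (c u) = u

/-- restriction of a path to an interval, reparametrised -/
def rst (g : C(ℝ, X)) (a b : ℝ) : C(ℝ, X) := ⟨fun t => g (a + t * (b - a)), by fun_prop⟩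

def sg (e : C(ℂ, X)) (z w : ℂ) : C(ℝ, X) := ⟨fun t => e (z + (t:ℂ) * (w - z)), by fun_prop⟩

namespace PF
variable {D : C(ℝ, X) → ℚ}
theorem cst (hD : PF D) {g : C(ℝ, X)} {x : X} (h : ∀ t ∈ Icc (0:ℝ) 1, g t = x) : D g = 0 := by
  rw [hD.ext g (ContinuousMap.const _ x) h]
  have := hD.tri (ContinuousMap.const _ x) (ContinuousMap.const _ x) (ContinuousMap.const _ x) (ContinuousMap.const _ x)
    (fun _ => rfl) (fun _ => rfl) (fun _ => rfl)
  linarith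

theorem sg_add (hD : PF D) (e : C(ℂ, X)) (x y z : ℂ) : D (sg e x y) + D (sg e y z) = D (sg e x z) := by
  have := hD.tri ⟨fun q => e (x + (q.1:ℂ) * (y - x) + (q.2:ℂ) * (z - x)), by fun_prop⟩
    (sg e y z) (sg e x z) (sg e x y)
    (fun t => by show e _ = e _; congr 1; push_cast; ring) (fun t => by show e _ = e _; congr 1; push_cast; ring)
    (fun t => by show e _ = e _; congr 1; push_cast; ring)
  linarith

theorem rst_add (hD : PF D) (g : C(ℝ, X)) (x y z : ℝ) : D (rst g x y) + D (rst g y z) = D (rst g x z) := by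
  have := hD.tri ⟨fun q => g (x + q.1 * (y - x) + q.2 * (z - x)), by fun_prop⟩
    (rst g y z) (rst g x z) (rst g x y)
    (fun t => by show g _ = g _; congr 1; ring) (fun t => by show g _ = g _; congr 1; ring)
    (fun t => by show g _ = g _; congr 1; ring)
  linarith

theorem sq (hD : PF D) (K : C(ℝ × ℝ, X)) : 
    D ⟨fun t => K (1, t), by fun_prop⟩ + D ⟨fun t => K (t, 0), by fun_prop⟩ =
    D ⟨fun t => K (t, 1), by fun_prop⟩ + D ⟨fun t => K (0, t), by fun_prop⟩ := by
  have h1 := hD.tri ⟨fun q => K (q.1 + q.2, q.2), by fun_prop⟩ ⟨fun t => K (1, t), by fun_prop⟩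
    ⟨fun t => K (t, t), by fun_prop⟩ ⟨fun t => K (t, 0), by fun_prop⟩
    (fun t => by simp) (fun t => by simp) (fun t => by simp)
  have h2 := hD.tri ⟨fun q => K (q.2, q.1 + q.2), by fun_prop⟩ ⟨fun t => K (t, 1), by fun_prop⟩
    ⟨fun t => K (t, t), by fun_prop⟩ ⟨fun t => K (0, t), by fun_prop⟩
    (fun t => by simp) (fun t => by simp) (fun t => by simp)
  linarith

theorem chart (hD : PF D) {T : Set X} {e : C(ℂ, X)} {c : X → ℂ} (hc : ContinuousOn c T)
    (hi : ∀ u ∈ T, e (c u) = u) (g : C(ℝ, X)) (hg : ∀ t ∈ Icc (0:ℝ) 1, g t ∈ T) :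
    D g = D (sg e (c (g 0)) (c (g 1))) := by
  let cl : ℝ → ℝ := fun t => max 0 (min t 1)
  have hcl : ∀ t, cl t ∈ Icc (0:ℝ) 1 := fun t => ⟨le_max_left _ _, by simp [cl]⟩
  have hcl' : ∀ t ∈ Icc (0:ℝ) 1, cl t = t := fun t ht => by
    simp [cl, ht.1, ht.2]
  have hclc : Continuous cl := by fun_prop
  have hh : Continuous fun t => c (g (cl t)) :=
    hc.comp_continuous (by fun_prop) (fun t => hg _ (hcl t))
  have hh2 : Continuous fun q : ℝ × ℝ => c (g (cl q.2)) := hh.comp continuous_snd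
  let K : C(ℝ × ℝ, X) := ⟨fun q => e ((1 - (q.1:ℂ)) * c (g (cl q.2)) +
    (q.1:ℂ) * (c (g 0) + (q.2:ℂ) * (c (g 1) - c (g 0)))), by
    refine e.continuous.comp (Continuous.add (Continuous.mul (by fun_prop) hh2) (by fun_prop))⟩
  have h := hD.sq K
  have a0 : cl 0 = 0 := hcl' _ (by simp)
  have a1 : cl 1 = 1 := hcl' _ (by simp)
  have e1 : D ⟨fun t => K (t, 0), by fun_prop⟩ = 0 := hD.cst (x := e (c (g 0))) fun t ht => by
    show e _ = e _
    congr 1; simp [a0]; ring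
  have e2 : D ⟨fun t => K (t, 1), by fun_prop⟩ = 0 := hD.cst (x := e (c (g 1))) fun t ht => by
    show e _ = e _
    congr 1; simp [a1]; ring
  have e3 : D ⟨fun t => K (1, t), by fun_prop⟩ = D (sg e (c (g 0)) (c (g 1))) := hD.ext _ _ fun t ht => by
    show e _ = e _
    congr 1; simp
  have e4 : D ⟨fun t => K (0, t), by fun_prop⟩ = D g := hD.ext _ _ fun t ht => by
    show e _ = _
    simp only [Complex.ofReal_zero, sub_zero, one_mul, zero_mul, add_zero, hcl' t ht]
    exact hi _ (hg t ht)
  rw [e1, e2, e3, e4] at h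
  linarith
end PF

theorem PF.sum {ι : Type*} (s : Finset ι) {D : ι → C(ℝ, X) → ℚ} (a : ι → ℚ) (h : ∀ i ∈ s, PF (D i)) :
    PF (fun g => ∑ i ∈ s, a i * D i g) := by
  constructor
  · intro G g0 g1 g2 h0 h1 h2
    rw [← Finset.sum_sub_distrib, ← Finset.sum_add_distrib]
    refine Finset.sum_eq_zero fun i hi => ?_
    linear_combination a i * (h i hi).tri G g0 g1 g2 h0 h1 h2
  · intro g k hk
    refine Finset.sum_congr rfl fun i hi => ?_
    rw [(h i hi).ext g k hk]

theorem seg_small (z : ℂ) {U : Set ℂ} (hU : U ∈ 𝓝 z) :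
    ∀ᶠ w in 𝓝 z, ∀ t ∈ Icc (0:ℝ) 1, z + (t:ℂ) * (w - z) ∈ U := by
  obtain ⟨δ, hδ, hb⟩ := Metric.mem_nhds_iff.1 hU
  filter_upwards [Metric.ball_mem_nhds z hδ] with w hw t ht
  apply hb
  rw [Metric.mem_ball, dist_eq_norm, add_sub_cancel_left, norm_mul, Complex.norm_real, Real.norm_of_nonneg ht.1]
  rw [Metric.mem_ball, dist_eq_norm] at hw
  nlinarith [norm_nonneg (w - z), ht.2]

theorem F_I (hG : GCh X) (r : ℕ) (h1 : FiniteBetti X 1) (h2 : bettiNumber X 1 = r) :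
    ∃ φ : Fin r → X → X → ℚ, (∀ j, ZC univ (φ j)) ∧
      ∀ a : Fin r → ℚ, BC univ (fun x u => ∑ j, a j * φ j x u) → a = 0 := by
  obtain ⟨D, hD, hind⟩ := H1_I r h1 h2
  choose T e c hT hxT he hc hi using hG
  let E : X → C(ℂ, X) := fun x => ⟨e x, he x⟩
  have hEi : ∀ x, ∀ u ∈ T x, E x (c x u) = u := hi
  have hcx : ∀ x, ContinuousAt (c x) x := fun x => (hc x).continuousAt ((hT x).mem_nhds (hxT x))
  have small : ∀ x, ∀ U ∈ 𝓝 x, ∀ᶠ u in 𝓝 x, u ∈ T x ∧ ∀ t ∈ Icc (0:ℝ) 1, sg (E x) (c x x) (c x u) t ∈ U := by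
    intro x U hU
    have : E x ⁻¹' U ∈ 𝓝 (c x x) := (he x).continuousAt (by
      show U ∈ 𝓝 (e x (c x x)); rw [hi x x (hxT x)]; exact hU)
    have h3 := (hcx x).eventually (seg_small _ this)
    filter_upwards [h3, (hT x).mem_nhds (hxT x)] with u hu hu2
    exact ⟨hu2, hu⟩
  have s0 : ∀ x u, sg (E x) (c x x) (c x u) 0 = x := fun x u => by
    show e x _ = _
    simp [hi x x (hxT x)]
  have s1 : ∀ x, ∀ u ∈ T x, sg (E x) (c x x) (c x u) 1 = u := fun x u hu => by
    show e x _ = _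
    simp [hi x u hu]
  refine ⟨fun j x u => D j (sg (E x) (c x x) (c x u)), fun j x _ => ?_, fun a ha => ?_⟩
  · filter_upwards [(hT x).mem_nhds (hxT x)] with y hy
    filter_upwards [small y (T x) ((hT x).mem_nhds hy), (hT x).mem_nhds hy] with u hu hux
    have e1 : D j (sg (E y) (c y y) (c y y)) = 0 := (hD j).cst (x := y) fun t _ => by
      show e y _ = y
      simp [hi y y (hxT y)]
    have e2 := (hD j).sg_add (E x) (c x x) (c x y) (c x u)
    have e3 := (hD j).chart (hc x) (hEi x) _ hu.2
    rw [s0, s1 y u hu.1] at e3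
    linarith
  · obtain ⟨f, hf⟩ := ha
    apply hind a f
    intro g0
    have hP := PF.sum Finset.univ a (fun j _ => hD j)
    let P : C(ℝ, X) → ℚ := fun g => ∑ j, a j * D j g
    have hP : PF P := hP
    let cl : ℝ → ℝ := fun t => max 0 (min t 1)
    have hclc : Continuous cl := by fun_prop
    have hcl' : ∀ t ∈ Icc (0:ℝ) 1, cl t = t := fun t ht => by
      simp [cl, ht.1, ht.2]
    let g : C(ℝ, X) := ⟨fun t => g0 (cl t), by fun_prop⟩
    have hlc : LC univ (fun t => P (rst g 0 t) - f (g t)) := by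
      intro t _
      have hx := hf (g t) trivial
      have k1 := g.continuous.continuousAt.eventually hx
      have k2 : ∀ᶠ t' in 𝓝 t, ∀ s ∈ Icc (0:ℝ) 1, g (t + s * (t' - t)) ∈ T (g t) := by
        have : g ⁻¹' T (g t) ∈ 𝓝 t := g.continuous.continuousAt ((hT _).mem_nhds (hxT _))
        obtain ⟨δ, hδ, hb⟩ := Metric.mem_nhds_iff.1 this
        filter_upwards [Metric.ball_mem_nhds t hδ] with w hw s hs
        apply hb
        rw [Metric.mem_ball, dist_eq_norm, add_sub_cancel_left, norm_mul, Real.norm_of_nonneg hs.1]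
        rw [Metric.mem_ball, dist_eq_norm] at hw
        nlinarith [norm_nonneg (w - t), hs.2]
      filter_upwards [k1, k2] with t' h3 h4
      have e2 := hP.rst_add g 0 t t'
      have e3 := hP.chart (hc (g t)) (hEi (g t)) (rst g t t') h4
      have r0 : rst g t t' 0 = g t := by show g _ = _; simp
      have r1 : rst g t t' 1 = g t' := by show g _ = _; simp
      rw [r0, r1] at e3
      have e1 : P (sg (E (g t)) (c (g t) (g t)) (c (g t) (g t))) = 0 := hP.cst (x := g t) fun s _ => by
        show e (g t) _ = g t
        simp [hi _ _ (hxT (g t))]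
      have h5 : P (sg (E (g t)) (c (g t) (g t)) (c (g t) (g t'))) -
        P (sg (E (g t)) (c (g t) (g t)) (c (g t) (g t))) = f (g t') - f (g t) := h3
      linarith
    have := hlc.const_of_preconn isPreconnected_univ (x := 0) (y := 1) trivial trivial
    have e0 : P (rst g 0 0) = 0 := hP.cst (x := g 0) fun s _ => by show g _ = _; simp
    have e1 : P (rst g 0 1) = P g0 := hP.ext _ _ fun s hs => by
      show g0 (cl _) = g0 s
      rw [hcl' _ (by simpa using hs)]; simp
    have c0 : g 0 = g0 0 := by show g0 (cl 0) = _; rw [hcl' 0 (by simp)]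
    have c1 : g 1 = g0 1 := by show g0 (cl 1) = _; rw [hcl' 1 (by simp)]
    simp only [e0, e1, c0, c1] at this
    show P g0 = _
    linarith

theorem F_II [PathConnectedSpace X] (hG : GCh X) (r : ℕ) (h1 : FiniteBetti X 1) (h2 : bettiNumber X 1 = r)
    (φ : Fin (r+1) → X → X → ℚ) (hφ : ∀ j, ZC univ (φ j)) :
    ∃ a : Fin (r+1) → ℚ, a ≠ 0 ∧ BC univ (fun x u => ∑ j, a j * φ j x u) := by
  classical
  have hpr : ∀ j (g : C(ℝ, X)), ∃ F : ℝ → ℚ, Prim univ (fun s t => φ j (g s) (g t)) F := fun j g =>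
    BC_univ_of_vector ((hφ j).comp isOpen_univ g.continuous.continuousOn (fun _ _ => trivial))
  choose F hF using hpr
  have hPF : ∀ j, PF (fun g => F j g 1 - F j g 0) := by
    intro j
    constructor
    · intro G g0 g1 g2 h0 h1 h2
      obtain ⟨Φ, hΦ⟩ : ∃ F : ℝ × ℝ → ℚ, Prim univ (fun s t => φ j (G s) (G t)) F :=
        BC_univ_of_vector ((hφ j).comp isOpen_univ G.continuous.continuousOn (fun _ _ => trivial))
      have key : ∀ (k : ℝ → ℝ × ℝ) (g : C(ℝ, X)), Continuous k → (∀ t, g t = G (k t)) →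
          F j g 1 - F j g 0 = Φ (k 1) - Φ (k 0) := by
        intro k g hk hg
        have h3 := hΦ.comp isOpen_univ (g := k) hk.continuousOn (fun _ _ => trivial)
        have h4 := hF j g
        simp only [hg] at h4
        exact h4.unique h3 isPreconnected_univ trivial trivial
      rw [key _ g0 (by fun_prop) h0, key _ g1 (by fun_prop) h1, key _ g2 (by fun_prop) h2]
      norm_num
    · intro g h hgh
      let cl : ℝ → ℝ := fun t => max 0 (min t 1)
      have hclc : Continuous cl := by fun_prop
      have hcl : ∀ t, cl t ∈ Icc (0:ℝ) 1 := fun t => ⟨le_max_left _ _, by simp [cl]⟩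
      have p1 := (hF j g).comp isOpen_univ (g := cl) hclc.continuousOn (fun _ _ => trivial)
      have p2 := (hF j h).comp isOpen_univ (g := cl) hclc.continuousOn (fun _ _ => trivial)
      simp only [hgh _ (hcl _)] at p1
      have := p1.unique p2 isPreconnected_univ (x := 0) (y := 1) trivial trivial
      simpa [cl] using this
  obtain ⟨a, ha, hloop⟩ := H1_II r h1 h2 _ hPF
  refine ⟨a, ha, ?_⟩
  let P : C(ℝ, X) → ℚ := fun g => ∑ j, a j * (F j g 1 - F j g 0)
  have hP : PF P := PF.sum Finset.univ a (fun j _ => hPF j)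
  have hψ : ZC univ (fun x u => ∑ j, a j * φ j x u) := ZC.sum Finset.univ a (fun j _ => hφ j)
  have hFP : ∀ g : C(ℝ, X), Prim univ (fun s t => ∑ j, a j * φ j (g s) (g t)) (fun t => ∑ j, a j * F j g t) := by
    intro g x _
    have := fun j => hF j g x trivial
    filter_upwards [eventually_all.2 this] with u hu
    rw [← Finset.sum_sub_distrib, ← Finset.sum_sub_distrib]
    refine Finset.sum_congr rfl fun j _ => ?_
    linear_combination a j * hu j
  obtain ⟨x0⟩ : Nonempty X := inferInstance
  have hpath : ∀ x, ∃ g : C(ℝ, X), g 0 = x0 ∧ g 1 = x := by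
    intro x
    obtain ⟨γ⟩ := PathConnectedSpace.joined x0 x
    exact ⟨⟨γ.extend, γ.continuous_extend⟩, by simp, by simp⟩
  choose q hq0 hq1 using hpath
  refine ⟨fun x => P (q x), fun x _ => ?_⟩
  obtain ⟨T, e, c, hT, hxT, he, hc, hi⟩ := hG x
  let E : C(ℂ, X) := ⟨e, he⟩
  have hZ := hψ x trivial
  obtain ⟨U, hUs, hU, hxU⟩ := mem_nhds_iff.1 hZ
  have hcx : ContinuousAt c x := hc.continuousAt (hT.mem_nhds hxT)
  have hpre : e ⁻¹' U ∈ 𝓝 (c x) := he.continuousAt (by rw [hi x hxT]; exact hU.mem_nhds hxU)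
  filter_upwards [hcx.eventually (seg_small _ hpre), hT.mem_nhds hxT] with u hu huT
  have sg0 : sg E (c x) (c u) 0 = x := by show e _ = _; simp [hi x hxT]
  have sg1 : sg E (c x) (c u) 1 = u := by show e _ = _; simp [hi u huT]
  -- value along the segment
  have v1 : P (sg E (c x) (c u)) = ∑ j, a j * φ j x u - ∑ j, a j * φ j x x := by
    have p1 := (hFP (sg E (c x) (c u))).mono (subset_univ (Icc (0:ℝ) 1))
    have p2 : Prim (Icc (0:ℝ) 1) (fun s t => ∑ j, a j * φ j (sg E (c x) (c u) s) (sg E (c x) (c u) t))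
        (fun t => ∑ j, a j * φ j x (sg E (c x) (c u) t)) := by
      intro t ht
      have h3 : sg E (c x) (c u) t ∈ U := hu t ht
      have := hUs h3
      exact (sg E (c x) (c u)).continuous.continuousAt.eventually this
    have := p1.unique p2 isPreconnected_Icc (x := 0) (y := 1) (by simp) (by simp)
    rw [sg0, sg1] at this
    rw [← this]
    show ∑ j, a j * _ = _
    rw [← Finset.sum_sub_distrib]
    exact Finset.sum_congr rfl fun j _ => by ring
  -- the loop
  let γ : C(ℝ, X) := ⟨fun t => if t ≤ 1 then q x t else if t ≤ 2 then sg E (c x) (c u) (t - 1) else q u (3 - t), by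
    refine Continuous.if_le (by fun_prop) ?_ continuous_id continuous_const ?_
    · refine Continuous.if_le (by fun_prop) (by fun_prop) continuous_id continuous_const ?_
      rintro t rfl
      norm_num [sg1, hq1]
    · rintro t rfl
      norm_num [sg0, hq1]⟩
  have l1 : P (rst γ 0 1) = P (q x) := hP.ext _ _ fun t ht => by
    show (if _ then _ else _) = _
    simp [ht.2]
  have l2 : P (rst γ 1 2) = P (sg E (c x) (c u)) := hP.ext _ _ fun t ht => by
    show (if _ then _ else _) = _
    rcases eq_or_lt_of_le ht.1 with h | h
    · rw [← h]; norm_num [sg0, hq1]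
    · rw [if_neg (by linarith), if_pos (by linarith [ht.2])]
      congr 1; ring
  have l3 : P (rst γ 2 3) = P (rst (q u) 1 0) := hP.ext _ _ fun t ht => by
    show (if _ then _ else _) = q u _
    rcases eq_or_lt_of_le ht.1 with h | h
    · rw [← h]; norm_num [sg1, hq1]
    · rw [if_neg (by linarith), if_neg (by linarith [ht.2])]
      congr 1; ring
  have l4 := hP.rst_add (q u) 0 1 0
  have l5 : P (rst (q u) 0 0) = 0 := hP.cst (x := q u 0) fun s _ => by show q u _ = _; simp
  have l6 : P (rst (q u) 0 1) = P (q u) := hP.ext _ _ fun s _ => by show q u _ = _; simp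
  have l7 := hP.rst_add γ 0 1 2
  have l8 := hP.rst_add γ 0 2 3
  have l9 : P (rst γ 0 3) = 0 := hloop _ (by
    show (if _ then _ else _) = (if _ then _ else _)
    norm_num [hq0])
  show _ = P (q u) - P (q x)
  linarith
end
end
end

section
set_option linter.unusedSectionVars false
noncomputable section
section
variable {Z : Type*} [TopologicalSpace Z] [T2Space Z] {F : Type*} [NormedAddCommGroup F] [NormedSpace ℝ F] [ProperSpace F]

structure Box (q : Z → F) (b0 : F) (δ : ℝ) (Q : Set Z) (Θ : F → ℂ → Z) (l : Z → ℂ) : Prop where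
  dp : 0 < δ
  op : IsOpen Q
  ct : ContinuousOn (fun w : F × ℂ => Θ w.1 w.2) (Metric.ball b0 δ ×ˢ Metric.ball 0 1)
  mp : ∀ b ∈ Metric.ball b0 δ, ∀ ζ ∈ Metric.ball (0:ℂ) 1, Θ b ζ ∈ Q
  qT : ∀ b ∈ Metric.ball b0 δ, ∀ ζ ∈ Metric.ball (0:ℂ) 1, q (Θ b ζ) = b
  lT : ∀ b ∈ Metric.ball b0 δ, ∀ ζ ∈ Metric.ball (0:ℂ) 1, l (Θ b ζ) = ζ
  cl : ContinuousOn l Q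
  qm : ∀ x ∈ Q, q x ∈ Metric.ball b0 δ
  lm : ∀ x ∈ Q, l x ∈ Metric.ball (0:ℂ) 1
  inv : ∀ x ∈ Q, Θ (q x) (l x) = x

def sh (Q : Set Z) (l : Z → ℂ) (ρ : ℝ) : Set Z := Q ∩ l ⁻¹' Metric.ball 0 ρ

variable {q : Z → F} {b0 : F} {δ : ℝ} {Q : Set Z} {Θ : F → ℂ → Z} {l : Z → ℂ}

theorem sh_mono {ρ ρ' : ℝ} (h : ρ ≤ ρ') : sh Q l ρ ⊆ sh Q l ρ' :=
  fun _ hx => ⟨hx.1, Metric.ball_subset_ball h hx.2⟩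

namespace Box
theorem restrict (h : Box q b0 δ Q Θ l) (hq : Continuous q) {δ' : ℝ} (h0 : 0 < δ') (h1 : δ' ≤ δ) :
    Box q b0 δ' (Q ∩ q ⁻¹' Metric.ball b0 δ') Θ l where
  dp := h0
  op := h.op.inter (Metric.isOpen_ball.preimage hq)
  ct := h.ct.mono (prod_mono (Metric.ball_subset_ball h1) le_rfl)
  mp b hb ζ hζ := by
    have hb' := Metric.ball_subset_ball h1 hb
    exact ⟨h.mp b hb' ζ hζ, by rw [mem_preimage, h.qT b hb' ζ hζ]; exact hb⟩
  qT b hb := h.qT b (Metric.ball_subset_ball h1 hb)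
  lT b hb := h.lT b (Metric.ball_subset_ball h1 hb)
  cl := h.cl.mono inter_subset_left
  qm x hx := hx.2
  lm x hx := h.lm x hx.1
  inv x hx := h.inv x hx.1

theorem ctAt (h : Box q b0 δ Q Θ l) {b : F} {ζ : ℂ} (hb : b ∈ Metric.ball b0 δ) (hζ : ζ ∈ Metric.ball (0:ℂ) 1) :
    ContinuousAt (fun w : F × ℂ => Θ w.1 w.2) (b, ζ) :=
  h.ct.continuousAt ((Metric.isOpen_ball.prod Metric.isOpen_ball).mem_nhds ⟨hb, hζ⟩)

theorem clAt (h : Box q b0 δ Q Θ l) {x : Z} (hx : x ∈ Q) : ContinuousAt l x :=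
  h.cl.continuousAt (h.op.mem_nhds hx)

theorem sh_op (h : Box q b0 δ Q Θ l) (ρ : ℝ) : IsOpen (sh Q l ρ) :=
  h.cl.isOpen_inter_preimage h.op Metric.isOpen_ball

theorem sh_one (h : Box q b0 δ Q Θ l) : sh Q l 1 = Q :=
  inter_eq_left.2 h.lm

theorem b0m (h : Box q b0 δ Q Θ l) : b0 ∈ Metric.ball b0 δ := Metric.mem_ball_self h.dp

theorem T_mem_sh (h : Box q b0 δ Q Θ l) {ρ : ℝ} (hρ : ρ ≤ 1) {b : F} {ζ : ℂ} (hb : b ∈ Metric.ball b0 δ)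
    (hζ : ζ ∈ Metric.ball (0:ℂ) ρ) : Θ b ζ ∈ sh Q l ρ := by
  have h1 := Metric.ball_subset_ball hρ hζ
  exact ⟨h.mp b hb ζ h1, by rw [mem_preimage, h.lT b hb ζ h1]; exact hζ⟩

theorem compl (h : Box q b0 δ Q Θ l) (hq : Continuous q) {z : Z} (hz : z ∉ Q) (hzb : q z = b0) {ρ : ℝ} (hρ : ρ < 1) :
    ∀ᶠ z' in 𝓝 z, z' ∉ sh Q l ρ := by
  have hδ := h.dp
  have hsub : Metric.closedBall b0 (δ/2) ×ˢ Metric.closedBall (0:ℂ) ρ ⊆ Metric.ball b0 δ ×ˢ Metric.ball 0 1 :=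
    prod_mono (Metric.closedBall_subset_ball (by linarith)) (Metric.closedBall_subset_ball hρ)
  have hK : IsCompact ((fun w : F × ℂ => Θ w.1 w.2) '' (Metric.closedBall b0 (δ/2) ×ˢ Metric.closedBall 0 ρ)) :=
    ((isCompact_closedBall _ _).prod (isCompact_closedBall _ _)).image_of_continuousOn (h.ct.mono hsub)
  have hz' : z ∉ (fun w : F × ℂ => Θ w.1 w.2) '' (Metric.closedBall b0 (δ/2) ×ˢ Metric.closedBall 0 ρ) := by
    rintro ⟨w, hw, rfl⟩
    exact hz (h.mp _ (hsub hw).1 _ (hsub hw).2)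
  have hqe : ∀ᶠ z' in 𝓝 z, q z' ∈ Metric.ball b0 (δ/2) :=
    hq.continuousAt (by rw [hzb]; exact Metric.ball_mem_nhds _ (by linarith))
  filter_upwards [hK.isClosed.isOpen_compl.mem_nhds hz', hqe] with z' h1 h2 h3
  exact h1 ⟨(q z', l z'), ⟨Metric.ball_subset_closedBall h2, Metric.ball_subset_closedBall h3.2⟩, h.inv z' h3.1⟩
end Box

variable {Q' : Set Z} {Θ' : F → ℂ → Z} {l' : Z → ℂ} {Q'' : Set Z} {Θ'' : F → ℂ → Z} {l'' : Z → ℂ}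

theorem S1 (hq : Continuous q) (hi : Box q b0 δ Q Θ l) (hj : Box q b0 δ Q' Θ' l') {σ ρ ρ' : ℝ} (hσ : σ < 1) (hρ : ρ < ρ') (hρ' : ρ' ≤ 1) :
    ∀ᶠ w in 𝓝 (b0, b0), ∀ ζ ∈ Metric.closedBall (0:ℂ) σ, Θ' w.1 ζ ∈ sh Q l ρ → Θ' w.2 ζ ∈ sh Q l ρ' := by
  apply (isCompact_closedBall (0:ℂ) σ).eventually_forall_of_forall_eventually
  intro ζ hζ
  have hζ1 := Metric.closedBall_subset_ball hσ hζ
  have c1 : Tendsto (fun z : (F × F) × ℂ => Θ' z.1.1 z.2) (𝓝 ((b0, b0), ζ)) (𝓝 (Θ' b0 ζ)) := 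
    Tendsto.comp (f := fun z : (F × F) × ℂ => (z.1.1, z.2)) (hj.ctAt hj.b0m hζ1)
    (Continuous.tendsto (by fun_prop) ((b0, b0), ζ))
  have c2 : Tendsto (fun z : (F × F) × ℂ => Θ' z.1.2 z.2) (𝓝 ((b0, b0), ζ)) (𝓝 (Θ' b0 ζ)) := 
    Tendsto.comp (f := fun z : (F × F) × ℂ => (z.1.2, z.2)) (hj.ctAt hj.b0m hζ1)
    (Continuous.tendsto (by fun_prop) ((b0, b0), ζ))
  by_cases hz : Θ' b0 ζ ∈ sh Q l ρ'
  · filter_upwards [c2 ((hi.sh_op ρ').mem_nhds hz)] with z h1 _ using h1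
  · have : ∀ᶠ z' in 𝓝 (Θ' b0 ζ), z' ∉ sh Q l ρ := by
      by_cases hzQ : Θ' b0 ζ ∈ Q
      · have h2 : l (Θ' b0 ζ) ∉ Metric.closedBall (0:ℂ) ρ := fun h => hz ⟨hzQ, Metric.closedBall_subset_ball hρ h⟩
        filter_upwards [(hi.clAt hzQ) (Metric.isClosed_closedBall.isOpen_compl.mem_nhds h2)] with z' h3 h4
        exact h3 (Metric.ball_subset_closedBall h4.2)
      · exact hi.compl hq hzQ (hj.qT _ hj.b0m _ hζ1) (by linarith)
    filter_upwards [c1 this] with z h1 h2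
    exact absurd h2 h1

theorem S2 (hq : Continuous q) (hi : Box q b0 δ Q Θ l) (hj : Box q b0 δ Q' Θ' l') (hk : Box q b0 δ Q'' Θ'' l'')
    {ρ : ℝ} (hρ : ρ < 1) {c : Z → ℚ}
    (hc : ∀ z ∈ Q ∩ Q', q z = b0 → ∀ᶠ u in 𝓝[q ⁻¹' {b0}] z, c u = c z) :
    ∀ᶠ b in 𝓝 b0, ∀ ζ ∈ Metric.closedBall (0:ℂ) ρ, Θ'' b ζ ∈ sh Q l ρ → Θ'' b ζ ∈ sh Q' l' ρ →
      c (Θ'' b0 ζ) = c (Θ b0 (l (Θ'' b ζ))) := by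
  apply (isCompact_closedBall (0:ℂ) ρ).eventually_forall_of_forall_eventually
  intro ζ hζ
  have hζ1 := Metric.closedBall_subset_ball hρ hζ
  have c1 : Tendsto (fun z : F × ℂ => Θ'' z.1 z.2) (𝓝 (b0, ζ)) (𝓝 (Θ'' b0 ζ)) := hk.ctAt hk.b0m hζ1
  have hzb := hk.qT _ hk.b0m _ hζ1
  by_cases hzQ : Θ'' b0 ζ ∈ Q
  swap
  · filter_upwards [c1 (hi.compl hq hzQ hzb hρ)] with z h1 h2
    exact absurd h2 h1
  by_cases hzQ' : Θ'' b0 ζ ∈ Q'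
  swap
  · filter_upwards [c1 (hj.compl hq hzQ' hzb hρ)] with z h1 _ h2
    exact absurd h2 h1
  have hc' := hc _ ⟨hzQ, hzQ'⟩ hzb
  rw [eventually_nhdsWithin_iff] at hc'
  have c2 : Tendsto (fun z : F × ℂ => Θ'' b0 z.2) (𝓝 (b0, ζ)) (𝓝 (Θ'' b0 ζ)) :=
    Tendsto.comp (f := fun z : F × ℂ => (b0, z.2)) (hk.ctAt hk.b0m hζ1)
      (Continuous.tendsto (by fun_prop) (b0, ζ))
  have e0 : Θ b0 (l (Θ'' b0 ζ)) = Θ'' b0 ζ := by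
    have := hi.inv _ hzQ
    rwa [hzb] at this
  have c3 : Tendsto (fun z : F × ℂ => Θ b0 (l (Θ'' z.1 z.2))) (𝓝 (b0, ζ)) (𝓝 (Θ'' b0 ζ)) := by
    have h1 : Tendsto (fun z : F × ℂ => (b0, l (Θ'' z.1 z.2))) (𝓝 (b0, ζ)) (𝓝 (b0, l (Θ'' b0 ζ))) :=
      tendsto_const_nhds.prodMk_nhds ((hi.clAt hzQ).tendsto.comp c1)
    have h2 := (hi.ctAt hi.b0m (hi.lm _ hzQ)).tendsto
    rw [e0] at h2
    exact Tendsto.comp (g := fun w : F × ℂ => Θ w.1 w.2) (f := fun z : F × ℂ => (b0, l (Θ'' z.1 z.2))) h2 h1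
  have hball : ∀ᶠ z : F × ℂ in 𝓝 (b0, ζ), z.2 ∈ Metric.ball (0:ℂ) 1 :=
    continuous_snd.continuousAt (Metric.isOpen_ball.mem_nhds hζ1)
  filter_upwards [c2 hc', c3 hc', hball] with z h1 h2 h3 h4 _
  have a1 : c (Θ'' b0 z.2) = _ := h1 (hk.qT _ hk.b0m _ h3)
  have a2 : c (Θ b0 (l (Θ'' z.1 z.2))) = _ := h2 (hi.qT _ hi.b0m _ (hi.lm _ h4.1))
  rw [a1, a2]
end
end
end

section
set_option linter.unusedSectionVars false
noncomputable section
section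
variable {Z : Type*} [TopologicalSpace Z] [T2Space Z] {F : Type*} [NormedAddCommGroup F] [NormedSpace ℝ F] [ProperSpace F]
  {E : Type*} [NormedAddCommGroup E] {I : Type*}

abbrev Fb (q : Z → F) (b : F) : Type _ := ↥{z : Z | q z = b}

structure FB (q : Z → F) (ι : Z → E) (b0 b : F) (δ R : ℝ) (Q : I → Set Z) (Θ : I → F → ℂ → Z) (l : I → Z → ℂ)
    (k : Z → I) : Prop where
  bx : ∀ i, Box q b0 δ (Q i) (Θ i) (l i)
  hi : Continuous ι
  hb : b ∈ Metric.ball b0 δ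
  osc : ∀ i, ∀ z ∈ Q i, ∀ z' ∈ Q i, ‖ι z'‖ < ‖ι z‖ + 1
  hk : ∀ v, q v = b0 ∨ q v = b → ‖ι v‖ ≤ R → v ∈ sh (Q (k v)) (l (k v)) (1/4)
  H1 : ∀ u m i, q u = b0 → u ∈ sh (Q m) (l m) (1/4) → u ∈ sh (Q i) (l i) (1/4) → Θ m b (l m u) ∈ sh (Q i) (l i) (1/2)
  H1' : ∀ y i j, q y = b → y ∈ sh (Q i) (l i) (1/2) → y ∈ sh (Q j) (l j) (1/2) → Θ i b0 (l i y) ∈ Q j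

structure FF (q : Z → F) (b0 b : F) (Q : I → Set Z) (Θ : I → F → ℂ → Z) (l : I → Z → ℂ)
    (f : I → Z → ℚ) : Prop where
  hc : ∀ i j, ∀ z ∈ Q i ∩ Q j, q z = b0 → ∀ᶠ u in 𝓝[q ⁻¹' {b0}] z, f i u - f j u = f i z - f j z
  H2 : ∀ v, q v = b → ∀ i j m, v ∈ sh (Q i) (l i) (1/2) → v ∈ sh (Q j) (l j) (1/2) → v ∈ sh (Q m) (l m) (1/2) →
    f i (Θ m b0 (l m v)) - f j (Θ m b0 (l m v)) = f i (Θ i b0 (l i v)) - f j (Θ i b0 (l i v))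

def PhiC (b0 : F) (Θ : I → F → ℂ → Z) (l : I → Z → ℂ) (k : Z → I) (f : I → Z → ℚ) (x u : Z) : ℚ :=
  f (k x) (Θ (k u) b0 (l (k u) u))

variable {q : Z → F} {ι : Z → E} {b0 b : F} {δ R : ℝ} {Q : I → Set Z} {Θ : I → F → ℂ → Z} {l : I → Z → ℂ}
    {k : Z → I} {f : I → Z → ℚ}

theorem FB.K (h : FB q ι b0 b δ R Q Θ l k) (hf : FF q b0 b Q Θ l f) {v : Fb q b} {i j : I}
    (hi : v.1 ∈ sh (Q i) (l i) (1/2)) (hj : v.1 ∈ sh (Q j) (l j) (1/2)) (hR : ‖ι v.1‖ < R) :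
    ∀ᶠ u : Fb q b in 𝓝 v,
      f i (Θ (k u) b0 (l (k u) u)) - f j (Θ (k u) b0 (l (k u) u)) =
      f i (Θ (k v) b0 (l (k v) v)) - f j (Θ (k v) b0 (l (k v) v)) := by
  have q4 : ∀ i, sh (Q i) (l i) (1/4) ⊆ sh (Q i) (l i) (1/2) := fun i => sh_mono (by norm_num)
  have e : ∀ u : Fb q b, u.1 ∈ sh (Q i) (l i) (1/2) → u.1 ∈ sh (Q j) (l j) (1/2) → ‖ι u.1‖ < R → 
      f i (Θ (k u) b0 (l (k u) u)) - f j (Θ (k u) b0 (l (k u) u)) = f i (Θ i b0 (l i u)) - f j (Θ i b0 (l i u)) :=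
    fun u h1 h2 h3 => hf.H2 u.1 u.2 i j (k u) h1 h2 (q4 _ (h.hk u.1 (Or.inr u.2) h3.le))
  have a := hf.hc i j (Θ i b0 (l i v)) ⟨(h.bx i).mp _ (h.bx i).b0m _ ((h.bx i).lm _ hi.1), h.H1' _ i j v.2 hi hj⟩
    ((h.bx i).qT _ (h.bx i).b0m _ ((h.bx i).lm _ hi.1))
  rw [eventually_nhdsWithin_iff] at a
  have c1 : Tendsto (fun u : Fb q b => Θ i b0 (l i u)) (𝓝 v) (𝓝 (Θ i b0 (l i v))) := by
    have h1 : Tendsto (fun u : Fb q b => (b0, l i u)) (𝓝 v) (𝓝 (b0, l i v)) :=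
      tendsto_const_nhds.prodMk_nhds (((h.bx i).clAt hi.1).tendsto.comp continuous_subtype_val.continuousAt)
    exact Tendsto.comp (g := fun w : F × ℂ => Θ i w.1 w.2) ((h.bx i).ctAt (h.bx i).b0m ((h.bx i).lm _ hi.1)) h1
  have o1 : ∀ᶠ u : Fb q b in 𝓝 v, u.1 ∈ sh (Q i) (l i) (1/2) :=
    continuous_subtype_val.continuousAt (((h.bx i).sh_op _).mem_nhds hi)
  have o2 : ∀ᶠ u : Fb q b in 𝓝 v, u.1 ∈ sh (Q j) (l j) (1/2) :=
    continuous_subtype_val.continuousAt (((h.bx j).sh_op _).mem_nhds hj)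
  have o3 : ∀ᶠ u : Fb q b in 𝓝 v, ‖ι u.1‖ < R :=
    ((h.hi.norm.comp continuous_subtype_val).continuousAt).eventually_lt_const hR
  filter_upwards [o1, o2, o3, c1 a] with u h1 h2 h3 h4

  rw [e u h1 h2 h3, e v hi hj hR]
  exact h4 ((h.bx i).qT _ (h.bx i).b0m _ ((h.bx i).lm _ h1.1))

theorem FB.zc (h : FB q ι b0 b δ R Q Θ l k) (hf : FF q b0 b Q Θ l f) :
    ZC {x : Fb q b | ‖ι x.1‖ < R} (fun x u => PhiC b0 Θ l k f x.1 u.1) := by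
  intro x hx
  have q4 : ∀ i, sh (Q i) (l i) (1/4) ⊆ sh (Q i) (l i) (1/2) := fun i => sh_mono (by norm_num)
  have o1 : ∀ᶠ u : Fb q b in 𝓝 x, u.1 ∈ sh (Q (k x)) (l (k x)) (1/4) :=
    continuous_subtype_val.continuousAt (((h.bx _).sh_op _).mem_nhds (h.hk x.1 (Or.inr x.2) hx.le))
  have o3 : ∀ᶠ u : Fb q b in 𝓝 x, ‖ι u.1‖ < R :=
    ((h.hi.norm.comp continuous_subtype_val).continuousAt).eventually_lt_const hx
  filter_upwards [o1, o3] with y h1 h3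
  filter_upwards [h.K hf (q4 _ h1) (q4 _ (h.hk y.1 (Or.inr y.2) h3.le)) h3] with u hu
  simp only [PhiC]
  linarith

theorem FB.slice (h : FB q ι b0 b δ R Q Θ l k) (i : I) :
    IsPreconnected {v : Fb q b | v.1 ∈ sh (Q i) (l i) (1/2)} := by
  let e : Metric.ball (0:ℂ) (1/2) → Fb q b := fun ζ => ⟨Θ i b ζ, (h.bx i).qT _ h.hb _ (Metric.ball_subset_ball (by norm_num) ζ.2)⟩
  have he : Continuous e := by
    refine Continuous.subtype_mk ?_ _
    have : Continuous fun ζ : Metric.ball (0:ℂ) (1/2) => (b, (ζ:ℂ)) := by fun_prop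
    exact (h.bx i).ct.comp_continuous this fun ζ => ⟨h.hb, (Metric.ball_subset_ball (by norm_num) ζ.2)⟩
  have : {v : Fb q b | v.1 ∈ sh (Q i) (l i) (1/2)} = range e := by
    ext v
    constructor
    · intro hv
      refine ⟨⟨l i v, hv.2⟩, Subtype.ext ?_⟩
      have := (h.bx i).inv v hv.1
      rwa [show q v.1 = b from v.2] at this
    · rintro ⟨ζ, rfl⟩
      exact (h.bx i).T_mem_sh (by norm_num) h.hb ζ.2
  rw [this]
  have : PreconnectedSpace (Metric.ball (0:ℂ) (1/2)) :=
    Subtype.preconnectedSpace ((convex_ball _ _).isPreconnected)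
  exact isPreconnected_range he

theorem FB.slice_sub (h : FB q ι b0 b δ R Q Θ l k) {i : I} {u : Z} (hu : u ∈ Q i) (huR : ‖ι u‖ + 1 ≤ R) {y0 v : Fb q b}
    (hv : v ∈ connectedComponentIn {x : Fb q b | ‖ι x.1‖ < R} y0) (hvi : v.1 ∈ sh (Q i) (l i) (1/2)) :
    {v : Fb q b | v.1 ∈ sh (Q i) (l i) (1/2)} ⊆ connectedComponentIn {x : Fb q b | ‖ι x.1‖ < R} y0 := by
  rw [connectedComponentIn_eq hv]
  refine (h.slice i).subset_connectedComponentIn hvi fun w hw => ?_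
  exact (h.osc i u hu w hw.1).trans_le huR

theorem FB.tr (h : FB q ι b0 b δ R Q Θ l k) (hf : FF q b0 b Q Θ l f) {R1 : ℝ} (hR1 : R1 + 1 ≤ R)
    {φ : Fb q b0 → Fb q b0 → ℚ} (hp : ∀ i, Prim {x : Fb q b0 | x.1 ∈ Q i} φ (fun x => f i x.1))
    {x0 : Fb q b0} {i0 : I} (hx0 : x0.1 ∈ sh (Q i0) (l i0) (1/4)) {y0 : Fb q b} (hy0 : y0.1 = Θ i0 b (l i0 x0))
    (hBC : BC (connectedComponentIn {x : Fb q b | ‖ι x.1‖ < R} y0) (fun x u => PhiC b0 Θ l k f x.1 u.1)) :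
    BC (connectedComponentIn {x : Fb q b0 | ‖ι x.1‖ < R1} x0) φ := by
  classical
  obtain ⟨G, hG⟩ := hBC
  by_cases hx0R : ‖ι x0.1‖ < R1
  swap
  · refine ⟨fun _ => 0, ?_⟩
    rw [connectedComponentIn_eq_empty (by exact hx0R)]
    intro x hx; exact hx.elim
  set Y0 := connectedComponentIn {x : Fb q b | ‖ι x.1‖ < R} y0 with hY0
  set Y := connectedComponentIn {x : Fb q b0 | ‖ι x.1‖ < R1} x0 with hY
  have hYR : ∀ u ∈ Y, ‖ι u.1‖ < R1 := fun u hu => connectedComponentIn_subset {x : Fb q b0 | ‖ι x.1‖ < R1} x0 hu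
  have hY0R : ∀ u ∈ Y0, ‖ι u.1‖ < R := fun u hu => connectedComponentIn_subset {x : Fb q b | ‖ι x.1‖ < R} y0 hu
  have q4 : ∀ i, sh (Q i) (l i) (1/4) ⊆ sh (Q i) (l i) (1/2) := fun i => sh_mono (by norm_num)
  -- transported point
  let θ : I → Fb q b0 → Fb q b := fun i u => if hh : u.1 ∈ sh (Q i) (l i) (1/4) then
    ⟨Θ i b (l i u), (h.bx i).qT _ h.hb _ ((h.bx i).lm _ hh.1)⟩ else y0
  have hθ : ∀ i u, u.1 ∈ sh (Q i) (l i) (1/4) → (θ i u).1 = Θ i b (l i u) := fun i u hh => by simp only [θ, dif_pos hh]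
  have hθh : ∀ i j u, u.1 ∈ sh (Q i) (l i) (1/4) → u.1 ∈ sh (Q j) (l j) (1/4) → (θ i u).1 ∈ sh (Q j) (l j) (1/2) :=
    fun i j u h1 h2 => by rw [hθ i u h1]; exact h.H1 _ _ _ u.2 h1 h2
  have hind : ∀ u : Fb q b0, ‖ι u.1‖ < R1 → ∀ i j, u.1 ∈ sh (Q i) (l i) (1/4) → u.1 ∈ sh (Q j) (l j) (1/4) → θ i u ∈ Y0 → θ j u ∈ Y0 :=
    fun u hu i j h1 h2 h3 => h.slice_sub h2.1 (by linarith) h3 (hθh i j u h1 h2) (hθh j j u h2 h2)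
  have hkY : ∀ u : Fb q b0, ‖ι u.1‖ < R1 → u.1 ∈ sh (Q (k u)) (l (k u)) (1/4) := fun u hu => h.hk u.1 (Or.inl u.2) (by linarith)
  have near : ∀ x : Fb q b0, ∀ i, x.1 ∈ sh (Q i) (l i) (1/4) → ∀ᶠ u : Fb q b0 in 𝓝 x, u.1 ∈ sh (Q i) (l i) (1/4) := fun x i hx =>
    continuous_subtype_val.continuousAt (((h.bx i).sh_op _).mem_nhds hx)
  have o3 : ∀ x : Fb q b0, ‖ι x.1‖ < R1 → ∀ᶠ u : Fb q b0 in 𝓝 x, ‖ι u.1‖ < R1 := fun x hx =>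
    ((h.hi.norm.comp continuous_subtype_val).continuousAt).eventually_lt_const hx
  have hPL : LC Y (fun u => θ (k u) u ∈ Y0) := by
    intro x hx
    have hxR := hYR x hx
    filter_upwards [near x _ (hkY x hxR), o3 x hxR] with u h1 h2
    have hux : θ (k x) u ∈ Y0 ↔ θ (k x) x ∈ Y0 := by
      have hh := hθh (k x) (k x) x (hkY x hxR) (hkY x hxR)
      have hh' := hθh (k x) (k x) u h1 h1
      exact ⟨fun h3 => h.slice_sub h1.1 (by linarith) h3 hh' hh, fun h3 => h.slice_sub h1.1 (by linarith) h3 hh hh'⟩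
    exact propext ⟨fun h3 => hux.1 (hind u h2 _ _ (hkY u h2) h1 h3), fun h3 => hind u h2 _ _ h1 (hkY u h2) (hux.2 h3)⟩
  have hx0Y : x0 ∈ Y := mem_connectedComponentIn (by exact hx0R)
  have hP : ∀ u ∈ Y, ∀ i, u.1 ∈ sh (Q i) (l i) (1/4) → θ i u ∈ Y0 := by
    intro u hu i hui
    have e := hPL.const_of_preconn isPreconnected_connectedComponentIn hx0Y hu
    have h0 : θ i0 x0 ∈ Y0 := by
      have : θ i0 x0 = y0 := Subtype.ext (by rw [hθ _ _ hx0, hy0])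
      rw [this]
      refine mem_connectedComponentIn ?_
      have := h.osc i0 x0.1 hx0.1 (θ i0 x0).1 (hθh i0 i0 x0 hx0 hx0).1
      rw [mem_ofPred_eq, ← ‹θ i0 x0 = y0›]; linarith
    have h1 := hind x0 hx0R i0 (k x0) hx0 (hkY _ hx0R) h0
    have h2 : θ (k u) u ∈ Y0 := by rw [e]; exact h1
    exact hind u (hYR u hu) _ _ (hkY u (hYR u hu)) hui h2
  -- the functions L
  let L : I → Fb q b → ℚ := fun i v => G v - f i (Θ (k v) b0 (l (k v) v))
  have hL : ∀ i, LC (Y0 ∩ {v : Fb q b | v.1 ∈ sh (Q i) (l i) (1/2)}) (L i) := by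
    intro i v hv
    have hvR := hY0R v hv.1
    filter_upwards [h.K hf hv.2 (q4 _ (h.hk v.1 (Or.inr v.2) hvR.le)) hvR, hG v hv.1] with u h1 h2

    simp only [PhiC] at h2
    simp only [L]
    linarith
  have hLc : ∀ x ∈ Y, ∀ i, x.1 ∈ sh (Q i) (l i) (1/4) → ∀ v : Fb q b, v.1 ∈ sh (Q i) (l i) (1/2) → L i v = L i (θ i x) := by
    intro x hx i hxi v hv
    have hs := h.slice_sub hxi.1 (by linarith [hYR x hx]) (hP x hx i hxi) (hθh i i x hxi hxi)
    refine (hL i).const_of_preconn ?_ ⟨hs (hθh i i x hxi hxi), hθh i i x hxi hxi⟩ ⟨hs hv, hv⟩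
    rw [inter_eq_right.2 hs]
    exact h.slice i
  refine ⟨fun u => L (k u) (θ (k u) u) + f (k u) u, fun x hx => ?_⟩
  have hxR := hYR x hx
  have hxi := hkY x hxR
  set i := k x with hi
  filter_upwards [near x i hxi, o3 x hxR, hp i x hxi.1] with u h1 h2 h3
  rw [h3]
  set m := k u with hm
  have hum : u.1 ∈ sh (Q m) (l m) (1/4) := hkY u h2
  have e1 := hLc x hx i hxi (θ m u) (hθh m i u hum h1)
  set v := θ m u with hv
  have hvR : ‖ι v.1‖ < R := by
    have := h.osc m u.1 hum.1 v.1 (hθh m m u hum hum).1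
    linarith
  have e2 := hf.H2 v.1 v.2 m i (k v) (hθh m m u hum hum) (hθh m i u hum h1) (q4 _ (h.hk v.1 (Or.inr v.2) hvR.le))
  have e3 : Θ m b0 (l m v) = u := by
    rw [hv, hθ _ _ hum, (h.bx m).lT _ h.hb _ ((h.bx m).lm _ hum.1)]
    have := (h.bx m).inv u hum.1
    rwa [show q u.1 = b0 from u.2] at this
  rw [e3] at e2
  simp only [L] at e1 ⊢
  linarith
end
end
end

section
set_option linter.unusedSectionVars false
noncomputable section
section
variable {Z : Type} [TopologicalSpace Z] [T2Space Z] {F : Type} [NormedAddCommGroup F] [NormedSpace ℝ F] [ProperSpace F]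
  {E : Type*} [NormedAddCommGroup E] [ProperSpace E]

def slE (q : Z → F) (b : F) (Θ : F → ℂ → Z) (y : Fb q b) (ζ : ℂ) : Fb q b :=
  open Classical in if h : q (Θ b ζ) = b then ⟨Θ b ζ, h⟩ else y

variable {q : Z → F} {b0 : F} {δ : ℝ}

theorem Box.slE_eq {Q : Set Z} {Θ : F → ℂ → Z} {l : Z → ℂ} (h : Box q b0 δ Q Θ l)
    {b : F} (hb : b ∈ Metric.ball b0 δ) (y : Fb q b) {ζ : ℂ} (hζ : ζ ∈ Metric.ball (0:ℂ) 1) : (slE q b Θ y ζ).1 = Θ b ζ := by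
  unfold slE; rw [dif_pos (h.qT b hb ζ hζ)]

theorem Box.dch {Q : Set Z} {Θ : F → ℂ → Z} {l : Z → ℂ} (h : Box q b0 δ Q Θ l)
    {b : F} (hb : b ∈ Metric.ball b0 δ) (y : Fb q b) :
    DCh {x : Fb q b | x.1 ∈ Q} (slE q b Θ y) (fun x => l x.1) where
  op := h.op.preimage continuous_subtype_val
  ec := by
    rw [Topology.IsInducing.subtypeVal.continuousOn_iff]
    have : ContinuousOn (fun ζ : ℂ => Θ b ζ) (Metric.ball 0 1) :=
      h.ct.comp (f := fun ζ : ℂ => (b, ζ)) (by fun_prop) fun ζ hζ => ⟨hb, hζ⟩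
    exact this.congr fun ζ hζ => h.slE_eq hb y hζ
  em ζ hζ := by rw [mem_ofPred_eq, h.slE_eq hb y hζ]; exact h.mp b hb ζ hζ
  cc := h.cl.comp continuous_subtype_val.continuousOn fun x hx => hx
  cm x hx := h.lm x.1 hx
  inv x hx := Subtype.ext (by
    rw [h.slE_eq hb y (h.lm x.1 hx)]
    have := h.inv x.1 hx
    rwa [show q x.1 = b from x.2] at this)

theorem DCh.bc {X : Type} [TopologicalSpace X] {T : Set X} {e : ℂ → X} {c : X → ℂ} (h : DCh T e c) {φ : X → X → ℚ}
    (hφ : ZC univ φ) : BC T φ := by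
  obtain ⟨f, hf⟩ := BC_open_convex Metric.isOpen_ball (convex_ball (0:ℂ) 1)
    (hφ.comp Metric.isOpen_ball h.ec (fun z _ => mem_univ _))
  refine ⟨f ∘ c, fun x hx => ?_⟩
  filter_upwards [(hf.comp h.op h.cc h.cm) x hx, h.op.mem_nhds hx] with u hu huT
  rw [← hu]
  simp only [h.inv x hx, h.inv u huT]

def HBox (q : Z → F) : Prop := ∀ z : Z, ∀ O ∈ 𝓝 z, ∃ δ Q Θ l, Box q (q z) δ Q Θ l ∧ Q ⊆ O ∧ z ∈ Q ∧ l z = 0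

theorem cover (hq : Continuous q) {ι : Z → E} (hι : IsClosedEmbedding ι) (hB : HBox q) (x0 : Z) (hx0 : q x0 = b0) (R : ℝ) :
    ∃ (I : Type) (_ : Finite I) (δ : ℝ) (Q : I → Set Z) (Θ : I → F → ℂ → Z) (l : I → Z → ℂ) (i0 : I),
      (∀ i, Box q b0 δ (Q i) (Θ i) (l i)) ∧ (∀ i, ∀ z ∈ Q i, ∀ z' ∈ Q i, ‖ι z'‖ < ‖ι z‖ + 1) ∧
      (∀ z, q z = b0 → ‖ι z‖ ≤ R → ∃ i, z ∈ sh (Q i) (l i) (1/4)) ∧ x0 ∈ sh (Q i0) (l i0) (1/4) := by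
  classical
  have ex : ∀ z : Z, ∃ δ Q Θ l, Box q (q z) δ Q Θ l ∧ Q ⊆ ι ⁻¹' Metric.ball (ι z) (1/2) ∧ z ∈ Q ∧ l z = 0 := fun z =>
    hB z _ (hι.continuous.continuousAt (Metric.ball_mem_nhds _ (by norm_num)))
  choose d Q Θ l hb hs hz hl using ex
  have hK : IsCompact (ι ⁻¹' Metric.closedBall 0 R ∩ q ⁻¹' {b0}) :=
    (hι.isCompact_preimage (isCompact_closedBall 0 R)).inter_right (isClosed_singleton.preimage hq)
  obtain ⟨t, ht, hc⟩ := hK.elim_nhds_subcover (fun z => sh (Q z) (l z) (1/4)) fun z _ =>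
    ((hb z).sh_op _).mem_nhds ⟨hz z, by simp [hl z]⟩
  let I := {z // z ∈ insert x0 t}
  have hI : ∀ i : I, q i.1 = b0 := fun i => by
    rcases Finset.mem_insert.1 i.2 with h | h
    · rw [h, hx0]
    · exact (ht _ h).2
  have hne : (insert x0 t).Nonempty := ⟨x0, Finset.mem_insert_self _ _⟩
  obtain ⟨w, hw, hwe⟩ := (insert x0 t).exists_mem_eq_inf' hne d
  set δ := (insert x0 t).inf' hne d with hδ
  have hδ0 : 0 < δ := by rw [hwe]; exact (hb w).dp
  have hδ1 : ∀ i : I, δ ≤ d i.1 := fun i => Finset.inf'_le _ i.2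
  have hbI : ∀ i : I, Box q b0 (d i.1) (Q i.1) (Θ i.1) (l i.1) := fun i => by rw [← hI i]; exact hb i.1
  have hsub : ∀ i : I, ∀ z, q z = b0 → z ∈ sh (Q i.1) (l i.1) (1/4) →
      z ∈ sh (Q i.1 ∩ q ⁻¹' Metric.ball b0 δ) (l i.1) (1/4) := fun i z hz h =>
    ⟨⟨h.1, by rw [mem_preimage, hz]; exact Metric.mem_ball_self hδ0⟩, h.2⟩
  refine ⟨I, inferInstance, δ, fun i => Q i.1 ∩ q ⁻¹' Metric.ball b0 δ, fun i => Θ i.1, fun i => l i.1,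
    ⟨x0, Finset.mem_insert_self _ _⟩, fun i => (hbI i).restrict hq hδ0 (hδ1 i), ?_, ?_, ?_⟩
  · intro i z h1 z' h2
    have h3 := hs i.1 h1.1
    have h4 := hs i.1 h2.1
    rw [mem_preimage, Metric.mem_ball] at h3 h4
    have h5 := dist_triangle_right (ι z') (ι z) (ι i.1)
    have h6 := norm_le_norm_add_norm_sub' (ι z') (ι z)
    rw [← dist_eq_norm] at h6
    linarith
  · intro z h1 h2
    obtain ⟨y, hy, h3⟩ := mem_iUnion₂.1 (hc ⟨by simpa using h2, h1⟩)
    exact ⟨⟨y, Finset.mem_insert_of_mem hy⟩, hsub ⟨y, _⟩ z h1 h3⟩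
  · exact hsub ⟨x0, _⟩ x0 hx0 ⟨hz x0, by simp [hl x0]⟩

theorem S0 (hq : Continuous q) {ι : Z → E} (hι : IsClosedEmbedding ι) {I : Type} {U : I → Set Z} (hU : ∀ i, IsOpen (U i)) {R : ℝ}
    (hc : ∀ z, q z = b0 → ‖ι z‖ ≤ R → ∃ i, z ∈ U i) :
    ∀ᶠ b in 𝓝 b0, ∀ z, q z = b → ‖ι z‖ ≤ R → ∃ i, z ∈ U i := by
  have hK : IsCompact (ι ⁻¹' Metric.closedBall 0 R \ ⋃ i, U i) :=
    (hι.isCompact_preimage (isCompact_closedBall 0 R)).diff (isOpen_iUnion hU)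
  have h1 : b0 ∉ q '' (ι ⁻¹' Metric.closedBall 0 R \ ⋃ i, U i) := by
    rintro ⟨z, hz, h⟩
    exact hz.2 (mem_iUnion.2 (hc z h (by simpa using hz.1)))
  filter_upwards [(hK.image hq).isClosed.isOpen_compl.mem_nhds h1] with b hb z hz hzR
  by_contra hn
  exact hb ⟨z, ⟨by simpa using hzR, fun h => hn (mem_iUnion.1 h)⟩, hz⟩
end
end
end

section
set_option linter.unusedSectionVars false
noncomputable section
section
variable {E : Type*} [NormedAddCommGroup E] [InnerProductSpace ℂ E] [ProperSpace E]

theorem pick_k {X : Type} [TopologicalSpace X] [LocallyConnectedSpace X] [PreconnectedSpace X] {ι : X → E} (hι : Continuous ι)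
    {r : ℕ} {φ : Fin r → X → X → ℚ} (hi : ∀ a : Fin r → ℚ, BC univ (fun x u => ∑ j, a j * φ j x u) → a = 0) (x0 : X)
    {R0 : ℝ} (hx0 : ‖ι x0‖ < R0) :
    ∃ k : ℕ, ∀ a : Fin r → ℚ, BC (connectedComponentIn (ι ⁻¹' Metric.ball 0 (R0 + k)) x0) (fun x u => ∑ j, a j * φ j x u) → a = 0 := by
  let V := fun k : ℕ => ι ⁻¹' (Metric.ball 0 (R0 + k))
  have hVm : Monotone V := mono_balls ι R0
  have hVo : ∀ k, IsOpen (V k) := fun k => Metric.isOpen_ball.preimage hι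
  have hU := iUnion_comp hVm hVo (x0 := x0) ⟨0, by simpa [V] using hx0⟩
  rw [iUnion_balls, connectedComponentIn_univ, PreconnectedSpace.connectedComponent_eq_univ] at hU
  have hYm : Monotone fun k => connectedComponentIn (V k) x0 := fun k l hkl => connectedComponentIn_mono _ (hVm hkl)
  let S : ℕ → Submodule ℚ (Fin r → ℚ) := fun k =>
    { carrier := {a | BC (connectedComponentIn (V k) x0) (fun x u => ∑ j, a j * φ j x u)}
      add_mem' := by
        intro a b ha hb
        exact (BC.add ha hb).of_eq fun x _ => by funext u; simp [add_mul, Finset.sum_add_distrib]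
      zero_mem' := ⟨0, fun x _ => by simp⟩
      smul_mem' := by
        intro c a ha
        exact (BC.smul ha c).of_eq fun x _ => by funext u; simp [mul_assoc, Finset.mul_sum] }
  obtain ⟨n, hn⟩ := IsArtinian.monotone_stabilizes (R := ℚ) (M := Fin r → ℚ)
    ⟨fun k => OrderDual.toDual (S k), fun k l hkl a ha => BC.mono ha (hYm hkl)⟩
  refine ⟨n, fun a ha => hi a ?_⟩
  rw [hU]
  refine BC_iUnion_preconn hYm (fun k => isPreconnected_connectedComponentIn) (fun k => (hVo k).connectedComponentIn) (x0 := x0)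
    (fun k x hx => mem_connectedComponentIn (mem_of_mem_comp hx)) fun k => ?_
  have ha' : a ∈ S n := ha
  rcases le_total n k with h | h
  · have : S n = S k := hn k h
    rw [this] at ha'
    exact ha'
  · exact BC.mono ha' (hYm h)

variable {Z : Type} [TopologicalSpace Z] [T2Space Z] {F : Type} [NormedAddCommGroup F] [NormedSpace ℝ F] [ProperSpace F]
  {q : Z → F} {b0 : F}

theorem FF.sum {b : F} {I : Type} {Q : I → Set Z} {Θ : I → F → ℂ → Z} {l : I → Z → ℂ} {r : ℕ}
    {f : Fin r → I → Z → ℚ} (h : ∀ j, FF q b0 b Q Θ l (f j)) (a : Fin r → ℚ) : FF q b0 b Q Θ l (fun i z => ∑ j, a j * f j i z) where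
  hc i i' z hz hq := by
    have := eventually_all.2 fun j => (h j).hc i i' z hz hq
    filter_upwards [this] with u hu
    simp only [← Finset.sum_sub_distrib, ← mul_sub, hu]
  H2 v hv i i' m h1 h2 h3 := by
    simp only [← Finset.sum_sub_distrib, ← mul_sub, (h _).H2 v hv i i' m h1 h2 h3]

theorem tight (hq : Continuous q) {ι : Z → E} (hι : IsClosedEmbedding ι) (hB : HBox q) (x0 : Fb q b0)
    [LocallyConnectedSpace (Fb q b0)] [PreconnectedSpace (Fb q b0)] {r : ℕ} {φ : Fin r → Fb q b0 → Fb q b0 → ℚ}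
    (hφ : ∀ j, ZC univ (φ j)) (hi : ∀ a : Fin r → ℚ, BC univ (fun x u => ∑ j, a j * φ j x u) → a = 0)
    {O : Set Z} (hO : O ∈ 𝓝 x0.1) :
    ∃ (I : Type) (_ : Finite I) (R δ : ℝ) (Q : I → Set Z) (Θ : I → F → ℂ → Z) (l : I → Z → ℂ) (i0 : I),
      (∀ i, Box q b0 δ (Q i) (Θ i) (l i)) ∧ (∀ i, ∀ z ∈ Q i, ∀ z' ∈ Q i, ‖ι z'‖ < ‖ι z‖ + 1) ∧
      x0.1 ∈ sh (Q i0) (l i0) (1/4) ∧ ‖ι x0.1‖ + 1 < R ∧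
      (∀ z, q z ∈ Metric.ball b0 δ → ‖ι z‖ ≤ R → ∃ i, z ∈ sh (Q i) (l i) (1/4)) ∧
      (∀ i j, ∀ b ∈ Metric.ball b0 δ, ∀ b' ∈ Metric.ball b0 δ, ∀ ζ ∈ Metric.closedBall (0:ℂ) (1/2),
        Θ j b ζ ∈ sh (Q i) (l i) (1/2) → Θ j b' ζ ∈ Q i) ∧
      (∀ b ∈ Metric.ball b0 δ, Θ i0 b (l i0 x0) ∈ O) ∧
      ∀ b ∈ Metric.ball b0 δ, ∃ Φ : Fin r → Fb q b → Fb q b → ℚ, (∀ j, ZC {x : Fb q b | ‖ι x.1‖ < R} (Φ j)) ∧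
        ∀ y0 : Fb q b, y0.1 = Θ i0 b (l i0 x0) → ∀ a : Fin r → ℚ,
          BC (connectedComponentIn {x : Fb q b | ‖ι x.1‖ < R} y0) (fun x u => ∑ j, a j * Φ j x u) → a = 0 := by
  classical
  have eS : ∀ (b : F) (R : ℝ), {x : Fb q b | ‖ι x.1‖ < R} = (fun x : Fb q b => ι x.1) ⁻¹' Metric.ball 0 R := fun b R => by
    ext x; simp
  obtain ⟨k1, hk1⟩ := pick_k (ι := fun x : Fb q b0 => ι x.1) (hι.continuous.comp continuous_subtype_val) hi x0
    (R0 := ‖ι x0.1‖ + 1) (by linarith)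
  set R1 := ‖ι x0.1‖ + 1 + k1 with hR1
  have hR1x : ‖ι x0.1‖ + 1 ≤ R1 := by rw [hR1]; linarith [Nat.cast_nonneg (α := ℝ) k1]
  rw [← eS] at hk1
  obtain ⟨I, hI, δ, Q, Θ, l, i0, hb, hosc, hcov, hx0⟩ := cover hq hι hB x0.1 x0.2 (R1 + 1)
  have hfe : ∀ j i, ∃ g : Z → ℚ, Prim {x : Fb q b0 | x.1 ∈ Q i} (φ j) (fun x => g x.1) := by
    intro j i
    obtain ⟨g, hg⟩ := ((hb i).dch (hb i).b0m x0).bc (hφ j)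
    refine ⟨fun z => if h : q z = b0 then g ⟨z, h⟩ else 0, ?_⟩
    convert hg using 1
    funext x
    dsimp only
    rw [dif_pos (show q x.1 = b0 from x.2)]
  choose f hf using hfe
  have hc : ∀ j i i', ∀ z ∈ Q i ∩ Q i', q z = b0 → ∀ᶠ u in 𝓝[q ⁻¹' {b0}] z, f j i u - f j i' u = f j i z - f j i' z := by
    intro j i i' z hz hzb
    have h1 := ((hf j i).mono (W := {x : Fb q b0 | x.1 ∈ Q i ∩ Q i'}) fun x hx => hx.1).sub_LC ((hf j i').mono fun x hx => hx.2) ⟨z, hzb⟩ hz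
    rw [nhds_subtype_eq_comap, eventually_comap] at h1
    rw [eventually_nhdsWithin_iff]
    exact h1.mono fun u hu huq => hu ⟨u, huq⟩ rfl
  have e0 := S0 hq hι (fun i => (hb i).sh_op (1/4)) hcov
  have e1 : ∀ᶠ w in 𝓝 (b0, b0), ∀ i j, ∀ ζ ∈ Metric.closedBall (0:ℂ) (1/4), Θ j w.1 ζ ∈ sh (Q i) (l i) (1/4) → Θ j w.2 ζ ∈ sh (Q i) (l i) (1/2) :=
    eventually_all.2 fun i => eventually_all.2 fun j => S1 hq (hb i) (hb j) (by norm_num) (by norm_num) (by norm_num)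
  have e1' : ∀ᶠ w in 𝓝 (b0, b0), ∀ i j, ∀ ζ ∈ Metric.closedBall (0:ℂ) (1/2), Θ j w.1 ζ ∈ sh (Q i) (l i) (1/2) → Θ j w.2 ζ ∈ sh (Q i) (l i) 1 :=
    eventually_all.2 fun i => eventually_all.2 fun j => S1 hq (hb i) (hb j) (by norm_num) (by norm_num) (by norm_num)
  have e2 : ∀ᶠ b in 𝓝 b0, ∀ j i i' m, ∀ ζ ∈ Metric.closedBall (0:ℂ) (1/2), Θ m b ζ ∈ sh (Q i) (l i) (1/2) → Θ m b ζ ∈ sh (Q i') (l i') (1/2) →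
      f j i (Θ m b0 ζ) - f j i' (Θ m b0 ζ) = f j i (Θ i b0 (l i (Θ m b ζ))) - f j i' (Θ i b0 (l i (Θ m b ζ))) :=
    eventually_all.2 fun j => eventually_all.2 fun i => eventually_all.2 fun i' => eventually_all.2 fun m =>
      S2 hq (hb i) (hb i') (hb m) (by norm_num) (c := fun z => f j i z - f j i' z) (hc j i i')
  have e3 : ∀ᶠ b in 𝓝 b0, Θ i0 b (l i0 x0) ∈ O := by
    have h1 := (hb i0).ctAt (hb i0).b0m ((hb i0).lm _ hx0.1)
    have h2 := (hb i0).inv _ hx0.1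
    rw [show q x0.1 = b0 from x0.2] at h2
    rw [ContinuousAt] at h1
    simp only [h2] at h1
    exact (h1.comp (Continuous.tendsto (f := fun b : F => (b, l i0 x0.1)) (by fun_prop) b0)) hO
  obtain ⟨ε0, hε0, h0⟩ := Metric.eventually_nhds_iff_ball.1 ((e0.and e2).and e3)
  obtain ⟨ε1, hε1, h1⟩ := Metric.eventually_nhds_iff_ball.1 (e1.and e1')
  have hd := (hb i0).dp
  set δ' := min δ (min ε0 ε1) with hδ'
  have hδ0 : 0 < δ' := lt_min hd (lt_min hε0 hε1)
  have hδ1 : δ' ≤ δ := min_le_left _ _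
  have b0' : ∀ b ∈ Metric.ball b0 δ', b ∈ Metric.ball b0 ε0 := fun b hb =>
    Metric.ball_subset_ball ((min_le_right _ _).trans (min_le_left _ _)) hb
  have b1' : ∀ b ∈ Metric.ball b0 δ', ∀ b' ∈ Metric.ball b0 δ', (b, b') ∈ Metric.ball (b0, b0) ε1 := fun b hb b' hb' => by
    rw [← ball_prod_same]
    exact ⟨Metric.ball_subset_ball ((min_le_right _ _).trans (min_le_right _ _)) hb,
      Metric.ball_subset_ball ((min_le_right _ _).trans (min_le_right _ _)) hb'⟩
  have bd' : ∀ b ∈ Metric.ball b0 δ', b ∈ Metric.ball b0 δ := fun b hb => Metric.ball_subset_ball hδ1 hb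
  have bc' : b0 ∈ Metric.ball b0 δ' := Metric.mem_ball_self hδ0
  refine ⟨I, hI, R1 + 1, δ', fun i => Q i ∩ q ⁻¹' Metric.ball b0 δ', Θ, l, i0, fun i => (hb i).restrict hq hδ0 hδ1,
    fun i z hz z' hz' => hosc i z hz.1 z' hz'.1, ⟨⟨hx0.1, ?_⟩, hx0.2⟩, by linarith, ?_, ?_, fun b hb => (h0 _ (b0' _ hb)).2, ?_⟩
  · rw [mem_preimage, show q x0.1 = b0 from x0.2]; exact bc'
  · intro z hz hzR
    obtain ⟨i, hi⟩ := (h0 _ (b0' _ hz)).1.1 z rfl hzR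
    exact ⟨i, ⟨hi.1, hz⟩, hi.2⟩
  · intro i j b hbb b' hbb' ζ hζ hm
    have := (h1 _ (b1' b hbb b' hbb')).2 i j ζ hζ ⟨hm.1.1, hm.2⟩
    refine ⟨this.1, ?_⟩
    rw [mem_preimage, (hb j).qT b' (bd' _ hbb') ζ (Metric.closedBall_subset_ball (by norm_num) hζ)]
    exact hbb'
  · intro b hbb
    have ek : ∀ v, q v = b0 ∨ q v = b → ‖ι v‖ ≤ R1 + 1 → ∃ i, v ∈ sh (Q i) (l i) (1/4) := by
      rintro v (hv | hv) hvR
      · exact hcov v hv hvR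
      · exact (h0 _ (b0' _ hbb)).1.1 v hv hvR
    have : ∃ k : Z → I, ∀ v, q v = b0 ∨ q v = b → ‖ι v‖ ≤ R1 + 1 → v ∈ sh (Q (k v)) (l (k v)) (1/4) := by
      refine ⟨fun v => if h : ∃ i, v ∈ sh (Q i) (l i) (1/4) then h.choose else i0, fun v h1 h2 => ?_⟩
      dsimp only
      rw [dif_pos (ek v h1 h2)]
      exact (ek v h1 h2).choose_spec
    obtain ⟨k, hk⟩ := this
    have hFB : FB q ι b0 b δ (R1 + 1) Q Θ l k :=
      { bx := hb
        hi := hι.continuous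
        hb := bd' _ hbb
        osc := hosc
        hk := hk
        H1 := by
          intro u m i hu h2 h3
          refine (h1 _ (b1' b0 bc' b hbb)).1 i m (l m u) (Metric.ball_subset_closedBall h2.2) ?_
          have := (hb m).inv u h2.1
          rw [hu] at this
          rw [this]; exact h3
        H1' := by
          intro y i j hy h2 h3
          refine ((h1 _ (b1' b hbb b0 bc')).2 j i (l i y) (Metric.ball_subset_closedBall h2.2) ?_).1
          have := (hb i).inv y h2.1
          rw [hy] at this
          rw [this]; exact h3 }
    have hFF : ∀ j, FF q b0 b Q Θ l (f j) := fun j =>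
      { hc := hc j
        H2 := by
          intro v hv i i' m h2 h3 h4
          have e := (hb m).inv v h4.1
          rw [hv] at e
          have := (h0 _ (b0' _ hbb)).1.2 j i i' m (l m v) (Metric.ball_subset_closedBall h4.2) (by rw [e]; exact h2) (by rw [e]; exact h3)
          rw [e] at this
          exact this }
    refine ⟨fun j x u => PhiC b0 Θ l k (f j) x.1 u.1, fun j => hFB.zc (hFF j), fun y0 hy0 a ha => hk1 a ?_⟩
    refine hFB.tr (FF.sum hFF a) le_rfl (fun i x hx => ?_) hx0 hy0 ha
    have := eventually_all.2 fun j => hf j i x hx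
    filter_upwards [this] with u hu
    simp only [← Finset.sum_sub_distrib, ← mul_sub, hu]
end
end
end

section
set_option linter.unusedSectionVars false
noncomputable section
section
variable {E : Type*} [NormedAddCommGroup E] [InnerProductSpace ℂ E] [ProperSpace E]

theorem ht_lemma {X Xt : Type} [TopologicalSpace X] [TopologicalSpace Xt] {ι : X → E} {w : Xt → X} {𝒰 : Set (Set X)}
    (hF : Fam ι w 𝒰) {R : ℝ} (hR : 0 < R) {r : ℕ}
    (HII : ∀ φ : Fin (r+1) → X → X → ℚ, (∀ j, ZC univ (φ j)) → ∃ a : Fin (r+1) → ℚ, a ≠ 0 ∧ BC univ (fun x u => ∑ j, a j * φ j x u))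
    {Φ : Fin r → X → X → ℚ} (hΦ : ∀ j, ZC (ι ⁻¹' Metric.ball 0 R) (Φ j)) {y0 : X}
    (hi : ∀ a : Fin r → ℚ, BC (connectedComponentIn (ι ⁻¹' Metric.ball 0 R) y0) (fun x u => ∑ j, a j * Φ j x u) → a = 0)
    (χ : X → X → ℚ) (hχ : ZC univ χ) (hY : BC (connectedComponentIn (ι ⁻¹' Metric.ball 0 R) y0) χ) : BC univ χ := by
  choose Φ' h1 h2 using fun j => hF.ext_ball hR (Φ j) (hΦ j)
  obtain ⟨a, ha, hb⟩ := HII (Fin.cons χ Φ') (fun j => by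
    refine Fin.cases ?_ (fun i => ?_) j
    · exact hχ
    · exact h1 i)
  have hb' : BC univ (fun x u => a 0 * χ x u + ∑ j, a (Fin.succ j) * Φ' j x u) := hb.of_eq fun x _ => by
    funext u; rw [Fin.sum_univ_succ]; rfl
  have ht : (fun j => a (Fin.succ j)) = 0 := by
    apply hi
    refine ((hb'.mono (subset_univ _)).add (hY.smul (- a 0))).of_eq fun x hx => ?_
    funext u
    have : ∀ j, Φ' j x = Φ j x := fun j => h2 j x (connectedComponentIn_subset _ _ hx)
    simp only [this]
    ring
  have h0 : a 0 ≠ 0 := by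
    intro h0
    apply ha
    funext j
    refine Fin.cases h0 (fun i => ?_) j
    exact congrFun ht i
  refine (hb'.smul (a 0)⁻¹).of_eq fun x hx => ?_
  funext u
  have : ∀ j, a (Fin.succ j) = 0 := fun j => congrFun ht j
  simp [this, h0]
end
end
end

section
set_option linter.unusedSectionVars false
noncomputable section
section
variable {Z : Type} [TopologicalSpace Z] [T2Space Z] {F : Type} [NormedAddCommGroup F] [NormedSpace ℝ F] [ProperSpace F]
  {Mt : Type} [TopologicalSpace Mt] [T2Space Mt] {q : Z → F} {b0 : F} {δ : ℝ} {Q : Set Z} {Θ : F → ℂ → Z} {l : Z → ℂ} {π : Mt → Z}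

theorem fib_lift {b : F} (hc : IsCoveringMap (restrictPreimage {x | q x = b} π)) {γ : unitInterval → Z} (hγ : Continuous γ)
    (hq : ∀ t, q (γ t) = b) {y : Mt} (hy : π y = γ 0) : ∃ Γ : unitInterval → Mt, Continuous Γ ∧ (∀ t, π (Γ t) = γ t) ∧ Γ 0 = y := by
  let γ' : C(unitInterval, {x | q x = b}) := ⟨fun t => ⟨γ t, hq t⟩, hγ.subtype_mk _⟩
  let e : π ⁻¹' {x | q x = b} := ⟨y, by rw [mem_preimage, hy]; exact hq 0⟩
  have h0 : γ' 0 = restrictPreimage {x | q x = b} π e := Subtype.ext hy.symm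
  refine ⟨fun t => (hc.liftPath γ' e h0 t).1, by fun_prop, fun t => ?_, ?_⟩
  · have := congrFun (hc.liftPath_lifts γ' e h0) t
    exact congrArg Subtype.val this
  · exact congrArg Subtype.val (hc.liftPath_zero γ' e h0)

abbrev ABox (b0 : F) (δ : ℝ) := ↥(Metric.ball b0 δ) × ↥(Metric.ball (0:ℂ) 1)

theorem E1 (hl : IsLocalHomeomorph π) (hc : ∀ z, IsCoveringMap (restrictPreimage {x | q x = q z} π)) (hq : Continuous q)
    (h : Box q b0 δ Q Θ l) {ζ0 : ℂ} (hζ0 : ζ0 ∈ Metric.ball (0:ℂ) 1) {σ : F → Mt} (hσ : ContinuousOn σ (Metric.ball b0 δ))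
    (hσπ : ∀ b ∈ Metric.ball b0 δ, π (σ b) = Θ b ζ0) :
    ∃ s : Z → Mt, ContinuousOn s Q ∧ (∀ z ∈ Q, π (s z) = z) ∧ ∀ b ∈ Metric.ball b0 δ, s (Θ b ζ0) = σ b := by
  classical
  have hm : ∀ (t : unitInterval) (ζ : ↥(Metric.ball (0:ℂ) 1)), ζ0 + (t:ℝ) • (ζ.1 - ζ0) ∈ Metric.ball (0:ℂ) 1 := fun t ζ =>
    (convex_ball (0:ℂ) 1).add_smul_sub_mem hζ0 ζ.2 t.2
  let f : unitInterval × ABox b0 δ → Z := fun w => Θ w.2.1 (ζ0 + (w.1:ℝ) • (w.2.2.1 - ζ0))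
  have hf : Continuous f := by
    rw [← continuousOn_univ]
    exact h.ct.comp (f := fun w : unitInterval × ABox b0 δ => (w.2.1.1, ζ0 + (w.1:ℝ) • (w.2.2.1 - ζ0))) (by fun_prop)
      fun w _ => ⟨w.2.1.2, hm _ _⟩
  have ex : ∀ a : ABox b0 δ, ∃ Γ : unitInterval → Mt, Continuous Γ ∧ (∀ t, π (Γ t) = f (t, a)) ∧ Γ 0 = σ a.1 := fun a => by
    refine fib_lift (b := (a.1:F)) ?_ (γ := fun t => f (t, a)) (by fun_prop) (fun t => h.qT _ a.1.2 _ (hm _ _)) ?_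
    · have := hc (Θ a.1 ζ0)
      rwa [h.qT _ a.1.2 _ hζ0] at this
    · rw [hσπ _ a.1.2]; simp [f]
  choose Γ c1 c2 c3 using ex
  have hg : Continuous (fun w : unitInterval × ABox b0 δ => Γ w.2 w.1) :=
    hl.continuous_lift (T2Space.isSeparatedMap π) ⟨f, hf⟩ (by funext w; exact c2 _ _)
      (by
        simp only [c3]
        exact hσ.comp_continuous (by fun_prop) fun a => a.1.2) (fun a => c1 a)
  have hsur : Nonempty Mt := ⟨σ b0⟩
  refine ⟨fun z => if hz : z ∈ Q then Γ (⟨q z, h.qm z hz⟩, ⟨l z, h.lm z hz⟩) 1 else σ b0, ?_, ?_, ?_⟩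
  · rw [continuousOn_iff_continuous_domRestrict]
    have h1 : Continuous fun z : Q => ((1 : unitInterval), ((⟨q z, h.qm z z.2⟩, ⟨l z, h.lm z z.2⟩) : ABox b0 δ)) := by
      have := continuousOn_iff_continuous_domRestrict.1 h.cl
      refine continuous_const.prodMk (((hq.comp continuous_subtype_val).subtype_mk _).prodMk (Continuous.subtype_mk this _))
    refine (hg.comp h1).congr fun z => ?_
    simp
  · intro z hz
    dsimp only
    rw [dif_pos hz, c2]
    simp [f, h.inv z hz]
  · intro b hb
    dsimp only
    rw [dif_pos (h.mp b hb ζ0 hζ0)]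
    have e : ((⟨q (Θ b ζ0), h.qm _ (h.mp b hb ζ0 hζ0)⟩, ⟨l (Θ b ζ0), h.lm _ (h.mp b hb ζ0 hζ0)⟩) : ABox b0 δ) = (⟨b, hb⟩, ⟨ζ0, hζ0⟩) :=
      Prod.ext (Subtype.ext (h.qT b hb ζ0 hζ0)) (Subtype.ext (h.lT b hb ζ0 hζ0))
    rw [e]
    have hconst : ∀ t, Γ (⟨b, hb⟩, ⟨ζ0, hζ0⟩) t = σ b := by
      have := (T2Space.isSeparatedMap π).eq_of_comp_eq hl.isLocallyInjective (c1 (⟨b, hb⟩, ⟨ζ0, hζ0⟩)) (continuous_const (y := σ b))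
        (by funext t; simp [c2, f, hσπ b hb]) 0 (c3 _)
      exact congrFun this
    exact hconst 1
end
end
end

section
set_option linter.unusedSectionVars false
noncomputable section
section
variable {Z : Type} [TopologicalSpace Z] [T2Space Z] {F : Type} [NormedAddCommGroup F] [NormedSpace ℝ F] [ProperSpace F]
  {Mt : Type} [TopologicalSpace Mt] [T2Space Mt] {q : Z → F} {b0 : F} {δ : ℝ} {Q : Set Z} {Θ : F → ℂ → Z} {l : Z → ℂ} {π : Mt → Z}
  {Q' : Set Z} {Θ' : F → ℂ → Z} {l' : Z → ℂ}

def Sec (π : Mt → Z) (Q : Set Z) (y : Mt) : Prop := ∃ s : Z → Mt, ContinuousOn s Q ∧ (∀ z ∈ Q, π (s z) = z) ∧ s (π y) = y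

theorem Box.preconn (h : Box q b0 δ Q Θ l) {ρ : ℝ} (hρ : ρ ≤ 1) : IsPreconnected (sh Q l ρ) := by
  have e : sh Q l ρ = (fun w : F × ℂ => Θ w.1 w.2) '' (Metric.ball b0 δ ×ˢ Metric.ball 0 ρ) := by
    ext z
    constructor
    · intro hz
      exact ⟨(q z, l z), ⟨h.qm z hz.1, hz.2⟩, h.inv z hz.1⟩
    · rintro ⟨w, hw, rfl⟩
      exact h.T_mem_sh hρ hw.1 hw.2
  rw [e]
  exact ((convex_ball b0 δ).isPreconnected.prod (convex_ball (0:ℂ) ρ).isPreconnected).image _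
    (h.ct.mono (prod_mono le_rfl (Metric.ball_subset_ball hρ)))

theorem sec_unique (hl : IsLocalHomeomorph π) {U : Set Z} (hU : IsPreconnected U) {s t : Z → Mt} (hs : ContinuousOn s U) (ht : ContinuousOn t U)
    (hs' : ∀ z ∈ U, π (s z) = z) (ht' : ∀ z ∈ U, π (t z) = z) {a : Z} (ha : a ∈ U) (e : s a = t a) : ∀ z ∈ U, s z = t z :=
  (T2Space.isSeparatedMap π).eqOn_of_comp_eqOn hl.isLocallyInjective hU hs ht (fun z hz => by simp [hs' z hz, ht' z hz]) ha e

theorem E2 (hl : IsLocalHomeomorph π) (hc : ∀ z, IsCoveringMap (restrictPreimage {x | q x = q z} π)) (hq : Continuous q)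
    (hj : Box q b0 δ Q' Θ' l') 
    (P1 : ∀ b ∈ Metric.ball b0 δ, ∀ b' ∈ Metric.ball b0 δ, ∀ ζ ∈ Metric.closedBall (0:ℂ) (1/2),
        Θ' b ζ ∈ sh Q l (1/2) → Θ' b' ζ ∈ Q) {y : Mt} (h1 : π y ∈ sh Q l (1/2)) (h2 : π y ∈ sh Q' l' (1/2))
    (hs : Sec π Q y) : Sec π Q' y := by
  obtain ⟨s, s1, s2, s3⟩ := hs
  have hb := hj.qm _ h2.1
  have hinv := hj.inv _ h2.1
  have hQ : ∀ b' ∈ Metric.ball b0 δ, Θ' b' (l' (π y)) ∈ Q := fun b' hb' =>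
    P1 _ hb b' hb' _ (Metric.ball_subset_closedBall h2.2) (by rw [hinv]; exact h1)
  obtain ⟨s', a1, a2, a3⟩ := E1 hl hc hq hj (hj.lm _ h2.1) (σ := fun b' => s (Θ' b' (l' (π y))))
    (s1.comp (hj.ct.comp (f := fun b' => (b', l' (π y))) (by fun_prop) fun b' hb' => ⟨hb', hj.lm _ h2.1⟩) hQ)
    (fun b' hb' => s2 _ (hQ b' hb'))
  refine ⟨s', a1, a2, ?_⟩
  have := a3 _ hb
  rw [hinv, s3] at this
  exact this

theorem sec_loc (hl : IsLocalHomeomorph π) (hB : HBox q) (hQ : IsOpen Q) {y : Mt} (hy : π y ∈ Q) :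
    ∀ᶠ y' in 𝓝 y, Sec π Q y' ↔ Sec π Q y := by
  obtain ⟨e, hey, rfl⟩ := hl y
  obtain ⟨d, Q', Θ', l', hb, hsub, hz, -⟩ := hB (e y) (Q ∩ e.target) (inter_mem (hQ.mem_nhds hy) (e.open_target.mem_nhds (e.map_source hey)))
  have hpre := hb.preconn le_rfl
  rw [hb.sh_one] at hpre
  have hev : ∀ᶠ y' in 𝓝 y, e y' ∈ Q' := hl.continuous.continuousAt (hb.op.mem_nhds hz)
  filter_upwards [hev, e.open_source.mem_nhds hey] with y' h1 h2
  have key : ∀ u v : Mt, u ∈ e.source → v ∈ e.source → e u ∈ Q' → e v ∈ Q' → Sec e Q u → Sec e Q v := by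
    rintro u v hu hv huQ hvQ ⟨s, s1, s2, s3⟩
    refine ⟨s, s1, s2, ?_⟩
    have := sec_unique hl hpre (s1.mono fun z hz => (hsub hz).1) (e.continuousOn_symm.mono fun z hz => (hsub hz).2)
      (fun z hz => s2 z (hsub hz).1) (fun z hz => e.right_inv (hsub hz).2) huQ (by rw [s3, e.left_inv hu]) _ hvQ
    rw [this, e.left_inv hv]
  exact ⟨key _ _ h2 hey h1 hz, key _ _ hey h2 hz h1⟩

theorem E5 (hl : IsLocalHomeomorph π) {U : Set Z} (hU : IsOpen U) (hUc : IsPreconnected U) {x0 : Z} (hx0 : x0 ∈ U)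
    (h : ∀ y, π y ∈ U → Sec π U y) : IsEvenlyCovered π x0 (π ⁻¹' {x0}) := by
  have hd : DiscreteTopology (π ⁻¹' {x0}) := by
    rw [discreteTopology_iff_isOpen_singleton]
    intro p
    obtain ⟨e, he, hee⟩ := hl p
    have : ({p} : Set (π ⁻¹' {x0})) = Subtype.val ⁻¹' e.source := by
      ext p'
      constructor
      · rintro rfl; exact he
      · intro hp'
        refine Subtype.ext (e.injOn hp' he ?_)
        rw [← hee]
        exact (show π p' = x0 from p'.2).trans (show π p = x0 from p.2).symm
    rw [this]
    exact e.open_source.preimage continuous_subtype_val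
  choose s s1 s2 s3 using h
  have hpU : ∀ p : π ⁻¹' {x0}, π p.1 ∈ U := fun p => by rw [show π p.1 = x0 from p.2]; exact hx0
  have hp : ∀ p : π ⁻¹' {x0}, s p.1 (hpU p) x0 = p.1 := fun p => by
    have := s3 p.1 (hpU p)
    rwa [show π p.1 = x0 from p.2] at this
  have un : ∀ y hy y' hy' z, z ∈ U → s y hy z = s y' hy' z → ∀ z' ∈ U, s y hy z' = s y' hy' z' := fun y hy y' hy' z hz e =>
    sec_unique hl hUc (s1 _ _) (s1 _ _) (s2 _ _) (s2 _ _) hz e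
  refine ⟨hd, U, hx0, hU, hU.preimage hl.continuous, ⟨⟨fun y => (⟨π y, y.2⟩, ⟨s y.1 y.2 x0, s2 _ _ _ hx0⟩),
    fun w => ⟨s w.2.1 (hpU w.2) w.1, by rw [mem_preimage, s2 _ _ _ w.1.2]; exact w.1.2⟩, ?_, ?_⟩, ?_, ?_⟩, fun y => rfl⟩
  · intro y
    apply Subtype.ext
    dsimp only
    rw [un _ _ y.1 y.2 x0 hx0 (hp ⟨s y.1 y.2 x0, s2 _ _ _ hx0⟩) _ y.2]
    exact s3 _ _
  · rintro ⟨u, p⟩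
    refine Prod.ext (Subtype.ext (s2 _ _ _ u.2)) (Subtype.ext ?_)
    dsimp only
    have h1 : π (s p.1 (hpU p) u) ∈ U := by rw [s2 _ _ _ u.2]; exact u.2
    have h2 := s3 _ h1
    rw [un _ h1 p.1 (hpU p) u u.2 ?_ x0 hx0]
    · exact hp p
    · have e : π (s p.1 (hpU p) u) = u := s2 _ _ _ u.2
      rwa [e] at h2
  · refine Continuous.prodMk ((hl.continuous.comp continuous_subtype_val).subtype_mk _) ?_
    refine (IsLocallyConstant.iff_eventually_eq _ |>.2 fun y => ?_).continuous
    obtain ⟨e, he, hee⟩ := hl y.1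
    have c1 : ContinuousAt (fun y' : π ⁻¹' U => s y.1 y.2 (π y'.1)) y :=
      ContinuousAt.comp (f := fun y' : π ⁻¹' U => π y'.1) ((s1 y.1 y.2).continuousAt (hU.mem_nhds y.2))
        (hl.continuous.comp continuous_subtype_val).continuousAt
    have c2 : ∀ᶠ y' : π ⁻¹' U in 𝓝 y, s y.1 y.2 (π y'.1) ∈ e.source := c1 (e.open_source.mem_nhds (by dsimp only; rw [s3]; exact he))
    have c3 : ∀ᶠ y' : π ⁻¹' U in 𝓝 y, y'.1 ∈ e.source := continuous_subtype_val.continuousAt (e.open_source.mem_nhds he)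
    filter_upwards [c2, c3] with y' h1 h2
    apply Subtype.ext
    refine un _ _ _ _ (π y'.1) y'.2 ?_ x0 hx0
    rw [s3]
    refine (e.injOn h1 h2 ?_).symm
    rw [← hee]
    exact s2 _ _ _ y'.2
  · rw [continuous_prod_of_discrete_right]
    intro p
    refine Continuous.subtype_mk ?_ _
    exact (s1 p.1 (hpU p)).comp_continuous continuous_subtype_val fun u => u.2
end
end
end

section
set_option linter.unusedSectionVars false
noncomputable section
section
variable {E : Type*} [NormedAddCommGroup E] [InnerProductSpace ℂ E] [ProperSpace E]
  {Z : Type} [TopologicalSpace Z] [T2Space Z] {F : Type} [NormedAddCommGroup F] [NormedSpace ℝ F] [ProperSpace F]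
  {Mt : Type} [TopologicalSpace Mt] [T2Space Mt] {q : Z → F} {π : Mt → Z}

theorem good_loc {b0 : F} {δ R : ℝ} {I : Type} {Q : I → Set Z} {Θ : I → F → ℂ → Z} {l : I → Z → ℂ} {ι : Z → E}
    (hl : IsLocalHomeomorph π) (hc : ∀ z, IsCoveringMap (restrictPreimage {x | q x = q z} π)) (hq : Continuous q) (hB : HBox q)
    (hb : ∀ i, Box q b0 δ (Q i) (Θ i) (l i))
    (P0 : ∀ z, q z ∈ Metric.ball b0 δ → ‖ι z‖ ≤ R → ∃ i, z ∈ sh (Q i) (l i) (1/4))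
    (P1 : ∀ i j, ∀ b ∈ Metric.ball b0 δ, ∀ b' ∈ Metric.ball b0 δ, ∀ ζ ∈ Metric.closedBall (0:ℂ) (1/2),
        Θ j b ζ ∈ sh (Q i) (l i) (1/2) → Θ j b' ζ ∈ Q i) {y : Mt} (h1 : q (π y) ∈ Metric.ball b0 δ) (h2 : ‖ι (π y)‖ ≤ R) :
    ∀ᶠ y' in 𝓝 y, (∃ i, π y' ∈ sh (Q i) (l i) (1/2) ∧ Sec π (Q i) y') = (∃ i, π y ∈ sh (Q i) (l i) (1/2) ∧ Sec π (Q i) y) := by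
  obtain ⟨i, hi⟩ := P0 _ h1 h2
  have hi2 := sh_mono (ρ' := 1/2) (by norm_num) hi
  have key : ∀ u, π u ∈ sh (Q i) (l i) (1/2) → ((∃ i, π u ∈ sh (Q i) (l i) (1/2) ∧ Sec π (Q i) u) ↔ Sec π (Q i) u) := fun u hu =>
    ⟨fun ⟨j, hj, hs⟩ => E2 hl hc hq (hb i) (P1 j i) hj hu hs, fun hs => ⟨i, hu, hs⟩⟩
  have ev : ∀ᶠ y' in 𝓝 y, π y' ∈ sh (Q i) (l i) (1/2) := hl.continuous.continuousAt (((hb i).sh_op _).mem_nhds hi2)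
  filter_upwards [ev, sec_loc hl hB (hb i).op hi.1] with y' h3 h4
  rw [key _ h3, key _ hi2, h4]

theorem mainCov (hq : Continuous q) {ι : Z → E} (hι : IsClosedEmbedding ι) (hB : HBox q)
    (hD : ∀ z, DCov (fun x : Fb q (q z) => ι x.1)) (hcn : ∀ z, PreconnectedSpace (Fb q (q z)))
    {r : ℕ} (HI : ∀ z, ∃ φ : Fin r → Fb q (q z) → Fb q (q z) → ℚ, (∀ j, ZC univ (φ j)) ∧
      ∀ a : Fin r → ℚ, BC univ (fun x u => ∑ j, a j * φ j x u) → a = 0)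
    (HII : ∀ z, ∀ φ : Fin (r+1) → Fb q (q z) → Fb q (q z) → ℚ, (∀ j, ZC univ (φ j)) →
      ∃ a : Fin (r+1) → ℚ, a ≠ 0 ∧ BC univ (fun x u => ∑ j, a j * φ j x u))
    (hl : IsLocalHomeomorph π) (hc : ∀ z, IsCoveringMap (restrictPreimage {x | q x = q z} π))
    (hp : ∀ z, PathConnectedSpace ↥(π ⁻¹' {x | q x = q z})) : IsCoveringMap π := by
  intro x0
  have hsurj : ∀ z, Function.Surjective (restrictPreimage {x | q x = q z} π) := fun z => by
    have := hcn z
    have := hp z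
    exact cov_surj (hc z)
  obtain ⟨y0, hy0⟩ : ∃ y0, π y0 = x0 := by
    obtain ⟨y, hy⟩ := hsurj x0 ⟨x0, rfl⟩
    exact ⟨y.1, congrArg Subtype.val hy⟩
  obtain ⟨e, he, hee⟩ := hl y0
  have hO : e.target ∈ 𝓝 x0 := by
    have := e.open_target.mem_nhds (e.map_source he)
    rwa [← hee, hy0] at this
  obtain ⟨φ, hφ, hi⟩ := HI x0
  have := hcn x0
  have := (hD x0).lpc
  obtain ⟨I, -, R, δ, Q, Θ, l, i0, hb, osc, hx0, hR, P0, P1, hOm, hT⟩ := tight hq hι hB (⟨x0, rfl⟩ : Fb q (q x0)) hφ hi hO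
  dsimp only at hx0 hR hOm hT
  have hl0 := (hb i0).lm _ hx0.1
  obtain ⟨s0, a1, a2, a3⟩ := E1 hl hc hq (hb i0) hl0 (σ := fun b => e.symm (Θ i0 b (l i0 x0)))
    (e.continuousOn_symm.comp ((hb i0).ct.comp (f := fun b' => (b', l i0 x0)) (by fun_prop) fun b' hb' => ⟨hb', hl0⟩) hOm)
    (fun b hb => by rw [hee]; exact e.right_inv (hOm b hb))
  refine E5 hl ((hb i0).sh_op (1/2)) ((hb i0).preconn (by norm_num)) (sh_mono (by norm_num) hx0) fun y hy => ?_
  suffices hs : Sec π (Q i0) y by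
    obtain ⟨s, s1, s2, s3⟩ := hs
    exact ⟨s, s1.mono fun z hz => hz.1, fun z hz => s2 z hz.1, s3⟩
  have hbb := (hb i0).qm _ hy.1
  have := hcn (π y)
  have := (hD (π y)).lpc
  have := hp (π y)
  set b := q (π y) with hbdef
  have hne : Nonempty (Fb q b) := ⟨⟨π y, rfl⟩⟩
  have hιb : IsClosedEmbedding (fun x : Fb q b => ι x.1) :=
    hι.comp (IsClosed.isClosedEmbedding_subtypeVal (isClosed_eq hq continuous_const))
  obtain ⟨𝒰, hF⟩ := mkFam hιb (hD (π y)) (hc (π y)) (hsurj (π y))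
  obtain ⟨Φ, hΦ, hΦi⟩ := hT b hbb
  have eS : {x : Fb q b | ‖ι x.1‖ < R} = (fun x : Fb q b => ι x.1) ⁻¹' Metric.ball 0 R := by
    ext x; simp
  rw [eS] at hΦ hΦi
  have hR0 : 0 < R := by linarith [norm_nonneg (ι x0)]
  let z0 : Fb q b := ⟨Θ i0 b (l i0 x0), (hb i0).qT b hbb _ hl0⟩
  have hosc : ∀ z ∈ Q i0, ‖ι z‖ < R := fun z hz => (osc i0 _ hx0.1 z hz).trans hR
  have hz0 : z0 ∈ (fun x : Fb q b => ι x.1) ⁻¹' Metric.ball 0 R := by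
    rw [← eS]; exact hosc _ ((hb i0).mp b hbb _ hl0)
  have hslice : ∀ x : Fb q b, x.1 ∈ Q i0 → x ∈ connectedComponentIn ((fun x : Fb q b => ι x.1) ⁻¹' Metric.ball 0 R) z0 := by
    have h1 := ((hb i0).dch hbb z0).conn.isConnected.isPreconnected
    have h2 := h1.subset_connectedComponentIn (x := z0) (F := (fun x : Fb q b => ι x.1) ⁻¹' Metric.ball 0 R)
      ((hb i0).mp b hbb _ hl0) (by
        rw [← eS]; exact fun x hx => hosc x.1 hx)
    exact fun x hx => h2 hx
  have hπσ : π (e.symm (Θ i0 b (l i0 x0))) = Θ i0 b (l i0 x0) := by rw [hee]; exact e.right_inv (hOm b hbb)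
  have hz0Q := (hb i0).mp b hbb _ hl0
  have hg := partC (w := restrictPreimage {x | q x = b} π) (hc (π y)).isLocalHomeomorph hF hR0 hz0
    (ht_lemma hF hR0 (HII (π y)) hΦ (hΦi z0 rfl))
    (l0 := fun u => ∃ i, π u.1 ∈ sh (Q i) (l i) (1/2) ∧ Sec π (Q i) u.1)
    (by
      intro u hu
      have hu1 := connectedComponentIn_subset _ _ hu
      rw [← eS] at hu1
      have hub : q (π u.1) = b := u.2
      exact continuous_subtype_val.continuousAt (good_loc hl hc hq hB hb P0 P1 (y := u.1) (by rw [hub]; exact hbb) (le_of_lt hu1)))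
    (y1 := ⟨e.symm (Θ i0 b (l i0 x0)), by
      rw [mem_preimage, hπσ]; exact (hb i0).qT b hbb _ hl0⟩) (y2 := ⟨y, rfl⟩)
    (hslice _ (show π _ ∈ Q i0 by rw [hπσ]; exact hz0Q)) (hslice _ (show π _ ∈ Q i0 from hy.1))
    ⟨i0, by
      dsimp only; rw [hπσ]
      exact (hb i0).T_mem_sh (by norm_num) hbb (Metric.ball_subset_ball (by norm_num) hx0.2), s0, a1, a2, by
      dsimp only; rw [hπσ]; exact a3 b hbb⟩
  obtain ⟨j, hj, hs⟩ := hg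
  exact E2 hl hc hq (hb i0) (P1 j i0) hj hy hs
end
end
end

section
set_option linter.unusedSectionVars false
noncomputable section
section
theorem holo_c1 {E G : Type} [NormedAddCommGroup E] [NormedSpace ℂ E] [FiniteDimensional ℂ E] [NormedAddCommGroup G] [NormedSpace ℂ G]
    {f : E → G} {U : Set E} (hU : IsOpen U) (hf : DifferentiableOn ℂ f U) {x : E} (hx : x ∈ U) : ContDiffAt ℂ 1 f x := by
  have : ProperSpace E := FiniteDimensional.proper ℂ E
  suffices h : ContDiffOn ℂ 1 f U from h.contDiffAt (hU.mem_nhds hx)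
  rw [show (1 : WithTop ℕ∞) = 0 + 1 by simp, contDiffOn_succ_iff_fderiv_of_isOpen hU]
  refine ⟨hf, by simp, contDiffOn_zero.2 (continuousOn_clm_apply.2 fun v => ?_)⟩
  intro x hx
  apply ContinuousAt.continuousWithinAt
  obtain ⟨r0, hr0, hrU⟩ := Metric.isOpen_iff.1 hU x hx
  set r := r0 / 4 with hr
  have hrp : 0 < r := by positivity
  have hUC := (isCompact_closedBall x (2*r)).uniformContinuousOn_of_continuous (hf.continuousOn.mono
    ((Metric.closedBall_subset_ball (by linarith)).trans hrU))
  set ρ := r / (1 + ‖v‖) with hρ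
  have hv : 0 < 1 + ‖v‖ := by positivity
  have hρp : 0 < ρ := by positivity
  have hρv : ρ * ‖v‖ ≤ r := by
    rw [hρ, div_mul_eq_mul_div, div_le_iff₀ hv]; nlinarith [norm_nonneg v]
  have hmem : ∀ y ∈ Metric.ball x r, ∀ ζ ∈ Metric.closedBall (0:ℂ) ρ, y + ζ • v ∈ Metric.closedBall x (2*r) := by
    intro y hy ζ hζ
    rw [Metric.mem_closedBall, dist_eq_norm]
    rw [Metric.mem_ball, dist_eq_norm] at hy
    have h1 : ‖ζ‖ ≤ ρ := by simpa using hζ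
    calc ‖y + ζ • v - x‖ = ‖(y - x) + ζ • v‖ := by congr 1; abel
      _ ≤ ‖y - x‖ + ‖ζ‖ * ‖v‖ := (norm_add_le _ _).trans (by rw [norm_smul])
      _ ≤ r + ρ * ‖v‖ := by gcongr
      _ ≤ 2 * r := by linarith
  have hmemU : ∀ y ∈ Metric.ball x r, ∀ ζ ∈ Metric.closedBall (0:ℂ) ρ, y + ζ • v ∈ U := fun y hy ζ hζ =>
    hrU (Metric.closedBall_subset_ball (by linarith) (hmem y hy ζ hζ))
  have hderiv : ∀ y ∈ Metric.ball x r, ∀ ζ ∈ Metric.closedBall (0:ℂ) ρ,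
      HasDerivAt (fun ζ : ℂ => f (y + ζ • v)) (fderiv ℂ f (y + ζ • v) v) ζ := by
    intro y hy ζ hζ
    have h1 : HasDerivAt (fun ζ : ℂ => y + ζ • v) v ζ := by
      simpa using ((hasDerivAt_id ζ).smul_const v).const_add y
    exact ((hf.differentiableAt (hU.mem_nhds (hmemU y hy ζ hζ))).hasFDerivAt.comp_hasDerivAt ζ h1)
  rw [Metric.continuousAt_iff]
  intro ε hε
  obtain ⟨η, hη, hη'⟩ := Metric.uniformContinuousOn_iff.1 hUC (ε * ρ / 2) (by positivity)
  refine ⟨min η r, lt_min hη hrp, fun y hy => ?_⟩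
  have hyr : y ∈ Metric.ball x r := lt_of_lt_of_le hy (min_le_right _ _)
  have hxr : x ∈ Metric.ball x r := Metric.mem_ball_self hrp
  have h0 : (0:ℂ) ∈ Metric.closedBall (0:ℂ) ρ := Metric.mem_closedBall_self hρp.le
  have hd : ∀ ζ ∈ Metric.closedBall (0:ℂ) ρ, HasDerivAt (fun ζ : ℂ => f (y + ζ • v) - f (x + ζ • v))
      (fderiv ℂ f (y + ζ • v) v - fderiv ℂ f (x + ζ • v) v) ζ := fun ζ hζ => (hderiv y hyr ζ hζ).sub (hderiv x hxr ζ hζ)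
  have key := Complex.norm_deriv_le_of_forall_mem_sphere_norm_le (c := 0) (R := ρ) (C := ε * ρ / 2)
    (f := fun ζ : ℂ => f (y + ζ • v) - f (x + ζ • v)) hρp
    (DifferentiableOn.diffContOnCl (by
      rw [closure_ball _ hρp.ne']
      exact fun ζ hζ => (hd ζ hζ).differentiableAt.differentiableWithinAt)) (by
      intro ζ hζ
      have hζ' := Metric.sphere_subset_closedBall hζ
      have := hη' _ (hmem y hyr ζ hζ') _ (hmem x hxr ζ hζ') (by
        rw [dist_add_right]; exact lt_of_lt_of_le hy (min_le_left _ _))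
      rw [dist_eq_norm] at this
      exact this.le)
  rw [(hd 0 h0).deriv] at key
  simp only [zero_smul, add_zero] at key
  rw [dist_eq_norm]
  have : ε * ρ / 2 / ρ = ε / 2 := by field_simp
  rw [this] at key
  linarith

theorem lin_complete {E G H : Type} [NormedAddCommGroup E] [NormedSpace ℂ E] [FiniteDimensional ℂ E]
    [NormedAddCommGroup G] [NormedSpace ℂ G] [FiniteDimensional ℂ G] [NormedAddCommGroup H] [NormedSpace ℂ H] [FiniteDimensional ℂ H]
    (A : E →L[ℂ] G) (B : E →L[ℂ] H) (hA : Function.Surjective A)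
    (hB : Submodule.map B.toLinearMap (LinearMap.ker A.toLinearMap) = ⊤)
    (hd : Module.finrank ℂ E = Module.finrank ℂ G + Module.finrank ℂ H + 1) :
    ∃ (ℓ : E →L[ℂ] ℂ) (L : E ≃L[ℂ] G × H × ℂ), (L : E →L[ℂ] G × H × ℂ) = A.prod (B.prod ℓ) := by
  have hs : Function.Surjective (A.prod B) := by
    rintro ⟨a, b⟩
    obtain ⟨x, hx⟩ := hA a
    have : b - B x ∈ Submodule.map B.toLinearMap (LinearMap.ker A.toLinearMap) := by rw [hB]; trivial
    obtain ⟨y, hy, hy'⟩ := this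
    refine ⟨x + y, ?_⟩
    have h1 : A y = 0 := hy
    have h2 : B y = b - B x := hy'
    simp [h1, h2, hx]
  have hk : Module.finrank ℂ (LinearMap.ker (A.prod B).toLinearMap) = 1 := by
    have h1 := LinearMap.finrank_range_add_finrank_ker (A.prod B).toLinearMap
    rw [LinearMap.range_eq_top.2 hs, finrank_top, Module.finrank_prod] at h1
    omega
  obtain ⟨v, hv, hvs⟩ := finrank_eq_one_iff'.1 hk
  obtain ⟨ℓ, hℓ⟩ := SeparatingDual.exists_ne_zero (R := ℂ) (x := v.1) (fun h => hv (Subtype.ext h))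
  have hinj : Function.Injective (A.prod (B.prod ℓ)).toLinearMap := by
    rw [← LinearMap.ker_eq_bot, Submodule.eq_bot_iff]
    intro w hw
    have hw' : (A w, B w, ℓ w) = 0 := hw
    simp only [Prod.mk_eq_zero] at hw'
    obtain ⟨c, hc⟩ := hvs ⟨w, show (A w, B w) = 0 by simp [hw'.1, hw'.2.1]⟩
    have hc' : c • v.1 = w := congrArg Subtype.val hc
    have h3 := hw'.2.2
    rw [← hc', map_smul, smul_eq_mul, mul_eq_zero] at h3
    rcases h3 with h3 | h3
    · rw [← hc', h3, zero_smul]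
    · exact absurd h3 hℓ
  refine ⟨ℓ, (LinearMap.linearEquivOfInjective _ hinj (by simp [Module.finrank_prod, hd]; ring)).toContinuousLinearEquiv, ?_⟩
  ext w <;> rfl
end
end
end

section
set_option linter.unusedSectionVars false
noncomputable section
section
theorem box_ift {E G E' : Type} [NormedAddCommGroup E] [NormedSpace ℂ E] [FiniteDimensional ℂ E]
    [NormedAddCommGroup G] [NormedSpace ℂ G] [FiniteDimensional ℂ G] [NormedAddCommGroup E'] [NormedSpace ℂ E'] {n : ℕ}
    (Λ : E →L[ℂ] E') {M : Set E} {p : E → (Fin n → ℂ)} {U : Set E} (hU : IsOpen U) (hMU : M ⊆ U) (hp : DifferentiableOn ℂ p U)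
    (x : ↥M) {V : Set E} (hV : IsOpen V) (hxV : x.1 ∈ V) {g : E → G} (hg : DifferentiableOn ℂ g V)
    (hgs : Function.Surjective (fderiv ℂ g x.1)) (hMV : M ∩ V = {y ∈ V | g y = 0})
    (hsub : Submodule.map (fderiv ℂ p x.1).toLinearMap (LinearMap.ker (fderiv ℂ g x.1).toLinearMap) = ⊤)
    (hd : Module.finrank ℂ E = Module.finrank ℂ G + n + 1) {O : Set ↥M} (hO : O ∈ 𝓝 x) :
    ∃ δ Q Θ l, Box (fun z : ↥M => p z.1) (p x.1) δ Q Θ l ∧ Q ⊆ O ∧ x ∈ Q ∧ l x = 0 ∧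
      ∀ b ∈ Metric.ball (p x.1) δ, DifferentiableOn ℂ (fun ζ => Λ (Θ b ζ).1) (Metric.ball 0 1) := by
  classical
  have : CompleteSpace E := FiniteDimensional.complete ℂ E
  have : CompleteSpace G := FiniteDimensional.complete ℂ G
  have hxU := hMU x.2
  have hgx : g x.1 = 0 := by
    have : x.1 ∈ M ∩ V := ⟨x.2, hxV⟩
    rw [hMV] at this; exact this.2
  obtain ⟨ℓ, L, hL⟩ := lin_complete (fderiv ℂ g x.1) (fderiv ℂ p x.1) hgs hsub (by simpa using hd)
  let Ψ : E → G × (Fin n → ℂ) × ℂ := fun y => (g y, p y, ℓ (y - x.1))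
  have hΨ1 : ContDiffAt ℂ 1 Ψ x.1 := (holo_c1 hV hg hxV).prodMk ((holo_c1 hU hp hxU).prodMk (by fun_prop))
  have hΨ2 : HasFDerivAt Ψ (L : E →L[ℂ] G × (Fin n → ℂ) × ℂ) x.1 := by
    rw [hL]
    refine ((hg.differentiableAt (hV.mem_nhds hxV)).hasFDerivAt).prodMk
      (((hp.differentiableAt (hU.mem_nhds hxU)).hasFDerivAt).prodMk ?_)
    exact ℓ.hasFDerivAt.comp x.1 ((hasFDerivAt_id x.1).sub_const x.1)
  let e := hΨ1.toOpenPartialHomeomorph Ψ hΨ2 one_ne_zero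
  have hxe : x.1 ∈ e.source := hΨ1.mem_toOpenPartialHomeomorph_source hΨ2 one_ne_zero
  have hee : ∀ y, e y = (g y, p y, ℓ (y - x.1)) := fun y => rfl
  have hex : e x.1 = (0, p x.1, 0) := by rw [hee]; simp [hgx]
  have hinvc : ContDiffAt ℂ 1 e.symm (e x.1) := hΨ1.to_localInverse hΨ2 one_ne_zero
  have hev1 : ∀ᶠ w in 𝓝 (e x.1), DifferentiableAt ℂ e.symm w :=
    (hinvc.eventually (by simp)).mono fun w hw => hw.differentiableAt (by simp)
  obtain ⟨O', hO'1, hO'2⟩ := mem_nhds_subtype _ _ _ |>.1 hO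
  have hev2 : ∀ᶠ w in 𝓝 (e x.1), e.symm w ∈ V ∩ O' :=
    (e.tendsto_symm hxe) (inter_mem (hV.mem_nhds hxV) hO'1)
  obtain ⟨ε, hε, hball⟩ := Metric.eventually_nhds_iff_ball.1 ((hev1.and hev2).and (e.open_target.mem_nhds (e.map_source hxe)))
  rw [hex] at hball
  have hW : ∀ b ∈ Metric.ball (p x.1) ε, ∀ ζ ∈ Metric.ball (0:ℂ) ε, ((0, b, ζ) : G × (Fin n → ℂ) × ℂ) ∈ Metric.ball (0, p x.1, 0) ε := by
    intro b hb ζ hζ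
    rw [← ball_prod_same, ← ball_prod_same]
    exact ⟨Metric.mem_ball_self hε, hb, hζ⟩
  have hsc : ∀ ζ ∈ Metric.ball (0:ℂ) 1, (ε:ℂ) * ζ ∈ Metric.ball (0:ℂ) ε := by
    intro ζ hζ
    rw [mem_ball_zero_iff] at *
    rw [norm_mul, Complex.norm_real, Real.norm_of_nonneg hε.le]
    nlinarith
  have hεc : (ε:ℂ) ≠ 0 := by exact_mod_cast hε.ne'
  have hsc' : ∀ ζ ∈ Metric.ball (0:ℂ) 1, ∀ b ∈ Metric.ball (p x.1) ε, ((0, b, (ε:ℂ) * ζ) : G × (Fin n → ℂ) × ℂ) ∈ Metric.ball (0, p x.1, 0) ε :=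
    fun ζ hζ b hb => hW b hb _ (hsc ζ hζ)
  have T0 : ∀ b ∈ Metric.ball (p x.1) ε, ∀ ζ ∈ Metric.ball (0:ℂ) 1, e.symm (0, b, (ε:ℂ) * ζ) ∈ M ∩ V := by
    intro b hb ζ hζ
    have h1 := hball _ (hsc' ζ hζ b hb)
    rw [hMV]
    refine ⟨h1.1.2.1, ?_⟩
    have h2 := e.right_inv h1.2
    rw [hee] at h2
    exact congrArg Prod.fst h2
  let Θ : (Fin n → ℂ) → ℂ → ↥M := fun b ζ => if h : e.symm (0, b, (ε:ℂ) * ζ) ∈ M then ⟨_, h⟩ else x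
  have T1 : ∀ b ∈ Metric.ball (p x.1) ε, ∀ ζ ∈ Metric.ball (0:ℂ) 1, (Θ b ζ).1 = e.symm (0, b, (ε:ℂ) * ζ) := by
    intro b hb ζ hζ
    simp only [Θ]
    rw [dif_pos (T0 b hb ζ hζ).1]
  have T2 : ∀ b ∈ Metric.ball (p x.1) ε, ∀ ζ ∈ Metric.ball (0:ℂ) 1, e (Θ b ζ).1 = (0, b, (ε:ℂ) * ζ) := by
    intro b hb ζ hζ
    rw [T1 b hb ζ hζ]; exact e.right_inv (hball _ (hsc' ζ hζ b hb)).2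
  have hpc : Continuous fun z : ↥M => p z.1 := hp.continuousOn.comp_continuous continuous_subtype_val fun z => hMU z.2
  let l : ↥M → ℂ := fun z => (ε:ℂ)⁻¹ * ℓ (z.1 - x.1)
  have hlc : Continuous l := by fun_prop
  let Q : Set ↥M := Subtype.val ⁻¹' (e.source ∩ V) ∩ ((fun z : ↥M => p z.1) ⁻¹' Metric.ball (p x.1) ε ∩ l ⁻¹' Metric.ball 0 1)
  have lT : ∀ b ∈ Metric.ball (p x.1) ε, ∀ ζ ∈ Metric.ball (0:ℂ) 1, l (Θ b ζ) = ζ := by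
    intro b hb ζ hζ
    have := T2 b hb ζ hζ
    rw [hee] at this
    have h3 : ℓ ((Θ b ζ).1 - x.1) = (ε:ℂ) * ζ := congrArg (fun w => w.2.2) this
    simp only [l]
    rw [h3]; field_simp
  have qT : ∀ b ∈ Metric.ball (p x.1) ε, ∀ ζ ∈ Metric.ball (0:ℂ) 1, p (Θ b ζ).1 = b := by
    intro b hb ζ hζ
    have := T2 b hb ζ hζ
    rw [hee] at this
    exact congrArg (fun w => w.2.1) this
  have hze : ∀ z ∈ Q, e z.1 = (0, p z.1, (ε:ℂ) * l z) := by
    intro z hz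
    have h1 : z.1 ∈ M ∩ V := ⟨z.2, hz.1.2⟩
    rw [hMV] at h1
    rw [hee, h1.2]
    simp only [l]
    congr 2
    field_simp
  have hinv : ∀ z ∈ Q, e.symm (0, p z.1, (ε:ℂ) * l z) = z.1 := fun z hz => by
    rw [← hze z hz]; exact e.left_inv hz.1.1
  have hdf : ∀ b ∈ Metric.ball (p x.1) ε, ∀ ζ ∈ Metric.ball (0:ℂ) 1, DifferentiableAt ℂ e.symm (0, b, (ε:ℂ) * ζ) := fun b hb ζ hζ =>
    (hball _ (hsc' ζ hζ b hb)).1.1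
  refine ⟨ε, Q, Θ, l, ⟨hε, ?_, ?_, ?_, qT, lT, hlc.continuousOn, fun z hz => hz.2.1, fun z hz => hz.2.2, ?_⟩, ?_, ?_, ?_, ?_⟩
  · exact ((e.open_source.inter hV).preimage continuous_subtype_val).inter
      ((Metric.isOpen_ball.preimage hpc).inter (Metric.isOpen_ball.preimage hlc))
  · rw [Topology.IsInducing.subtypeVal.continuousOn_iff]
    have : ContinuousOn (fun w : (Fin n → ℂ) × ℂ => e.symm (0, w.1, (ε:ℂ) * w.2)) (Metric.ball (p x.1) ε ×ˢ Metric.ball 0 1) := by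
      intro w hw
      apply ContinuousAt.continuousWithinAt
      exact ContinuousAt.comp (f := fun w : (Fin n → ℂ) × ℂ => ((0, w.1, (ε:ℂ) * w.2) : G × (Fin n → ℂ) × ℂ))
        (hdf w.1 hw.1 w.2 hw.2).continuousAt (by fun_prop)
    exact this.congr fun w hw => T1 w.1 hw.1 w.2 hw.2
  · intro b hb ζ hζ
    refine ⟨⟨?_, ?_⟩, ?_, ?_⟩
    · rw [T1 b hb ζ hζ]; exact e.map_target (hball _ (hsc' ζ hζ b hb)).2
    · rw [T1 b hb ζ hζ]; exact (T0 b hb ζ hζ).2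
    · rw [mem_preimage, qT b hb ζ hζ]; exact hb
    · rw [mem_preimage, lT b hb ζ hζ]; exact hζ
  · intro z hz
    apply Subtype.ext
    rw [T1 _ hz.2.1 _ hz.2.2]
    exact hinv z hz
  · intro z hz
    apply hO'2
    have := (hball _ (hsc' _ hz.2.2 _ hz.2.1)).1.2.2
    rw [hinv z hz] at this
    exact this
  · refine ⟨⟨hxe, hxV⟩, Metric.mem_ball_self hε, ?_⟩
    simp [l]
  · simp [l]
  · intro b hb ζ hζ
    have h1 : DifferentiableAt ℂ (fun ζ : ℂ => Λ (e.symm (0, b, (ε:ℂ) * ζ))) ζ := by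
      refine Λ.differentiableAt.comp ζ (DifferentiableAt.comp (f := fun ζ : ℂ => ((0, b, (ε:ℂ) * ζ) : G × (Fin n → ℂ) × ℂ)) ζ (hdf b hb ζ hζ) ?_)
      fun_prop
    exact h1.differentiableWithinAt.congr (fun ζ' hζ' => by rw [T1 b hb ζ' hζ']) (by rw [T1 b hb ζ hζ])
end
end
end

section
set_option linter.unusedSectionVars false
noncomputable section
section
theorem DCh.gch {X : Type} [TopologicalSpace X] {T : Set X} {e : ℂ → X} {c : X → ℂ} (h : DCh T e c) :
    Continuous (fun w : ℂ => e (((1 + ‖w‖ : ℝ) : ℂ)⁻¹ * w)) ∧ ContinuousOn (fun x => ((1 - ‖c x‖ : ℝ) : ℂ)⁻¹ * c x) T ∧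
      ∀ u ∈ T, e (((1 + ‖((1 - ‖c u‖ : ℝ) : ℂ)⁻¹ * c u‖ : ℝ) : ℂ)⁻¹ * (((1 - ‖c u‖ : ℝ) : ℂ)⁻¹ * c u)) = u := by
  refine ⟨?_, ?_, ?_⟩
  · refine h.ec.comp_continuous ?_ ?_
    · refine Continuous.mul (Continuous.inv₀ (by fun_prop) fun w => ?_) continuous_id
      have : (0:ℝ) < 1 + ‖w‖ := by positivity
      exact_mod_cast this.ne'
    · intro w
      have : (0:ℝ) < 1 + ‖w‖ := by positivity
      rw [mem_ball_zero_iff, norm_mul, norm_inv, Complex.norm_real, Real.norm_of_nonneg this.le, inv_mul_lt_iff₀ this]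
      linarith
  · have hc := h.cc
    refine ContinuousOn.mul (ContinuousOn.inv₀ (by fun_prop) fun x hx => ?_) hc
    have := h.cm hx
    rw [mem_ball_zero_iff] at this
    have : (0:ℝ) < 1 - ‖c x‖ := by linarith
    exact_mod_cast this.ne'
  · intro u hu
    have h1 := h.cm hu
    rw [mem_ball_zero_iff] at h1
    have h2 : (0:ℝ) < 1 - ‖c u‖ := by linarith
    have h3 : (1 + ‖((1 - ‖c u‖ : ℝ) : ℂ)⁻¹ * c u‖ : ℝ) = (1 - ‖c u‖)⁻¹ := by
      rw [norm_mul, norm_inv, Complex.norm_real, Real.norm_of_nonneg h2.le]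
      field_simp; ring
    rw [h3]
    have h4 : ((1 - ‖c u‖ : ℝ) : ℂ) ≠ 0 := by exact_mod_cast h2.ne'
    rw [Complex.ofReal_inv, inv_inv, mul_inv_cancel_left₀ h4]
    exact h.inv u hu

variable {Z : Type} [TopologicalSpace Z] [T2Space Z] {F : Type} [NormedAddCommGroup F] [NormedSpace ℝ F] [ProperSpace F]
  {E : Type} [NormedAddCommGroup E] [InnerProductSpace ℂ E] [ProperSpace E] {q : Z → F}

theorem DCov_of {ι : Z → E}
    (hS : ∀ z : Z, ∀ O ∈ 𝓝 z, ∃ δ Q Θ l, Box q (q z) δ Q Θ l ∧ Q ⊆ O ∧ z ∈ Q ∧ l z = 0 ∧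
      ∀ b ∈ Metric.ball (q z) δ, DifferentiableOn ℂ (fun ζ => ι (Θ b ζ)) (Metric.ball 0 1)) (b : F) :
    DCov (fun x : Fb q b => ι x.1) := by
  intro x U hU
  obtain ⟨O, hO1, hO2⟩ := mem_nhds_subtype _ _ _ |>.1 hU
  obtain ⟨δ, Q, Θ, l, hb, hQ, hz, -, hd⟩ := hS x.1 O hO1
  have hx : q x.1 = b := x.2
  rw [hx] at hb hd
  refine ⟨_, _, _, hb.dch hb.b0m x, hz, fun y hy => hO2 (hQ hy), ?_⟩
  exact (hd b hb.b0m).congr fun ζ hζ => by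
    simp only [Function.comp]
    rw [hb.slE_eq hb.b0m x hζ]

theorem GCh_of {X Y : Type} [TopologicalSpace X] [TopologicalSpace Y] {ι : X → E} (hD : DCov ι) (h : X ≃ₜ Y) : GCh Y := by
  intro y
  obtain ⟨T, e, c, hc, hx, -, -⟩ := hD (h.symm y) univ univ_mem
  obtain ⟨a1, a2, a3⟩ := hc.gch
  refine ⟨h.symm ⁻¹' T, fun w => h (e (((1 + ‖w‖ : ℝ) : ℂ)⁻¹ * w)), fun u => ((1 - ‖c (h.symm u)‖ : ℝ) : ℂ)⁻¹ * c (h.symm u),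
    hc.op.preimage h.symm.continuous, hx, h.continuous.comp a1, a2.comp h.symm.continuous.continuousOn fun u hu => hu, fun u hu => ?_⟩
  have := a3 _ hu
  dsimp only
  rw [this, h.apply_symm_apply]

theorem BC.homeo {X Y : Type} [TopologicalSpace X] [TopologicalSpace Y] (h : X ≃ₜ Y) {φ : Y → Y → ℚ} (hb : BC univ φ) :
    BC univ (fun s t => φ (h s) (h t)) := by
  obtain ⟨f, hf⟩ := hb
  exact ⟨_, hf.comp isOpen_univ h.continuous.continuousOn (mapsTo_univ _ _)⟩

theorem ZC.homeo {X Y : Type} [TopologicalSpace X] [TopologicalSpace Y] (h : X ≃ₜ Y) {φ : Y → Y → ℚ} (hb : ZC univ φ) :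
    ZC univ (fun s t => φ (h s) (h t)) := hb.comp isOpen_univ h.continuous.continuousOn (mapsTo_univ _ _)

theorem HI_of {X Y : Type} [TopologicalSpace X] [TopologicalSpace Y] {ι : X → E} (hD : DCov ι) (h : X ≃ₜ Y) {r : ℕ}
    (h1 : FiniteBetti Y 1) (h2 : bettiNumber Y 1 = r) : ∃ φ : Fin r → X → X → ℚ, (∀ j, ZC univ (φ j)) ∧
      ∀ a : Fin r → ℚ, BC univ (fun x u => ∑ j, a j * φ j x u) → a = 0 := by
  obtain ⟨φ, p1, p2⟩ := F_I (GCh_of hD h) r h1 h2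
  refine ⟨fun j s t => φ j (h s) (h t), fun j => (p1 j).homeo h, fun a ha => p2 a ?_⟩
  simpa using ha.homeo h.symm

theorem HII_of {X Y : Type} [TopologicalSpace X] [TopologicalSpace Y] [PathConnectedSpace Y] {ι : X → E} (hD : DCov ι) (h : X ≃ₜ Y) {r : ℕ}
    (h1 : FiniteBetti Y 1) (h2 : bettiNumber Y 1 = r) (φ : Fin (r+1) → X → X → ℚ) (hφ : ∀ j, ZC univ (φ j)) :
      ∃ a : Fin (r+1) → ℚ, a ≠ 0 ∧ BC univ (fun x u => ∑ j, a j * φ j x u) := by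
  obtain ⟨a, ha, hb⟩ := F_II (GCh_of hD h) r h1 h2 (fun j s t => φ j (h.symm s) (h.symm t)) (fun j => (hφ j).homeo h.symm)
  exact ⟨a, ha, by simpa using hb.homeo h⟩
end
end
end

/-- Let `p : M → B` be a surjective holomorphic submersion from a
connected Stein manifold `M ⊆ ℂ^N` of dimension `n+1` to a connected open `B ⊆ ℂ^n`,
all of whose fibres are connected with the same finite first Betti number. If
`π : M̃ → M` is a local homeomorphism from a Hausdorff space which restricts over each
fibre of `p` to its universal covering, then `π` is a covering map. -/
theorem statement5 (N n : ℕ) (hn : 1 ≤ n) (hNn : n + 1 ≤ N)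
    (M : Set (Fin N → ℂ)) (hMstein : IsSteinSubmanifold N (n + 1) M)
    (hMconn : IsConnected M)
    (B : Set (Fin n → ℂ)) (hBopen : IsOpen B) (hBconn : IsConnected B)
    (p : (Fin N → ℂ) → (Fin n → ℂ))
    (hphol : ∃ U, IsOpen U ∧ M ⊆ U ∧ DifferentiableOn ℂ p U)
    (hpmaps : Set.MapsTo p M B)
    (hsub : ∀ x ∈ M, SubmersionAt (N - (n + 1)) M p x)
    (hsurj : ∀ b ∈ B, (M ∩ p ⁻¹' {b}).Nonempty)
    (b1 : ℕ)
    (hfib : ∀ b ∈ B, IsConnected (M ∩ p ⁻¹' {b}) ∧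
      FiniteBetti ↥(M ∩ p ⁻¹' {b}) 1 ∧ bettiNumber ↥(M ∩ p ⁻¹' {b}) 1 = b1)
    (Mt : Type) [TopologicalSpace Mt] [T2Space Mt]
    (π : Mt → ↥M) (hloc : IsLocalHomeomorph π)
    (hfibres : ∀ b ∈ B,
      (π ⁻¹' {x : ↥M | p x.val = b}).Nonempty ∧
      IsConnected (π ⁻¹' {x : ↥M | p x.val = b}) ∧
      SimplyConnectedSpace ↥(π ⁻¹' {x : ↥M | p x.val = b}) ∧
      IsCoveringMap (Set.restrictPreimage {x : ↥M | p x.val = b} π)) :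
    IsCoveringMap π := by
  obtain ⟨U, hU, hMU, hp⟩ := hphol
  let Λ : (Fin N → ℂ) →L[ℂ] EuclideanSpace ℂ (Fin N) := ((EuclideanSpace.equiv (Fin N) ℂ).symm : (Fin N → ℂ) →L[ℂ] EuclideanSpace ℂ (Fin N))
  let q : ↥M → (Fin n → ℂ) := fun z => p z.1
  have hq : Continuous q := (hp.continuousOn.mono hMU).restrict
  let ι : ↥M → EuclideanSpace ℂ (Fin N) := fun z => Λ z.1
  have hι : Topology.IsClosedEmbedding ι :=
    (EuclideanSpace.equiv (Fin N) ℂ).symm.toHomeomorph.isClosedEmbedding.comp hMstein.1.isClosedEmbedding_subtypeVal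
  have hS : ∀ z : ↥M, ∀ O ∈ 𝓝 z, ∃ δ Q Θ l, Box q (q z) δ Q Θ l ∧ Q ⊆ O ∧ z ∈ Q ∧ l z = 0 ∧
      ∀ b ∈ Metric.ball (q z) δ, DifferentiableOn ℂ (fun ζ => ι (Θ b ζ)) (Metric.ball 0 1) := by
    intro z O hO
    obtain ⟨V, g, ⟨hV, hxV, hg, hgs, hMV⟩, hs⟩ := hsub z.1 z.2
    have hz : g z.1 = 0 := by
      have : z.1 ∈ M ∩ V := ⟨z.2, hxV⟩
      rw [hMV] at this
      exact this.2
    refine box_ift Λ hU hMU hp z hV hxV hg (hgs _ hxV hz) hMV hs ?_ hO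
    simp only [Module.finrank_fin_fun]
    omega
  have hB : HBox q := fun z O hO => by
    obtain ⟨δ, Q, Θ, l, h1, h2, h3, h4, -⟩ := hS z O hO
    exact ⟨δ, Q, Θ, l, h1, h2, h3, h4⟩
  have hD : ∀ b, DCov (fun x : Fb q b => ι x.1) := fun b => DCov_of hS b
  let H : ∀ b, Fb q b ≃ₜ ↥(M ∩ p ⁻¹' {b}) := fun b =>
    { toFun := fun z => ⟨z.1.1, z.1.2, z.2⟩
      invFun := fun s => ⟨⟨s.1, s.2.1⟩, s.2.2⟩
      left_inv := fun _ => rfl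
      right_inv := fun _ => rfl
      continuous_toFun := by fun_prop
      continuous_invFun := by fun_prop }
  have hcn : ∀ z, ConnectedSpace (Fb q (q z)) := fun z => by
    haveI := isConnected_iff_connectedSpace.1 (hfib _ (hpmaps z.2)).1
    exact (H (q z)).symm.surjective.connectedSpace (H (q z)).symm.continuous
  have hpc : ∀ z, PathConnectedSpace ↥(M ∩ p ⁻¹' {q z}) := fun z => by
    haveI := hcn z
    haveI := (hD (q z)).lpc
    haveI : PathConnectedSpace (Fb q (q z)) := pathConnectedSpace_iff_connectedSpace.2 inferInstance
    exact (H (q z)).surjective.pathConnectedSpace (H (q z)).continuous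
  refine mainCov (r := b1) hq hι hB (fun z => hD _) (fun z => (hcn z).toPreconnectedSpace) (fun z => ?_) (fun z φ hφ => ?_) hloc
    (fun z => (hfibres _ (hpmaps z.2)).2.2.2) (fun z => ?_)
  · exact HI_of (hD _) (H (q z)) (hfib _ (hpmaps z.2)).2.1 (hfib _ (hpmaps z.2)).2.2
  · haveI := hpc z
    exact HII_of (hD _) (H (q z)) (hfib _ (hpmaps z.2)).2.1 (hfib _ (hpmaps z.2)).2.2 φ hφ
  · haveI := (hfibres _ (hpmaps z.2)).2.2.1
    exact (inferInstance : PathConnectedSpace ↥(π ⁻¹' {x : ↥M | p x.val = p z.1}))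

end
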